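/- Let Φ_1, …, Φ_n ∈ 𝔠(H) with X_i = ran Φ_i, and let U_1, …, U_n ⊆ B(K) be weak* closed subspaces such that for every non-empty subset E = {i_1, …, i_m} of {1, …, n}, the weak* closure U_E of U_{i_1} + ⋯ + U_{i_m} is completely hyperreflexive. Then the weak* closed span W of X_1 ⊗ U_1 + ⋯ + X_n ⊗ U_n in B(H⊗K) is completely hyperreflexive. -/

import Mathlib

open scoped InnerProductSpace Pointwise

noncomputable section

namespace SchurHyper

/-- `B H` is the algebra of bounded linear operators on `H`. -/
abbrev B (H : Type*) [NormedAddCommGroup H] [InnerProductSpace ℂ H] : Type _ := H →L[ℂ] H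

variable (H : Type*) [NormedAddCommGroup H] [InnerProductSpace ℂ H]

/-- A linear functional on `B H` is *normal* (weak* continuous) if it arises from
the duality with the trace class, i.e. it is of the form
`T ↦ ∑ₙ ⟪yₙ, T xₙ⟫` for square-summable sequences `(xₙ)`, `(yₙ)`
(recall that the inner product is conjugate-linear in its first slot). -/
def IsNormalFunctional (ω : B H →ₗ[ℂ] ℂ) : Prop :=
  ∃ x y : ℕ → H, Summable (fun n => ‖x n‖ ^ 2) ∧ Summable (fun n => ‖y n‖ ^ 2) ∧
    ∀ T : B H, ω T = ∑' n, ⟪y n, T (x n)⟫_ℂ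

/-- The weak* topology on `B H`: the topology induced by the normal functionals. -/
def weakStarTopology : TopologicalSpace (B H) :=
  TopologicalSpace.induced
    (fun (T : B H) (ω : {ω : B H →ₗ[ℂ] ℂ // IsNormalFunctional H ω}) => ω.1 T)
    inferInstance

/-- A set of operators is weak* closed if it is closed in the weak* topology. -/
def WStarClosed (X : Set (B H)) : Prop := @IsClosed _ (weakStarTopology H) X

/-- The weak* closure of a set of operators. -/
def wStarClosure (X : Set (B H)) : Set (B H) := @closure _ (weakStarTopology H) X

/-- A map on `B H` is weak* continuous if it is continuous with respect to the
weak* topology on both sides. -/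
def WStarContinuous (Φ : B H →L[ℂ] B H) : Prop :=
  @Continuous _ _ (weakStarTopology H) (weakStarTopology H) Φ

variable {H}
variable [CompleteSpace H]

/-- A maximal abelian selfadjoint subalgebra of `B H`: an abelian selfadjoint
subalgebra which contains every operator commuting with it (equivalently, it
coincides with its own commutant). -/
def IsMasa (D : StarSubalgebra ℂ (B H)) : Prop :=
  (∀ A ∈ D, ∀ C ∈ D, A * C = C * A) ∧
  (∀ T : B H, (∀ A ∈ D, T * A = A * T) → T ∈ D)

/-- A Schur multiplier: a weak* continuous `D`-bimodule map on `B H`. -/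
def IsSchurMultiplier (D : StarSubalgebra ℂ (B H)) (Φ : B H →L[ℂ] B H) : Prop :=
  WStarContinuous H Φ ∧ ∀ A ∈ D, ∀ C ∈ D, ∀ T : B H, Φ (A * T * C) = A * Φ T * C

/-- A Schur idempotent: an idempotent Schur multiplier. -/
def IsSchurIdempotent (D : StarSubalgebra ℂ (B H)) (Φ : B H →L[ℂ] B H) : Prop :=
  IsSchurMultiplier D Φ ∧ Φ.comp Φ = Φ

/-- A subspace `X ⊆ B H` is a `D`-bimodule if `D X D ⊆ X`. -/
def IsBimodule (D : StarSubalgebra ℂ (B H)) (X : Submodule ℂ (B H)) : Prop :=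
  ∀ A ∈ D, ∀ C ∈ D, ∀ T ∈ X, A * T * C ∈ X

/-- The Arveson distance `α(T, X)`. -/
def arveson (T : B H) (X : Set (B H)) : ℝ :=
  ⨆ ξ : {ξ : H // ‖ξ‖ = 1}, ⨅ S : X, ‖T ξ.1 - S.1 ξ.1‖

/-- The set of hyperreflexivity constants of `X`. -/
def hyperSet (X : Set (B H)) : Set ℝ :=
  {k | 0 < k ∧ ∀ T : B H, Metric.infDist T X ≤ k * arveson T X}

/-- A subspace is hyperreflexive if `d(T, X) ≤ k ⬝ α(T, X)` for some `k > 0`. -/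
def Hyperreflexive (X : Set (B H)) : Prop := (hyperSet X).Nonempty

/-- The hyperreflexivity constant `k(X)`: the least constant that works. -/
def hyperConst (X : Set (B H)) : ℝ := sInf (hyperSet X)

/-- The set of constants `λ` witnessing that a Schur idempotent lies in `𝔉H`. -/
def lamSet (Φ : B H →L[ℂ] B H) : Set ℝ :=
  {l | 0 < l ∧ ∀ T : B H, ‖T - Φ T‖ ≤ l * arveson T (Set.range Φ)}

/-- The class `𝔉H` of Schur idempotents `Φ` such that
`‖T - Φ T‖ ≤ λ ⬝ α(T, ran Φ)` for some `λ > 0` and all `T`. -/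
def MemFH (D : StarSubalgebra ℂ (B H)) (Φ : B H →L[ℂ] B H) : Prop :=
  IsSchurIdempotent D Φ ∧ (lamSet Φ).Nonempty

/-- The constant `λ(Φ)`: the least constant witnessing membership of `𝔉H`. -/
def lam (Φ : B H →L[ℂ] B H) : ℝ := sInf (lamSet Φ)

/-- A ternary masa-bimodule condition: `S T* R ∈ M` whenever `S, T, R ∈ M`. -/
def IsTernary (M : Submodule ℂ (B H)) : Prop :=
  ∀ S ∈ M, ∀ T ∈ M, ∀ R ∈ M, S * star T * R ∈ M

end SchurHyper

open SchurHyper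

/-- `t : H →ₗ K →ₗ HK` realises `HK` as the Hilbert-space tensor product `H ⊗ K`:
inner products of elementary tensors multiply, and elementary tensors are total. -/
def IsElemTensor {H K HK : Type*} [NormedAddCommGroup H] [InnerProductSpace ℂ H]
    [NormedAddCommGroup K] [InnerProductSpace ℂ K]
    [NormedAddCommGroup HK] [InnerProductSpace ℂ HK]
    (t : H →ₗ[ℂ] K →ₗ[ℂ] HK) : Prop :=
  (∀ (x₁ x₂ : H) (y₁ y₂ : K), ⟪t x₁ y₁, t x₂ y₂⟫_ℂ = ⟪x₁, x₂⟫_ℂ * ⟪y₁, y₂⟫_ℂ) ∧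
  Dense ((Submodule.span ℂ {z : HK | ∃ x y, z = t x y} : Submodule ℂ HK) : Set HK)

/-- `τ` sends a pair of operators `A ∈ B(H)`, `C ∈ B(K)` to the tensor product
operator `A ⊗ C ∈ B(H ⊗ K)`, characterised by its action on elementary tensors. -/
def IsOpTensor {H K HK : Type*} [NormedAddCommGroup H] [InnerProductSpace ℂ H]
    [NormedAddCommGroup K] [InnerProductSpace ℂ K]
    [NormedAddCommGroup HK] [InnerProductSpace ℂ HK]
    (t : H →ₗ[ℂ] K →ₗ[ℂ] HK) (τ : B H →ₗ[ℂ] B K →ₗ[ℂ] B HK) : Prop :=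
  ∀ (A : B H) (C : B K) (x : H) (y : K), τ A C (t x y) = t (A x) (C y)

/-- The linear span of the elementary tensors `a ⊗ c` with `a ∈ X`, `c ∈ Y`. -/
def tensorSpan {H K HK : Type*} [NormedAddCommGroup H] [InnerProductSpace ℂ H]
    [NormedAddCommGroup K] [InnerProductSpace ℂ K]
    [NormedAddCommGroup HK] [InnerProductSpace ℂ HK]
    (τ : B H →ₗ[ℂ] B K →ₗ[ℂ] B HK) (X : Set (B H)) (Y : Set (B K)) : Set (B HK) :=
  (Submodule.span ℂ {z : B HK | ∃ a ∈ X, ∃ c ∈ Y, z = τ a c} : Submodule ℂ (B HK))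

/-- A separable infinite-dimensional Hilbert space, namely `ℓ²`. -/
abbrev ell2 : Type := lp (fun _ : ℕ => ℂ) 2

/-- A weak* closed subspace `X ⊆ B(E)` is completely hyperreflexive if the weak*
closed span of `X ⊗ B(ℓ²)` is hyperreflexive (in any realisation of the Hilbert
space tensor product `E ⊗ ℓ²`). -/
def CompletelyHyperreflexive {E : Type*} [NormedAddCommGroup E] [InnerProductSpace ℂ E]
    (X : Set (B E)) : Prop :=
  ∀ (W : Type*) [NormedAddCommGroup W] [InnerProductSpace ℂ W] [CompleteSpace W],
    ∀ (t : E →ₗ[ℂ] ell2 →ₗ[ℂ] W) (τ : B E →ₗ[ℂ] B ell2 →ₗ[ℂ] B W),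
    IsElemTensor t → IsOpTensor t τ →
    Hyperreflexive (wStarClosure W (tensorSpan τ X Set.univ))

/-- The Boolean lattice `𝔠(H)` of Schur idempotents generated by the contractive
Schur idempotents, under meet `Φ∧Ψ = Φ∘Ψ`, join `Φ∨Ψ = Φ+Ψ−Φ∘Ψ` and
complement `Φ^⊥ = id − Φ`. -/
inductive InC {H : Type*} [NormedAddCommGroup H] [InnerProductSpace ℂ H] [CompleteSpace H]
    (D : StarSubalgebra ℂ (B H)) : (B H →L[ℂ] B H) → Prop
  | base (Φ : B H →L[ℂ] B H) (h : IsSchurIdempotent D Φ) (hc : ‖Φ‖ ≤ 1) : InC D Φ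
  | compl (Φ : B H →L[ℂ] B H) (h : InC D Φ) : InC D (ContinuousLinearMap.id ℂ (B H) - Φ)
  | meet (Φ Ψ : B H →L[ℂ] B H) (h1 : InC D Φ) (h2 : InC D Ψ) : InC D (Φ.comp Ψ)
  | join (Φ Ψ : B H →L[ℂ] B H) (h1 : InC D Φ) (h2 : InC D Ψ) : InC D (Φ + Ψ - Φ.comp Ψ)

namespace SchurHyper

section Normal

variable {H : Type*} [NormedAddCommGroup H] [InnerProductSpace ℂ H]
variable {H₁ : Type*} [NormedAddCommGroup H₁] [InnerProductSpace ℂ H₁]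
variable {H₂ : Type*} [NormedAddCommGroup H₂] [InnerProductSpace ℂ H₂]
variable {H₃ : Type*} [NormedAddCommGroup H₃] [InnerProductSpace ℂ H₃]

/-- The Cauchy–Schwarz inequality for sums over an arbitrary index type. -/
lemma summable_mul_and_tsum_le {ι : Type*} {f g : ι → ℝ} (hf : ∀ i, 0 ≤ f i) (hg : ∀ i, 0 ≤ g i)
    {a b : ℝ} (ha : 0 ≤ a) (hb : 0 ≤ b) (hfs : Summable fun i => f i ^ 2)
    (hgs : Summable fun i => g i ^ 2) (hfa : ∑' i, f i ^ 2 ≤ a ^ 2) (hgb : ∑' i, g i ^ 2 ≤ b ^ 2) :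
    Summable (fun i => f i * g i) ∧ ∑' i, f i * g i ≤ a * b := by
  have key : ∀ s : Finset ι, ∑ i ∈ s, f i * g i ≤ a * b := by
    intro s
    have h1 := Finset.sum_mul_sq_le_sq_mul_sq s f g
    have h2 : ∑ i ∈ s, f i ^ 2 ≤ a ^ 2 :=
      (hfs.sum_le_tsum s fun i _ => sq_nonneg _).trans hfa
    have h3 : ∑ i ∈ s, g i ^ 2 ≤ b ^ 2 :=
      (hgs.sum_le_tsum s fun i _ => sq_nonneg _).trans hgb
    refine abs_le_of_sq_le_sq' ?_ (mul_nonneg ha hb) |>.2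
    rw [mul_pow]
    exact h1.trans (mul_le_mul h2 h3 (Finset.sum_nonneg fun i _ => sq_nonneg _) (sq_nonneg _))
  have hs : Summable (fun i => f i * g i) :=
    summable_of_sum_le (fun i => mul_nonneg (hf i) (hg i)) key
  exact ⟨hs, hs.tsum_le_of_sum_le key⟩

lemma summable_inner_apply {ι : Type*} {x : ι → H₁} {y : ι → H₂}
    (hx : Summable fun i => ‖x i‖ ^ 2) (hy : Summable fun i => ‖y i‖ ^ 2) (T : H₁ →L[ℂ] H₂) :
    Summable fun i => ⟪y i, T (x i)⟫_ℂ := by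
  refine Summable.of_norm_bounded (g := fun i => ‖T‖ * (‖x i‖ ^ 2 + ‖y i‖ ^ 2))
    ((hx.add hy).mul_left _) fun i => ?_
  have h1 := norm_inner_le_norm (𝕜 := ℂ) (y i) (T (x i))
  have h2 := T.le_opNorm (x i)
  have h3 := norm_nonneg T
  have h4 : ‖y i‖ * ‖x i‖ ≤ ‖x i‖ ^ 2 + ‖y i‖ ^ 2 := by
    nlinarith [sq_nonneg (‖x i‖ - ‖y i‖), sq_nonneg (‖x i‖ + ‖y i‖)]
  calc _ ≤ ‖y i‖ * (‖T‖ * ‖x i‖) := h1.trans (mul_le_mul_of_nonneg_left h2 (norm_nonneg _))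
    _ = ‖T‖ * (‖y i‖ * ‖x i‖) := by ring
    _ ≤ _ := mul_le_mul_of_nonneg_left h4 h3

lemma norm_tsum_inner_apply_le {ι : Type*} {x : ι → H₁} {y : ι → H₂}
    (hx : Summable fun i => ‖x i‖ ^ 2) (hy : Summable fun i => ‖y i‖ ^ 2) (T : H₁ →L[ℂ] H₂)
    {a b : ℝ} (ha : 0 ≤ a) (hb : 0 ≤ b) (hxa : ∑' i, ‖x i‖ ^ 2 ≤ a ^ 2)
    (hyb : ∑' i, ‖y i‖ ^ 2 ≤ b ^ 2) :
    ‖∑' i, ⟪y i, T (x i)⟫_ℂ‖ ≤ ‖T‖ * (a * b) := by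
  obtain ⟨h1, h2⟩ := summable_mul_and_tsum_le (fun i => norm_nonneg (x i))
    (fun i => norm_nonneg (y i)) ha hb hx hy hxa hyb
  have h3 : ∀ i, ‖⟪y i, T (x i)⟫_ℂ‖ ≤ ‖T‖ * (‖x i‖ * ‖y i‖) := fun i => by
    calc _ ≤ ‖y i‖ * (‖T‖ * ‖x i‖) := (norm_inner_le_norm _ _).trans
          (mul_le_mul_of_nonneg_left (T.le_opNorm _) (norm_nonneg _))
      _ = _ := by ring
  have h4 : Summable fun i => ‖⟪y i, T (x i)⟫_ℂ‖ :=
    Summable.of_nonneg_of_le (fun _ => norm_nonneg _) h3 (h1.mul_left _)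
  calc _ ≤ ∑' i, ‖⟪y i, T (x i)⟫_ℂ‖ := norm_tsum_le_tsum_norm h4
    _ ≤ ∑' i, ‖T‖ * (‖x i‖ * ‖y i‖) := h4.tsum_le_tsum h3 (h1.mul_left _)
    _ = ‖T‖ * ∑' i, ‖x i‖ * ‖y i‖ := tsum_mul_left
    _ ≤ _ := mul_le_mul_of_nonneg_left h2 (norm_nonneg _)

/-- Square-summable families over arbitrary index types define normal functionals. -/
lemma IsNormalFunctional.of_family {ι : Type*} {x y : ι → H} (ω : B H →ₗ[ℂ] ℂ)
    (hx : Summable fun i => ‖x i‖ ^ 2) (hy : Summable fun i => ‖y i‖ ^ 2)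
    (hω : ∀ T : B H, ω T = ∑' i, ⟪y i, T (x i)⟫_ℂ) : IsNormalFunctional H ω := by
  classical
  have hc : (Function.support fun i => ‖x i‖ ^ 2).Countable := hx.countable_support
  set S := Function.support fun i => ‖x i‖ ^ 2 with hS
  have : Countable S := hc
  obtain ⟨f, hf⟩ := exists_injective_nat S
  have hsub : ∀ T : B H, Function.support (fun i => ⟪y i, T (x i)⟫_ℂ) ⊆ S := by
    intro T i hi
    simp only [hS, Function.mem_support] at hi ⊢
    intro h
    apply hi
    have : x i = 0 := by simpa using h
    simp [this]
  refine ⟨Function.extend f (fun i => x i) 0, Function.extend f (fun i => y i) 0, ?_, ?_, ?_⟩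
  · have : (fun n => ‖Function.extend f (fun i : S => x i) 0 n‖ ^ 2)
        = Function.extend f (fun i : S => ‖x i‖ ^ 2) 0 := by
      funext n
      by_cases h : ∃ i, f i = n
      · obtain ⟨i, rfl⟩ := h
        simp [hf.extend_apply]
      · simp [Function.extend_apply' _ _ _ h]
    rw [this]
    exact (summable_extend_zero hf).2 (hx.subtype S)
  · have : (fun n => ‖Function.extend f (fun i : S => y i) 0 n‖ ^ 2)
        = Function.extend f (fun i : S => ‖y i‖ ^ 2) 0 := by
      funext n
      by_cases h : ∃ i, f i = n
      · obtain ⟨i, rfl⟩ := h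
        simp [hf.extend_apply]
      · simp [Function.extend_apply' _ _ _ h]
    rw [this]
    exact (summable_extend_zero hf).2 (hy.subtype S)
  · intro T
    rw [hω, ← tsum_subtype_eq_of_support_subset (hsub T)]
    have : (fun n => ⟪Function.extend f (fun i : S => y i) 0 n,
        T (Function.extend f (fun i : S => x i) 0 n)⟫_ℂ)
        = Function.extend f (fun i : S => ⟪y i, T (x i)⟫_ℂ) 0 := by
      funext n
      by_cases h : ∃ i, f i = n
      · obtain ⟨i, rfl⟩ := h
        simp [hf.extend_apply]
      · simp [Function.extend_apply' _ _ _ h]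
    rw [this, tsum_extend_zero hf]

lemma IsNormalFunctional.of_inner (x y : H) (ω : B H →ₗ[ℂ] ℂ) (hω : ∀ T : B H, ω T = ⟪y, T x⟫_ℂ) :
    IsNormalFunctional H ω := by
  refine .of_family (ι := Unit) (x := fun _ => x) (y := fun _ => y) ω ?_ ?_ ?_
  · exact Summable.of_finite
  · exact Summable.of_finite
  · intro T; simp [hω]

lemma IsNormalFunctional.zero : IsNormalFunctional H 0 :=
  .of_inner 0 0 _ (by simp)

lemma IsNormalFunctional.add {ω₁ ω₂ : B H →ₗ[ℂ] ℂ} (h₁ : IsNormalFunctional H ω₁)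
    (h₂ : IsNormalFunctional H ω₂) : IsNormalFunctional H (ω₁ + ω₂) := by
  obtain ⟨x, y, hx, hy, h⟩ := h₁
  obtain ⟨x', y', hx', hy', h'⟩ := h₂
  refine .of_family (ι := ℕ ⊕ ℕ) (x := Sum.elim x x') (y := Sum.elim y y') _ ?_ ?_ ?_
  · exact Summable.sum _ (by simpa [Function.comp_def] using hx)
      (by simpa [Function.comp_def] using hx')
  · exact Summable.sum _ (by simpa [Function.comp_def] using hy)
      (by simpa [Function.comp_def] using hy')
  · intro T
    rw [LinearMap.add_apply, h, h']
    rw [Summable.tsum_sum]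
    · simp
    · simpa [Function.comp_def] using summable_inner_apply hx hy T
    · simpa [Function.comp_def] using summable_inner_apply hx' hy' T

lemma IsNormalFunctional.smul (c : ℂ) {ω : B H →ₗ[ℂ] ℂ} (h₁ : IsNormalFunctional H ω) :
    IsNormalFunctional H (c • ω) := by
  obtain ⟨x, y, hx, hy, h⟩ := h₁
  refine .of_family (x := fun n => c • x n) (y := y) _ ?_ hy ?_
  · simp_rw [norm_smul, mul_pow]
    exact hx.mul_left _
  · intro T
    simp only [LinearMap.smul_apply, h, map_smul, inner_smul_right, smul_eq_mul]
    rw [tsum_mul_left]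

/-- Linear maps between algebras of operators which are weak* continuous, expressed through their
preduals. -/
def IsNormalMap (Θ : B H₁ →ₗ[ℂ] B H₂) : Prop :=
  ∀ ω, IsNormalFunctional H₂ ω → IsNormalFunctional H₁ (ω ∘ₗ Θ)

lemma IsNormalMap.comp {Θ : B H₂ →ₗ[ℂ] B H₃} {Ψ : B H₁ →ₗ[ℂ] B H₂} (h : IsNormalMap Θ)
    (h' : IsNormalMap Ψ) : IsNormalMap (Θ ∘ₗ Ψ) := fun ω hω => h' _ (h _ hω)

lemma IsNormalMap.add {Θ Ψ : B H₁ →ₗ[ℂ] B H₂} (h : IsNormalMap Θ)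
    (h' : IsNormalMap Ψ) : IsNormalMap (Θ + Ψ) := fun ω hω => by
  rw [LinearMap.comp_add]; exact (h _ hω).add (h' _ hω)

lemma IsNormalMap.smul (c : ℂ) {Θ : B H₁ →ₗ[ℂ] B H₂} (h : IsNormalMap Θ) :
    IsNormalMap (c • Θ) := fun ω hω => by
  rw [LinearMap.comp_smul]; exact (h _ hω).smul c

lemma IsNormalMap.sub {Θ Ψ : B H₁ →ₗ[ℂ] B H₂} (h : IsNormalMap Θ)
    (h' : IsNormalMap Ψ) : IsNormalMap (Θ - Ψ) := by
  have : Θ - Ψ = Θ + (-1 : ℂ) • Ψ := by ext T x; simp [sub_eq_add_neg]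
  rw [this]; exact h.add (h'.smul _)

lemma IsNormalMap.id : IsNormalMap (LinearMap.id : B H →ₗ[ℂ] B H) := fun ω hω => hω

/-- The normal functionals separate into coordinates of the weak* topology. -/
def weakStarEmb (H : Type*) [NormedAddCommGroup H] [InnerProductSpace ℂ H] :
    B H →ₗ[ℂ] ({ω : B H →ₗ[ℂ] ℂ // IsNormalFunctional H ω} → ℂ) :=
  LinearMap.pi fun ω => ω.1

lemma weakStarTopology_eq : weakStarTopology H =
    TopologicalSpace.induced (weakStarEmb H) inferInstance := rfl

lemma tendsto_weakStar_iff {α : Type*} {l : Filter α} {f : α → B H} {T : B H} :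
    Filter.Tendsto f l (@nhds _ (weakStarTopology H) T) ↔
      ∀ ω, IsNormalFunctional H ω → Filter.Tendsto (fun a => ω (f a)) l (nhds (ω T)) := by
  rw [weakStarTopology_eq, nhds_induced, Filter.tendsto_comap_iff, tendsto_pi_nhds]
  exact ⟨fun h ω hω => h ⟨ω, hω⟩, fun h ω => h ω.1 ω.2⟩

lemma continuous_weakStar_of_normal {ω : B H →ₗ[ℂ] ℂ} (hω : IsNormalFunctional H ω) :
    @Continuous _ _ (weakStarTopology H) _ ω := by
  let := weakStarTopology H
  rw [continuous_iff_continuousAt]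
  intro T
  exact tendsto_weakStar_iff.1 Filter.tendsto_id ω hω

lemma IsNormalMap.continuous {Θ : B H₁ →ₗ[ℂ] B H₂} (h : IsNormalMap Θ) :
    @Continuous _ _ (weakStarTopology H₁) (weakStarTopology H₂) Θ := by
  let := weakStarTopology H₁
  let := weakStarTopology H₂
  rw [continuous_iff_continuousAt]
  intro T
  refine tendsto_weakStar_iff.2 fun ω hω => ?_
  exact tendsto_weakStar_iff.1 Filter.tendsto_id _ (h ω hω)

lemma isNormalMap_of_wStarContinuous {Φ : B H →L[ℂ] B H} (h : WStarContinuous H Φ) :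
    IsNormalMap (Φ : B H →ₗ[ℂ] B H) := by
  intro ω hω
  have hc : @Continuous _ _ (weakStarTopology H) _ (ω ∘ₗ (Φ : B H →ₗ[ℂ] B H)) := by
    have h1 := continuous_weakStar_of_normal hω
    rw [WStarContinuous] at h
    let := weakStarTopology H
    exact Continuous.comp (f := Φ) (g := ω) h1 h
  have hi : weakStarTopology H =
      ⨅ i : {ω : B H →ₗ[ℂ] ℂ // IsNormalFunctional H ω},
        TopologicalSpace.induced (i.1) inferInstance := by
    rw [weakStarTopology, Pi.topologicalSpace, induced_iInf]
    simp only [induced_compose]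
    rfl
  rw [hi] at hc
  have := (LinearMap.mem_span_iff_continuous
    (f := fun i : {ω : B H →ₗ[ℂ] ℂ // IsNormalFunctional H ω} => i.1) _).2 hc
  refine Submodule.span_induction (p := fun φ _ => IsNormalFunctional H φ) ?_ ?_ ?_ ?_ this
  · rintro _ ⟨i, rfl⟩; exact i.2
  · exact .zero
  · intro _ _ _ _ h h'; exact h.add h'
  · intro c _ _ h; exact h.smul c

/-- The weak* closure of a subspace, as a subspace. -/
def wcl (X : Submodule ℂ (B H)) : Submodule ℂ (B H) :=
  let := weakStarTopology H
  haveI : IsTopologicalAddGroup (B H) := topologicalAddGroup_induced (weakStarEmb H)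
  haveI : ContinuousSMul ℂ (B H) := continuousSMul_induced (weakStarEmb H)
  X.topologicalClosure

lemma coe_wcl (X : Submodule ℂ (B H)) : (wcl X : Set (B H)) = wStarClosure H X := rfl

lemma le_wcl (X : Submodule ℂ (B H)) : X ≤ wcl X :=
  @subset_closure _ (weakStarTopology H) (X : Set (B H))

lemma mem_wcl_of_tendsto {α : Type*} {l : Filter α} [l.NeBot] {f : α → B H} {T : B H}
    {X : Submodule ℂ (B H)} (hf : ∀ a, f a ∈ X)
    (h : ∀ ω, IsNormalFunctional H ω → Filter.Tendsto (fun a => ω (f a)) l (nhds (ω T))) :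
    T ∈ wcl X := by
  let := weakStarTopology H
  exact mem_closure_of_tendsto (tendsto_weakStar_iff.2 h) (Filter.Eventually.of_forall hf)

lemma IsNormalMap.map_wcl {Θ : B H₁ →ₗ[ℂ] B H₂} (h : IsNormalMap Θ) {X : Submodule ℂ (B H₁)}
    {Y : Submodule ℂ (B H₂)} (hXY : ∀ T ∈ X, Θ T ∈ wcl Y) {T : B H₁} (hT : T ∈ wcl X) :
    Θ T ∈ wcl Y := by
  let := weakStarTopology H₁
  let := weakStarTopology H₂
  have h1 := map_mem_closure h.continuous hT hXY
  have h2 : closure (wcl Y : Set (B H₂)) = wcl Y := by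
    rw [coe_wcl, wStarClosure, closure_closure]
  rw [h2] at h1
  exact h1

lemma wcl_le {X Y : Submodule ℂ (B H)} (h : X ≤ wcl Y) : wcl X ≤ wcl Y :=
  fun _ hT => IsNormalMap.id.map_wcl h hT

lemma wcl_mono {X Y : Submodule ℂ (B H)} (h : X ≤ Y) : wcl X ≤ wcl Y :=
  wcl_le (h.trans (le_wcl Y))

lemma eq_zero_of_mem_wcl {X : Submodule ℂ (B H)} {ω : B H →ₗ[ℂ] ℂ} (hω : IsNormalFunctional H ω)
    (h : ∀ T ∈ X, ω T = 0) {T : B H} (hT : T ∈ wcl X) : ω T = 0 := by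
  let := weakStarTopology H
  have h1 := map_mem_closure (continuous_weakStar_of_normal hω) hT (t := {0}) h
  simpa using h1

end Normal

section Kraus

variable {H₁ : Type*} [NormedAddCommGroup H₁] [InnerProductSpace ℂ H₁]
variable {H₂ : Type*} [NormedAddCommGroup H₂] [InnerProductSpace ℂ H₂]

/-- Families of operators whose column has norm at most `C`. -/
def IsBddFam {ι : Type*} (V : ι → H₂ →L[ℂ] H₁) (C : ℝ) : Prop :=
  0 ≤ C ∧ ∀ x, Summable (fun i => ‖V i x‖ ^ 2) ∧ ∑' i, ‖V i x‖ ^ 2 ≤ (C * ‖x‖) ^ 2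

lemma IsBddFam.single (A : H₂ →L[ℂ] H₁) : IsBddFam (fun _ : Unit => A) ‖A‖ := by
  refine ⟨norm_nonneg _, fun x => ⟨Summable.of_finite, ?_⟩⟩
  simp only [tsum_fintype, Finset.univ_unique, Finset.sum_const, Finset.card_singleton, one_smul]
  exact pow_le_pow_left₀ (norm_nonneg _) (A.le_opNorm x) 2

lemma IsBddFam.norm_tsum_le {ι : Type*} {V V' : ι → H₂ →L[ℂ] H₁} {C C' : ℝ}
    (hV : IsBddFam V C) (hV' : IsBddFam V' C') (T : B H₁) (x y : H₂) :
    ‖∑' i, ⟪V' i y, T (V i x)⟫_ℂ‖ ≤ ‖T‖ * (C * C') * ‖x‖ * ‖y‖ := by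
  have := norm_tsum_inner_apply_le (hV.2 x).1 (hV'.2 y).1 T (mul_nonneg hV.1 (norm_nonneg x))
    (mul_nonneg hV'.1 (norm_nonneg y)) (hV.2 x).2 (hV'.2 y).2
  calc _ ≤ _ := this
    _ = _ := by ring

lemma isNormalMap_of_form {ι : Type*} {V V' : ι → H₂ →L[ℂ] H₁} {C C' : ℝ}
    (hV : IsBddFam V C) (hV' : IsBddFam V' C') (Θ : B H₁ →ₗ[ℂ] B H₂)
    (h : ∀ T x y, ⟪y, Θ T x⟫_ℂ = ∑' i, ⟪V' i y, T (V i x)⟫_ℂ) : IsNormalMap Θ := by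
  rintro ω ⟨x, y, hx, hy, hω⟩
  have key : ∀ {V : ι → H₂ →L[ℂ] H₁} {C : ℝ} (_ : IsBddFam V C) {x : ℕ → H₂}
      (_ : Summable fun n => ‖x n‖ ^ 2), Summable fun p : ℕ × ι => ‖V p.2 (x p.1)‖ ^ 2 := by
    intro V C hV x hx
    rw [summable_prod_of_nonneg (fun _ => sq_nonneg _)]
    refine ⟨fun n => (hV.2 (x n)).1, ?_⟩
    refine Summable.of_nonneg_of_le (fun n => tsum_nonneg fun _ => sq_nonneg _)
      (fun n => (hV.2 (x n)).2) ?_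
    simp_rw [mul_pow]
    exact hx.mul_left _
  refine .of_family (ι := ℕ × ι) (x := fun p => V p.2 (x p.1)) (y := fun p => V' p.2 (y p.1)) _
    (key hV hx) (key hV' hy) fun T => ?_
  have hs := summable_inner_apply (key hV hx) (key hV' hy) T
  rw [hs.tsum_prod' fun n => summable_inner_apply (hV.2 (x n)).1 (hV'.2 (y n)).1 T]
  simp only [LinearMap.comp_apply, hω, h]

variable [CompleteSpace H₂]

lemma exists_form {ι : Type*} {V V' : ι → H₂ →L[ℂ] H₁} {C C' : ℝ}
    (hV : IsBddFam V C) (hV' : IsBddFam V' C') (T : B H₁) :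
    ∃ S : B H₂, (∀ x y, ⟪y, S x⟫_ℂ = ∑' i, ⟪V' i y, T (V i x)⟫_ℂ) ∧ ‖S‖ ≤ C * C' * ‖T‖ := by
  have hs : ∀ x y, Summable fun i => ⟪V' i y, T (V i x)⟫_ℂ := fun x y =>
    summable_inner_apply (hV.2 x).1 (hV'.2 y).1 T
  let F : H₂ →ₗ⋆[ℂ] H₂ →ₗ[ℂ] ℂ := LinearMap.mk₂'ₛₗ (starRingEnd ℂ) (RingHom.id ℂ)
    (fun y x => ∑' i, ⟪V' i y, T (V i x)⟫_ℂ)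
    (fun y y' x => by
      simp only [map_add, inner_add_left]
      exact (hs x y).tsum_add (hs x y'))
    (fun c y x => by
      simp only [map_smul, inner_smul_left, smul_eq_mul]
      exact tsum_mul_left)
    (fun y x x' => by
      simp only [map_add, inner_add_right]
      exact (hs x y).tsum_add (hs x' y))
    (fun c y x => by
      simp only [map_smul, inner_smul_right, smul_eq_mul, RingHom.id_apply]
      exact tsum_mul_left)
  have hF : ∀ y x, ‖F y x‖ ≤ (C * C' * ‖T‖) * ‖y‖ * ‖x‖ := fun y x => by
    have := hV.norm_tsum_le hV' T x y
    calc _ ≤ _ := this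
      _ = _ := by ring
  let G := F.mkContinuous₂ (C * C' * ‖T‖) hF
  refine ⟨ContinuousLinearMap.adjoint (InnerProductSpace.continuousLinearMapOfBilin G), ?_, ?_⟩
  · intro x y
    rw [ContinuousLinearMap.adjoint_inner_right,
      InnerProductSpace.continuousLinearMapOfBilin_apply]
    rfl
  · refine ContinuousLinearMap.opNorm_le_bound _
      (mul_nonneg (mul_nonneg hV.1 hV'.1) (norm_nonneg _)) fun x => ?_
    set S := ContinuousLinearMap.adjoint (InnerProductSpace.continuousLinearMapOfBilin G)
    have h1 : ⟪S x, S x⟫_ℂ = F (S x) x := by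
      rw [ContinuousLinearMap.adjoint_inner_right,
        InnerProductSpace.continuousLinearMapOfBilin_apply]
      rfl
    have h2 := hF (S x) x
    rw [← h1, inner_self_eq_norm_sq_to_K] at h2
    by_contra! hlt
    have h3 : ‖S x‖ ^ 2 ≤ C * C' * ‖T‖ * ‖S x‖ * ‖x‖ := by simpa using h2
    have h4 : 0 ≤ C * C' * ‖T‖ * ‖x‖ := mul_nonneg
      (mul_nonneg (mul_nonneg hV.1 hV'.1) (norm_nonneg _)) (norm_nonneg _)
    nlinarith

/-- The operator `T ↦ ∑ V'ᵢ* T Vᵢ`. -/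
lemma exists_kraus {ι : Type*} {V V' : ι → H₂ →L[ℂ] H₁} {C C' : ℝ}
    (hV : IsBddFam V C) (hV' : IsBddFam V' C') :
    ∃ Θ : B H₁ →L[ℂ] B H₂, (∀ T x y, ⟪y, Θ T x⟫_ℂ = ∑' i, ⟪V' i y, T (V i x)⟫_ℂ) ∧
      IsNormalMap (Θ : B H₁ →ₗ[ℂ] B H₂) := by
  choose S hS hSn using exists_form hV hV'
  have hs : ∀ (T : B H₁) x y, Summable fun i => ⟪V' i y, T (V i x)⟫_ℂ := fun T x y =>
    summable_inner_apply (hV.2 x).1 (hV'.2 y).1 T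
  let Θ : B H₁ →ₗ[ℂ] B H₂ :=
    { toFun := S
      map_add' := fun T T' => by
        refine ContinuousLinearMap.ext fun x => ext_inner_left ℂ fun y => ?_
        rw [add_apply, inner_add_right, hS, hS, hS,
          ← (hs T x y).tsum_add (hs T' x y)]
        simp [inner_add_right]
      map_smul' := fun c T => by
        refine ContinuousLinearMap.ext fun x => ext_inner_left ℂ fun y => ?_
        rw [RingHom.id_apply, smul_apply, inner_smul_right, hS, hS,
          ← tsum_mul_left]
        simp [inner_smul_right] }
  refine ⟨Θ.mkContinuous (C * C') hSn, fun T x y => hS T x y, ?_⟩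
  exact isNormalMap_of_form hV hV' _ fun T x y => hS T x y

lemma isNormalMap_of_apply [CompleteSpace H₁] (A : H₁ →L[ℂ] H₂) (C : H₂ →L[ℂ] H₁)
    (Θ : B H₁ →ₗ[ℂ] B H₂) (h : ∀ T x, Θ T x = A (T (C x))) : IsNormalMap Θ := by
  refine isNormalMap_of_form (IsBddFam.single C)
    (IsBddFam.single (ContinuousLinearMap.adjoint A)) Θ fun T x y => ?_
  simp [h, ContinuousLinearMap.adjoint_inner_left]

/-- Two-sided multiplication. -/
def mulLR {H : Type*} [NormedAddCommGroup H] [InnerProductSpace ℂ H] (A C : B H) :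
    B H →ₗ[ℂ] B H :=
  LinearMap.mulLeft ℂ A ∘ₗ LinearMap.mulRight ℂ C

@[simp] lemma mulLR_apply {H : Type*} [NormedAddCommGroup H] [InnerProductSpace ℂ H]
    (A C T : B H) : mulLR A C T = A * T * C := by simp [mulLR, mul_assoc]

lemma isNormalMap_mulLR (A C : B H₂) : IsNormalMap (mulLR A C) :=
  isNormalMap_of_apply A C _ fun T x => by simp

end Kraus

section Arveson

variable {H : Type*} [NormedAddCommGroup H] [InnerProductSpace ℂ H]

/-- `T` is bounded by `c` on the rank one annihilator of `X`. -/
def AnnBound (T : B H) (X : Set (B H)) (c : ℝ) : Prop :=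
  ∀ ξ η : H, (∀ S ∈ X, ⟪η, S ξ⟫_ℂ = 0) → ‖⟪η, T ξ⟫_ℂ‖ ≤ c * ‖ξ‖ * ‖η‖

lemma AnnBound.mono {T : B H} {X Y : Set (B H)} {c : ℝ} (h : AnnBound T X c) (hXY : X ⊆ Y) :
    AnnBound T Y c := fun ξ η hS => h ξ η fun S hSX => hS S (hXY hSX)

lemma AnnBound.of_wcl {T : B H} {X : Submodule ℂ (B H)} {c : ℝ} (h : AnnBound T (wcl X) c) :
    AnnBound T X c := fun ξ η hS => by
  refine h ξ η fun S hSX => ?_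
  let ω : B H →ₗ[ℂ] ℂ := (innerSL ℂ η : H →ₗ[ℂ] ℂ) ∘ₗ
    (ContinuousLinearMap.apply ℂ H ξ : B H →ₗ[ℂ] H)
  have hω : IsNormalFunctional H ω := .of_inner ξ η _ fun T => rfl
  exact eq_zero_of_mem_wcl hω hS hSX

lemma arveson_term_bddBelow (T : B H) (X : Set (B H)) (ξ : H) :
    BddBelow (Set.range fun S : X => ‖T ξ - S.1 ξ‖) :=
  ⟨0, by rintro _ ⟨S, rfl⟩; exact norm_nonneg _⟩

lemma arveson_nonneg (T : B H) (X : Set (B H)) : 0 ≤ arveson T X :=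
  Real.iSup_nonneg fun _ => Real.iInf_nonneg fun _ => norm_nonneg _

lemma le_arveson (T : B H) (X : Submodule ℂ (B H)) {ξ : H} (hξ : ‖ξ‖ = 1) :
    ⨅ S : (X : Set (B H)), ‖T ξ - S.1 ξ‖ ≤ arveson T X := by
  refine le_ciSup (f := fun ξ : {ξ : H // ‖ξ‖ = 1} =>
    ⨅ S : (X : Set (B H)), ‖T ξ.1 - S.1 ξ.1‖) ?_ ⟨ξ, hξ⟩
  refine ⟨‖T‖, ?_⟩
  rintro _ ⟨⟨ξ, hξ⟩, rfl⟩
  refine (ciInf_le (arveson_term_bddBelow T X ξ) ⟨0, X.zero_mem⟩).trans ?_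
  simpa [hξ] using T.le_opNorm ξ

lemma annBound_arveson (T : B H) (X : Submodule ℂ (B H)) : AnnBound T X (arveson T X) := by
  intro ξ η hS
  by_cases hξ : ξ = 0
  · simp [hξ]
  have hξ' : ‖ξ‖ ≠ 0 := norm_ne_zero_iff.2 hξ
  have hu : ‖((‖ξ‖ : ℂ)⁻¹ • ξ)‖ = 1 := by simp [norm_smul, hξ']
  set u := (‖ξ‖ : ℂ)⁻¹ • ξ with hudef
  have hξu : ξ = (‖ξ‖ : ℂ) • u := by
    rw [hudef, smul_smul, mul_inv_cancel₀ (by exact_mod_cast hξ'), one_smul]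
  have h1 : ‖⟪η, T u⟫_ℂ‖ ≤ arveson T X * ‖η‖ := by
    by_cases hη : ‖η‖ = 0
    · simp [norm_eq_zero.1 hη]
    have hη' : 0 < ‖η‖ := lt_of_le_of_ne (norm_nonneg _) (Ne.symm hη)
    rw [← div_le_iff₀ hη']
    refine le_trans ?_ (le_arveson T X hu)
    haveI : Nonempty (X : Set (B H)) := ⟨⟨0, X.zero_mem⟩⟩
    refine le_ciInf fun S => ?_
    rw [div_le_iff₀ hη', mul_comm]
    have h0 : ⟪η, S.1 u⟫_ℂ = 0 := by
      rw [hudef, map_smul, inner_smul_right, hS S.1 S.2, mul_zero]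
    calc ‖⟪η, T u⟫_ℂ‖ = ‖⟪η, T u - S.1 u⟫_ℂ‖ := by rw [inner_sub_right, h0, sub_zero]
      _ ≤ _ := norm_inner_le_norm _ _
  calc ‖⟪η, T ξ⟫_ℂ‖ = ‖ξ‖ * ‖⟪η, T u⟫_ℂ‖ := by
        conv_lhs => rw [hξu]
        rw [map_smul, inner_smul_right, norm_mul]; simp
    _ ≤ ‖ξ‖ * (arveson T X * ‖η‖) := by gcongr
    _ = _ := by ring

lemma arveson_le [CompleteSpace H] {T : B H} {X : Submodule ℂ (B H)} {c : ℝ} (hc : 0 ≤ c)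
    (h : AnnBound T X c) : arveson T X ≤ c := by
  refine Real.iSup_le (fun ξ => ?_) hc
  obtain ⟨ξ, hξ⟩ := ξ
  let M : Submodule ℂ H :=
    (X.map (ContinuousLinearMap.apply ℂ H ξ : B H →ₗ[ℂ] H)).topologicalClosure
  haveI : CompleteSpace M := (Submodule.isClosed_topologicalClosure _).completeSpace_coe
  set m := M.starProjection (T ξ) with hm
  have hmM : m ∈ M := Submodule.starProjection_apply_mem _ _
  have hη : T ξ - m ∈ Mᗮ := Submodule.sub_starProjection_mem_orthogonal _
  have hS : ∀ S ∈ (X : Set (B H)), ⟪T ξ - m, S ξ⟫_ℂ = 0 := fun S hS => by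
    refine Submodule.inner_left_of_mem_orthogonal (K := M) ?_ hη
    exact Submodule.le_topologicalClosure _ ⟨S, hS, rfl⟩
  have h1 := h ξ (T ξ - m) hS
  have h2 : ⟪T ξ - m, T ξ⟫_ℂ = ⟪T ξ - m, T ξ - m⟫_ℂ := by
    rw [inner_sub_right (T ξ - m) (T ξ) m, Submodule.inner_left_of_mem_orthogonal hmM hη, sub_zero]
  rw [h2, inner_self_eq_norm_sq_to_K, hξ] at h1
  have h3 : ‖T ξ - m‖ ≤ c := by
    by_contra! hlt
    have : ‖T ξ - m‖ ^ 2 ≤ c * ‖T ξ - m‖ := by simpa using h1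
    nlinarith
  refine le_of_forall_pos_le_add fun ε hε => ?_
  obtain ⟨z, ⟨S, hSX, rfl⟩, hz⟩ := Metric.mem_closure_iff.1
    (show m ∈ closure (X.map (ContinuousLinearMap.apply ℂ H ξ : B H →ₗ[ℂ] H) : Set H) from hmM)
    ε hε
  refine (ciInf_le (arveson_term_bddBelow T X ξ) ⟨S, hSX⟩).trans ?_
  have : T ξ - S ξ = (T ξ - m) + (m - S ξ) := by abel
  rw [dist_eq_norm] at hz
  change ‖T ξ - S ξ‖ ≤ _
  rw [this]
  exact (norm_add_le _ _).trans (add_le_add h3 hz.le)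

lemma hyperreflexive_iff [CompleteSpace H] {X : Submodule ℂ (B H)} :
    Hyperreflexive (X : Set (B H)) ↔
      ∃ k : ℝ, 0 < k ∧ ∀ T c, 0 ≤ c → AnnBound T X c →
        Metric.infDist T (X : Set (B H)) ≤ k * c := by
  constructor
  · rintro ⟨k, hk, h⟩
    exact ⟨k, hk, fun T c hc hT => (h T).trans
      (mul_le_mul_of_nonneg_left (arveson_le hc hT) hk.le)⟩
  · rintro ⟨k, hk, h⟩
    exact ⟨k, hk, fun T => h T _ (arveson_nonneg _ _) (annBound_arveson _ _)⟩

end Arveson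

section Masa

variable {H : Type*} [NormedAddCommGroup H] [InnerProductSpace ℂ H] [CompleteSpace H]

/-- The orthogonal projection onto the closure of a subspace. -/
def projOn (M : Submodule ℂ H) : B H :=
  haveI : CompleteSpace M.topologicalClosure :=
    (Submodule.isClosed_topologicalClosure _).completeSpace_coe
  M.topologicalClosure.starProjection

lemma projOn_star (M : Submodule ℂ H) : IsStarProjection (projOn M) :=
  haveI : CompleteSpace M.topologicalClosure :=
    (Submodule.isClosed_topologicalClosure _).completeSpace_coe
  isStarProjection_starProjection

lemma projOn_apply {M : Submodule ℂ H} {v : H} (h : v ∈ M) : projOn M v = v :=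
  haveI : CompleteSpace M.topologicalClosure :=
    (Submodule.isClosed_topologicalClosure _).completeSpace_coe
  Submodule.starProjection_eq_self_iff.2 (M.le_topologicalClosure h)

lemma projOn_mem_closure (M : Submodule ℂ H) (v : H) : projOn M v ∈ M.topologicalClosure :=
  haveI : CompleteSpace M.topologicalClosure :=
    (Submodule.isClosed_topologicalClosure _).completeSpace_coe
  Submodule.starProjection_apply_mem _ _

lemma eqOn_projOn {E : Type*} [NormedAddCommGroup E] [InnerProductSpace ℂ E]
    {M : Submodule ℂ H} {S T : H →L[ℂ] E} (h : ∀ v ∈ M, S v = T v) (v : H) :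
    S (projOn M v) = T (projOn M v) := by
  have : Set.EqOn S T (closure (M : Set H)) :=
    Set.EqOn.closure (fun v hv => h v hv) S.continuous T.continuous
  exact this (projOn_mem_closure M v)

lemma projOn_eq_zero {M : Submodule ℂ H} {v : H} (h : ∀ w ∈ M, ⟪w, v⟫_ℂ = 0) :
    projOn M v = 0 := by
  have h1 : ⟪projOn M v, projOn M v⟫_ℂ = ⟪projOn M v, v⟫_ℂ := by
    have := (projOn_star M).isSelfAdjoint.isSymmetric (projOn M v) v
    simp only [ContinuousLinearMap.coe_coe] at this
    rw [← this, ← mul_apply_eq_comp, (projOn_star M).isIdempotentElem.eq]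
  have h2 : ⟪v, projOn M v⟫_ℂ = 0 := by
    have := eqOn_projOn (E := ℂ) (S := innerSL ℂ v) (T := 0) (M := M) (fun w hw => by
      have := h w hw
      rw [innerSL_apply_apply, ← inner_conj_symm, this]; simp) v
    simpa using this
  rw [← inner_conj_symm (projOn M v) v, h2] at h1
  simpa using h1

/-- The projections of an algebra of operators. -/
def IsProj (D : StarSubalgebra ℂ (B H)) (p : B H) : Prop := p ∈ D ∧ IsStarProjection p

lemma IsStarProjection.mul_apply {p : B H} (hp : IsStarProjection p) (v : H) : p (p v) = p v := by
  rw [← mul_apply_eq_comp, hp.isIdempotentElem.eq]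

lemma IsStarProjection.inner_left {p : B H} (hp : IsStarProjection p) (v w : H) :
    ⟪p v, w⟫_ℂ = ⟪v, p w⟫_ℂ := hp.isSelfAdjoint.isSymmetric v w

lemma IsStarProjection.norm_apply_sq {p : B H} (hp : IsStarProjection p) (v : H) :
    ((‖p v‖ ^ 2 : ℝ) : ℂ) = ⟪v, p v⟫_ℂ := by
  rw [← hp.mul_apply v, ← hp.inner_left, hp.mul_apply, inner_self_eq_norm_sq_to_K]
  simp

lemma IsStarProjection.norm_apply_le {p : B H} (hp : IsStarProjection p) (v : H) :
    ‖p v‖ ≤ ‖v‖ := by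
  have h1 := hp.norm_apply_sq v
  have h2 : ‖p v‖ ^ 2 ≤ ‖v‖ * ‖p v‖ := by
    have := norm_inner_le_norm (𝕜 := ℂ) v (p v)
    rw [← h1] at this
    simpa using this
  by_contra! h
  nlinarith [norm_nonneg v]

variable {D : StarSubalgebra ℂ (B H)}

lemma IsMasa.comm (hD : IsMasa D) {a b : B H} (ha : a ∈ D) (hb : b ∈ D) : a * b = b * a :=
  hD.1 a ha b hb

lemma IsProj.zero : IsProj D 0 := ⟨D.zero_mem, .zero _⟩
lemma IsProj.one : IsProj D 1 := ⟨D.one_mem, .one _⟩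

lemma IsProj.one_sub {p : B H} (hp : IsProj D p) : IsProj D (1 - p) :=
  ⟨D.sub_mem D.one_mem hp.1, hp.2.one_sub⟩

lemma IsProj.mul (hD : IsMasa D) {p q : B H} (hp : IsProj D p) (hq : IsProj D q) :
    IsProj D (p * q) :=
  ⟨D.mul_mem hp.1 hq.1, hp.2.mul hq.2 (hD.comm hp.1 hq.1)⟩

lemma IsProj.sub {p q : B H} (hp : IsProj D p) (hq : IsProj D q) (h : p * q = q) :
    IsProj D (p - q) :=
  ⟨D.sub_mem hp.1 hq.1, hq.2.sub_of_mul_eq_right hp.2 h⟩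

lemma IsProj.add (hD : IsMasa D) {p q : B H} (hp : IsProj D p) (hq : IsProj D q) (h : p * q = 0) :
    IsProj D (p + q) :=
  ⟨D.add_mem hp.1 hq.1, hp.2.add hq.2 h⟩

lemma isProj_projOn (hD : IsMasa D) {M : Submodule ℂ H} (hM : ∀ a ∈ D, ∀ v ∈ M, a v ∈ M) :
    IsProj D (projOn M) := by
  refine ⟨hD.2 _ fun a ha => ?_, projOn_star M⟩
  have key : ∀ a ∈ D, a * projOn M = projOn M * a * projOn M := fun a ha => by
    refine ContinuousLinearMap.ext fun v => ?_
    exact eqOn_projOn (S := a) (T := projOn M * a) (M := M)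
      (fun w hw => by simp [projOn_apply (hM a ha w hw)]) v
  have h2 := congrArg star (key (star a) (star_mem ha))
  simp only [star_mul, star_star, (projOn_star M).isSelfAdjoint.star_eq] at h2
  rw [h2, key a ha, ← mul_assoc, ← mul_assoc, (projOn_star M).isIdempotentElem.eq]

/-- Bounded pointwise weakly convergent nets converge weak*. -/
lemma IsNormalFunctional.tendsto {H : Type*} [NormedAddCommGroup H] [InnerProductSpace ℂ H]
    {ω : B H →ₗ[ℂ] ℂ} (hω : IsNormalFunctional H ω) {α : Type*}
    {l : Filter α} {f : α → B H} {T : B H} {C : ℝ} (hC : ∀ a, ‖f a‖ ≤ C)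
    (h : ∀ x y, Filter.Tendsto (fun a => ⟪y, f a x⟫_ℂ) l (nhds ⟪y, T x⟫_ℂ)) :
    Filter.Tendsto (fun a => ω (f a)) l (nhds (ω T)) := by
  obtain ⟨x, y, hx, hy, hω⟩ := hω
  simp only [hω]
  refine tendsto_tsum_of_dominated_convergence (bound := fun n => C * (‖x n‖ * ‖y n‖)) ?_
    (fun n => h _ _) (Filter.Eventually.of_forall fun a n => ?_)
  · refine Summable.mul_left _ ?_
    refine Summable.of_nonneg_of_le (fun n => by positivity) (fun n => ?_) (hx.add hy)
    nlinarith [sq_nonneg (‖x n‖ - ‖y n‖), sq_nonneg (‖x n‖ + ‖y n‖)]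
  · calc _ ≤ ‖y n‖ * (C * ‖x n‖) := (norm_inner_le_norm _ _).trans
          (mul_le_mul_of_nonneg_left ((f a).le_of_opNorm_le (hC a) _) (norm_nonneg _))
      _ = _ := by ring

lemma exists_spectral_proj (hD : IsMasa D) {a : B H} (ha : a ∈ D) (hs : IsSelfAdjoint a) :
    ∃ r, IsProj D r ∧ 0 ≤ a * r ∧ a * (1 - r) ≤ 0 := by
  set b := cfc (fun x : ℝ => max x 0) a
  set c := cfc (fun x : ℝ => max (-x) 0) a
  have hbc : b - c = a := by
    rw [← cfc_sub (fun x : ℝ => max x 0) (fun x : ℝ => max (-x) 0) a]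
    conv_rhs => rw [← cfc_id' ℝ a]
    congr 1; funext x
    rcases le_total x 0 with h | h
    · simp [h]
    · simp [h]
  have hcb : c * b = 0 := by
    rw [← cfc_mul (fun x : ℝ => max (-x) 0) (fun x : ℝ => max x 0) a]
    have : (fun x : ℝ => max (-x) 0 * max x 0) = fun _ => 0 := by
      funext x
      rcases le_total x 0 with h | h
      · simp [h]
      · simp [h]
    rw [this]; simp
  have hb0 : 0 ≤ b := cfc_nonneg fun x _ => le_max_right _ _
  have hc0 : 0 ≤ c := cfc_nonneg fun x _ => le_max_right _ _
  have hbD : b ∈ D := hD.2 _ fun d hd =>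
    (Commute.cfc_real (show Commute a d from hD.comm ha hd) _).eq
  let M : Submodule ℂ H := LinearMap.range (b : H →ₗ[ℂ] H)
  have hM : ∀ d ∈ D, ∀ v ∈ M, d v ∈ M := by
    rintro d hd _ ⟨v, rfl⟩
    refine ⟨d v, ?_⟩
    have := congrArg (fun T : B H => T v) (hD.comm hbD hd)
    simpa using this
  have hr := isProj_projOn hD hM
  have h1 : projOn M * b = b := ContinuousLinearMap.ext fun v => projOn_apply ⟨v, rfl⟩
  have h2 : c * projOn M = 0 := ContinuousLinearMap.ext fun v => by
    refine eqOn_projOn (S := c) (T := 0) (M := M) ?_ v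
    rintro _ ⟨w, rfl⟩
    have := congrArg (fun T : B H => T w) hcb
    simpa using this
  have h3 : b * projOn M = b := by rw [hD.comm hbD hr.1, h1]
  refine ⟨projOn M, hr, ?_, ?_⟩
  · rw [← hbc, sub_mul, h3, h2, sub_zero]; exact hb0
  · rw [← hbc, sub_mul, mul_sub, mul_sub, h3, h2]; simpa using hc0

lemma exists_dyadic_proj (hD : IsMasa D) {h : B H} (hh : h ∈ D) (h0 : 0 ≤ h) (h1 : h ≤ 1) :
    ∃ r, IsProj D r ∧ 0 ≤ (2 : ℝ) • h - r ∧ (2 : ℝ) • h - r ≤ 1 := by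
  have hs : IsSelfAdjoint h := IsSelfAdjoint.of_nonneg h0
  have hs' : IsSelfAdjoint ((2 : ℝ) • h - 1) := by
    refine IsSelfAdjoint.sub ?_ (.one _)
    rw [isSelfAdjoint_iff, star_smul, hs.star_eq, star_trivial]
  have hmem : (2 : ℝ) • h ∈ D := by rw [two_smul]; exact D.add_mem hh hh
  obtain ⟨r, hr, hp, hn⟩ := exists_spectral_proj hD (D.sub_mem hmem D.one_mem) hs'
  have e1 : h * (1 - r) = (1 - r) * h * (1 - r) := by
    rw [hD.comm (D.sub_mem D.one_mem hr.1) hh, mul_assoc, hr.one_sub.2.isIdempotentElem.eq]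
  have e2 : (1 - h) * r = r * (1 - h) * r := by
    rw [hD.comm hr.1 (D.sub_mem D.one_mem hh), mul_assoc, hr.2.isIdempotentElem.eq]
  have p1 : 0 ≤ h * (1 - r) := by
    rw [e1]
    have := star_right_conjugate_nonneg h0 (1 - r)
    rwa [hr.one_sub.2.isSelfAdjoint.star_eq] at this
  have p2 : 0 ≤ (1 - h) * r := by
    rw [e2]
    have := star_right_conjugate_nonneg (sub_nonneg.2 h1) r
    rwa [hr.2.isSelfAdjoint.star_eq] at this
  refine ⟨r, hr, ?_, ?_⟩
  · have : (2 : ℝ) • h - r = ((2 : ℝ) • h - 1) * r + (h * (1 - r) + h * (1 - r)) := by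
      rw [two_smul]; noncomm_ring
    rw [this]
    exact add_nonneg hp (add_nonneg p1 p1)
  · rw [← sub_nonneg]
    have : 1 - ((2 : ℝ) • h - r) =
        -(((2 : ℝ) • h - 1) * (1 - r)) + ((1 - h) * r + (1 - h) * r) := by
      rw [two_smul]; noncomm_ring
    rw [this]
    exact add_nonneg (neg_nonneg.2 hn) (add_nonneg p2 p2)

lemma norm_le_one_of_unit {h : B H} (h0 : 0 ≤ h) (h1 : h ≤ 1) : ‖h‖ ≤ 1 :=
  (CStarAlgebra.norm_le_one_iff_of_nonneg h h0).2 h1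

lemma apply_nonpos_of_proj (hD : IsMasa D) (F : B H →ₗ[ℝ] ℝ) {M : ℝ}
    (hM0 : 0 ≤ M) (hM : ∀ a, |F a| ≤ M * ‖a‖) (hF : ∀ r, IsProj D r → F r ≤ 0)
    {h : B H} (hh : h ∈ D)
    (h0 : 0 ≤ h) (h1 : h ≤ 1) : F h ≤ 0 := by
  have key : ∀ N : ℕ, ∀ h ∈ D, 0 ≤ h → h ≤ 1 → F h ≤ M * (1 / 2) ^ N := by
    intro N
    induction N with
    | zero =>
      intro h hh h0 h1
      have := norm_le_one_of_unit h0 h1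
      calc F h ≤ |F h| := le_abs_self _
        _ ≤ M * ‖h‖ := hM h
        _ ≤ M * (1 / 2) ^ 0 := by rw [pow_zero]; gcongr
    | succ N ih =>
      intro h hh h0 h1
      obtain ⟨r, hr, hr0, hr1⟩ := exists_dyadic_proj hD hh h0 h1
      have hmem : (2 : ℝ) • h ∈ D := by rw [two_smul]; exact D.add_mem hh hh
      have := ih _ (D.sub_mem hmem hr.1) hr0 hr1
      have h3 := hF r hr
      rw [map_sub, map_smul, smul_eq_mul] at this
      rw [pow_succ]; linarith
  have ht : Filter.Tendsto (fun N : ℕ => M * (1 / 2 : ℝ) ^ N) Filter.atTop (nhds (M * 0)) :=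
    (tendsto_pow_atTop_nhds_zero_of_lt_one (by norm_num) (by norm_num)).const_mul M
  rw [mul_zero] at ht
  exact ge_of_tendsto' ht fun N => key N h hh h0 h1

lemma mem_closure_span_proj (hD : IsMasa D) {a : B H} (ha : a ∈ D) :
    a ∈ (Submodule.span ℂ {p | IsProj D p}).topologicalClosure := by
  set S := Submodule.span ℂ {p | IsProj D p} with hS
  have hsub : ∀ r, IsProj D r → r ∈ S := fun r hr => Submodule.subset_span hr
  have key : ∀ N : ℕ, ∀ h ∈ D, 0 ≤ h → h ≤ 1 → ∃ s ∈ S, ‖h - s‖ ≤ (1 / 2) ^ N := by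
    intro N
    induction N with
    | zero =>
      intro h hh h0 h1
      exact ⟨0, S.zero_mem, by simpa using norm_le_one_of_unit h0 h1⟩
    | succ N ih =>
      intro h hh h0 h1
      obtain ⟨r, hr, hr0, hr1⟩ := exists_dyadic_proj hD hh h0 h1
      have hmem : (2 : ℝ) • h ∈ D := by rw [two_smul]; exact D.add_mem hh hh
      obtain ⟨s, hs, hsn⟩ := ih _ (D.sub_mem hmem hr.1) hr0 hr1
      refine ⟨(1 / 2 : ℂ) • (r + s), S.smul_mem _ (S.add_mem (hsub r hr) hs), ?_⟩
      have : h - (1 / 2 : ℂ) • (r + s) = (1 / 2 : ℂ) • ((2 : ℝ) • h - r - s) := by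
        rw [two_smul, smul_sub, smul_sub, smul_add, smul_add, ← add_smul]
        norm_num
        abel
      rw [this, norm_smul, pow_succ]
      simp only [one_div, norm_inv, RCLike.norm_ofNat]
      rw [mul_comm]
      simp only [one_div] at hsn
      gcongr
  have hunit : ∀ h ∈ D, 0 ≤ h → h ≤ 1 → h ∈ S.topologicalClosure := by
    intro h hh h0 h1
    refine Metric.mem_closure_iff.2 fun ε hε => ?_
    obtain ⟨N, hN⟩ := exists_pow_lt_of_lt_one hε (show (1 / 2 : ℝ) < 1 by norm_num)
    obtain ⟨s, hs, hsn⟩ := key N h hh h0 h1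
    exact ⟨s, hs, by rw [dist_eq_norm]; exact hsn.trans_lt hN⟩
  have hsa : ∀ h ∈ D, IsSelfAdjoint h → h ∈ S.topologicalClosure := by
    intro h hh hs
    by_cases hn : ‖h‖ = 0
    · rw [norm_eq_zero.1 hn]; exact zero_mem _
    have hpos : 0 < ‖h‖ := lt_of_le_of_ne (norm_nonneg _) (Ne.symm hn)
    have b1 : h ≤ algebraMap ℝ (B H) ‖h‖ := hs.le_algebraMap_norm_self
    have b2 : -(algebraMap ℝ (B H) ‖h‖) ≤ h := hs.neg_algebraMap_norm_le_self
    rw [Algebra.algebraMap_eq_smul_one] at b1 b2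
    set g : B H := (1 / (2 * ‖h‖) : ℝ) • (h + ‖h‖ • (1 : B H)) with hg
    have smem : ∀ (c : ℝ) (x : B H), x ∈ D → c • x ∈ D := fun c x hx => by
      have : c • x = (c : ℂ) • x := (Complex.coe_smul c x).symm
      rw [this]; exact D.smul_mem hx _
    have g0 : 0 ≤ g := smul_nonneg (by positivity)
      (by rw [add_comm]; exact neg_le_iff_add_nonneg'.1 b2)
    have g1 : g ≤ 1 := by
      have : (1 : B H) = (1 / (2 * ‖h‖) : ℝ) • (‖h‖ • (1 : B H) + ‖h‖ • (1 : B H)) := by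
        rw [← add_smul, smul_smul]
        have : 1 / (2 * ‖h‖) * (‖h‖ + ‖h‖) = 1 := by field_simp; norm_num
        rw [this, one_smul]
      rw [this]
      exact smul_le_smul_of_nonneg_left (add_le_add_left b1 _) (by positivity)
    have gm := hunit g (smem _ _ (D.add_mem hh (smem _ _ D.one_mem))) g0 g1
    have : h = ((2 * ‖h‖ : ℝ) : ℂ) • g - (‖h‖ : ℂ) • (1 : B H) := by
      rw [Complex.coe_smul, Complex.coe_smul, hg, smul_smul]
      have : 2 * ‖h‖ * (1 / (2 * ‖h‖)) = 1 := by field_simp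
      rw [this, one_smul, add_sub_cancel_right]
    rw [this]
    exact Submodule.sub_mem _ (Submodule.smul_mem _ _ gm)
      (Submodule.smul_mem _ _ (S.le_topologicalClosure (hsub 1 .one)))
  have hst : star a ∈ D := star_mem ha
  have e : a = (1 / 2 : ℂ) • (a + star a) + (-Complex.I / 2) • (Complex.I • (a - star a)) := by
    rw [smul_smul]
    have : -Complex.I / 2 * Complex.I = 1 / 2 := by
      have := Complex.I_mul_I
      linear_combination (-1/2 : ℂ) * this
    rw [this, ← smul_add]
    have : a + star a + (a - star a) = (2 : ℂ) • a := by rw [two_smul]; abel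
    rw [this, smul_smul]; norm_num
  rw [e]
  refine Submodule.add_mem _ (Submodule.smul_mem _ _ (hsa _ (D.add_mem ha hst) ?_))
    (Submodule.smul_mem _ _ (hsa _ (D.smul_mem (D.sub_mem ha hst) _) ?_))
  · exact IsSelfAdjoint.add_star_self a
  · rw [isSelfAdjoint_iff, star_smul, star_sub, star_star]
    simp [smul_sub]
    abel

end Masa

section NearConstant

variable {H : Type*} [NormedAddCommGroup H] [InnerProductSpace ℂ H]

lemma IsNormalFunctional.bound {ω : B H →ₗ[ℂ] ℂ} (hω : IsNormalFunctional H ω) :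
    ∃ M : ℝ, 0 ≤ M ∧ ∀ T, ‖ω T‖ ≤ M * ‖T‖ := by
  obtain ⟨x, y, hx, hy, h⟩ := hω
  have hX : 0 ≤ ∑' n, ‖x n‖ ^ 2 := tsum_nonneg fun _ => sq_nonneg _
  have hY : 0 ≤ ∑' n, ‖y n‖ ^ 2 := tsum_nonneg fun _ => sq_nonneg _
  refine ⟨√(∑' n, ‖x n‖ ^ 2) * √(∑' n, ‖y n‖ ^ 2), by positivity, fun T => ?_⟩
  rw [h, mul_comm]
  exact norm_tsum_inner_apply_le hx hy T (Real.sqrt_nonneg _) (Real.sqrt_nonneg _)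
    (Real.sq_sqrt hX).ge (Real.sq_sqrt hY).ge

variable [CompleteSpace H] {D : StarSubalgebra ℂ (B H)}

lemma projOn_eq_of {M : Submodule ℂ H} {p : B H} (hp : IsStarProjection p)
    (h1 : ∀ v ∈ M, p v = v) (h2 : ∀ v, p v ∈ M.topologicalClosure) : projOn M = p := by
  have e1 : p * projOn M = projOn M := ContinuousLinearMap.ext fun v =>
    eqOn_projOn (S := p) (T := 1) (M := M) h1 v
  have e2 : projOn M * p = p := ContinuousLinearMap.ext fun v => by
    have : CompleteSpace M.topologicalClosure :=
      (Submodule.isClosed_topologicalClosure _).completeSpace_coe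
    exact Submodule.starProjection_eq_self_iff.2 (h2 v)
  have e3 := congrArg star e1
  rw [star_mul, hp.isSelfAdjoint.star_eq, (projOn_star M).isSelfAdjoint.star_eq] at e3
  rw [← e3, e2]

lemma projOn_bot : projOn (⊥ : Submodule ℂ H) = 0 :=
  projOn_eq_of (.zero _) (fun v hv => by simp [(Submodule.mem_bot ℂ).1 hv])
    (fun v => zero_mem _)

lemma IsProj.mul_eq_comm {p q : B H} (hp : IsProj D p) (hq : IsProj D q) (h : p * q = q) :
    q * p = q := by
  have := congrArg star h
  rwa [star_mul, hp.2.isSelfAdjoint.star_eq, hq.2.isSelfAdjoint.star_eq] at this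

/-- A Hahn decomposition for normal functionals on a masa. -/
lemma exists_negative_proj (hD : IsMasa D) {ω : B H →ₗ[ℂ] ℂ} (hω : IsNormalFunctional H ω)
    {q₀ : B H} (hq₀ : IsProj D q₀) (hneg : (ω q₀).re < 0) :
    ∃ q, IsProj D q ∧ q₀ * q = q ∧ (ω q).re < 0 ∧
      ∀ r, IsProj D r → q * r = r → (ω r).re ≤ 0 := by
  let 𝒮 : Set (Submodule ℂ H) := {M | (∀ a ∈ D, ∀ v ∈ M, a v ∈ M) ∧ (∀ v ∈ M, q₀ v = v) ∧
    0 ≤ (ω (projOn M)).re}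
  have hbot : (⊥ : Submodule ℂ H) ∈ 𝒮 := by
    refine ⟨fun a _ v hv => ?_, fun v hv => ?_, ?_⟩
    · simp [(Submodule.mem_bot ℂ).1 hv]
    · simp [(Submodule.mem_bot ℂ).1 hv]
    · simp [projOn_bot]
  have hchain : ∀ c ⊆ 𝒮, IsChain (· ≤ ·) c → ∃ ub ∈ 𝒮, ∀ z ∈ c, z ≤ ub := by
    intro c hc hch
    rcases c.eq_empty_or_nonempty with rfl | hne
    · exact ⟨⊥, hbot, by simp⟩
    let U : c → Submodule ℂ H := fun i => i.1.topologicalClosure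
    have hU : Monotone U := fun i j hij => Submodule.topologicalClosure_mono hij
    have : Nonempty c := hne.to_subtype
    have : IsDirected c (· ≤ ·) := ⟨fun i j => by
      rcases hch.total i.2 j.2 with h | h
      · exact ⟨j, h, le_rfl⟩
      · exact ⟨i, le_rfl, h⟩⟩
    have hcomap : ∀ (a : B H) (N : Submodule ℂ H), (∀ i : c, i.1 ≤ N.comap (a : H →ₗ[ℂ] H)) →
        IsClosed (N : Set H) → ∀ i, U i ≤ N.comap (a : H →ₗ[ℂ] H) := fun a N h hN i =>
      Submodule.topologicalClosure_minimal _ (h i) (hN.preimage a.continuous)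
    refine ⟨⨆ i, U i, ⟨fun a ha v hv => ?_, fun v hv => ?_, ?_⟩, fun z hz => ?_⟩
    · have h1 : ⨆ i, U i ≤ (⨆ i, U i).comap (a : H →ₗ[ℂ] H) := by
        refine iSup_le fun i => ?_
        refine (Submodule.topologicalClosure_minimal (t := (U i).comap (a : H →ₗ[ℂ] H)) _
          (fun v hv => i.1.le_topologicalClosure ((hc i.2).1 a ha v hv))
          ((Submodule.isClosed_topologicalClosure _).preimage a.continuous)).trans ?_
        exact Submodule.comap_mono (le_iSup U i)
      exact h1 hv
    · have h1 : ⨆ i, U i ≤ LinearMap.eqLocus (q₀ : H →ₗ[ℂ] H) LinearMap.id := by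
        refine iSup_le fun i => Submodule.topologicalClosure_minimal _ (hc i.2).2.1 ?_
        exact isClosed_eq q₀.continuous continuous_id
      exact h1 hv
    · have hcomp : ∀ i, CompleteSpace (U i) := fun i =>
        (Submodule.isClosed_topologicalClosure _).completeSpace_coe
      have hcomp' : CompleteSpace (⨆ i, U i).topologicalClosure :=
        (Submodule.isClosed_topologicalClosure _).completeSpace_coe
      have hlim := Submodule.starProjection_tendsto_closure_iSup U hU
      have h2 : Filter.Tendsto (fun i : c => ω (projOn i.1)) Filter.atTop
          (nhds (ω (projOn (⨆ i, U i)))) := by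
        refine hω.tendsto (C := 1) (fun i => (projOn_star _).norm_le) fun x y => ?_
        exact Filter.Tendsto.inner tendsto_const_nhds (hlim x)
      exact ge_of_tendsto' ((Complex.continuous_re.tendsto _).comp h2) fun i => (hc i.2).2.2
    · exact z.le_topologicalClosure.trans (le_iSup U ⟨z, hz⟩)
  obtain ⟨M, hM⟩ := zorn_le₀ 𝒮 hchain
  obtain ⟨hMi, hMq, hMω⟩ := hM.prop
  have hr₀ := isProj_projOn hD hMi
  have hq₀r₀ : q₀ * projOn M = projOn M := ContinuousLinearMap.ext fun v =>
    eqOn_projOn (S := q₀) (T := 1) (M := M) hMq v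
  have hq := hq₀.sub hr₀ hq₀r₀
  refine ⟨q₀ - projOn M, hq, ?_, ?_, fun r hr hqr => ?_⟩
  · rw [mul_sub, hq₀.2.isIdempotentElem.eq, hq₀r₀]
  · rw [map_sub, Complex.sub_re]; linarith
  by_contra! hpos
  have hr0 : projOn M * r = 0 := by
    rw [← hqr, ← mul_assoc, mul_sub, hq₀.mul_eq_comm hr₀ hq₀r₀, hr₀.2.isIdempotentElem.eq,
      sub_self, zero_mul]
  have hq₀r : q₀ * r = r := by
    rw [← hqr, ← mul_assoc, mul_sub, hq₀.2.isIdempotentElem.eq, hq₀r₀]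
  let M' : Submodule ℂ H := M ⊔ LinearMap.range (r : H →ₗ[ℂ] H)
  have hsum := IsProj.add hD hr₀ hr hr0
  have hr0' : ∀ v ∈ M, r v = 0 := fun v hv => by
    have h1 : r * projOn M = 0 := by rw [hD.comm hr.1 hr₀.1, hr0]
    have := congrArg (fun T : B H => T v) h1
    simpa [projOn_apply hv] using this
  have hM'p : projOn M' = projOn M + r := by
    refine projOn_eq_of hsum.2 (fun v hv => ?_) fun v => ?_
    · obtain ⟨u, hu, _, ⟨w, rfl⟩, rfl⟩ := Submodule.mem_sup.1 hv
      have := congrArg (fun T : B H => T w) hr0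
      simp only [mul_apply_eq_comp, zero_apply] at this
      simp [projOn_apply hu, hr0' u hu, this, hr.2.mul_apply]
    · refine add_mem (Submodule.topologicalClosure_mono le_sup_left (projOn_mem_closure M v)) ?_
      exact Submodule.le_topologicalClosure _ (Submodule.mem_sup_right ⟨v, rfl⟩)
  have hM' : M' ∈ 𝒮 := by
    refine ⟨fun a ha v hv => ?_, fun v hv => ?_, ?_⟩
    · obtain ⟨u, hu, _, ⟨w, rfl⟩, rfl⟩ := Submodule.mem_sup.1 hv
      rw [map_add]
      refine Submodule.add_mem_sup (hMi a ha u hu) ⟨a w, ?_⟩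
      have := congrArg (fun T : B H => T w) (hD.comm hr.1 ha)
      simpa using this
    · obtain ⟨u, hu, _, ⟨w, rfl⟩, rfl⟩ := Submodule.mem_sup.1 hv
      have := congrArg (fun T : B H => T w) hq₀r
      simp only [mul_apply_eq_comp] at this
      simp [hMq u hu, this]
    · rw [hM'p, map_add, Complex.add_re]; linarith
  have hle := hM.le_of_ge hM' le_sup_left
  have : r = 0 := ContinuousLinearMap.ext fun v => by
    have h1 : r v ∈ M := hle (Submodule.mem_sup_right ⟨v, rfl⟩)
    rw [← projOn_apply h1, ← mul_apply_eq_comp, hr0]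
  rw [this] at hpos
  simp at hpos

lemma exists_negative_compression (hD : IsMasa D) {ω : B H →ₗ[ℂ] ℂ} (hω : IsNormalFunctional H ω)
    {q₀ : B H} (hq₀ : IsProj D q₀) (hneg : (ω q₀).re < 0) :
    ∃ q, IsProj D q ∧ q₀ * q = q ∧ (ω q).re < 0 ∧
      ∀ b ∈ D, (ω (star b * b * q)).re ≤ 0 := by
  obtain ⟨q, hq, hqq, hqn, hqr⟩ := exists_negative_proj hD hω hq₀ hneg
  refine ⟨q, hq, hqq, hqn, fun b hb => ?_⟩
  obtain ⟨M, hM0, hM⟩ := hω.bound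
  let F : B H →ₗ[ℝ] ℝ := Complex.reLm ∘ₗ (ω ∘ₗ LinearMap.mulRight ℂ q).restrictScalars ℝ
  have hF : ∀ a, F a = (ω (a * q)).re := fun a => rfl
  have hFb : ∀ a, |F a| ≤ M * ‖a‖ := fun a => by
    rw [hF]
    refine (Complex.abs_re_le_norm _).trans ((hM _).trans ?_)
    refine mul_le_mul_of_nonneg_left ?_ hM0
    calc ‖a * q‖ ≤ ‖a‖ * ‖q‖ := norm_mul_le _ _
      _ ≤ ‖a‖ * 1 := by gcongr; exact hq.2.norm_le
      _ = ‖a‖ := mul_one _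
  have hFr : ∀ r, IsProj D r → F r ≤ 0 := fun r hr => by
    rw [hF]
    refine hqr _ (hr.mul hD hq) ?_
    rw [hD.comm hr.1 hq.1, ← mul_assoc, hq.2.isIdempotentElem.eq]
  by_cases hb0 : ‖b‖ = 0
  · rw [norm_eq_zero.1 hb0]; simp
  have hbpos : 0 < ‖b‖ := lt_of_le_of_ne (norm_nonneg _) (Ne.symm hb0)
  have hbb : star b * b ∈ D := mul_mem (star_mem hb) hb
  have h1 := apply_nonpos_of_proj hD F hM0 hFb hFr (h := ((1 / ‖b‖ ^ 2 : ℝ)) • (star b * b))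
    (by rw [← Complex.coe_smul]; exact D.smul_mem hbb _)
    (smul_nonneg (by positivity) (star_mul_self_nonneg b)) (by
      have h2 := CStarAlgebra.star_mul_le_algebraMap_norm_sq (a := b)
      rw [Algebra.algebraMap_eq_smul_one] at h2
      calc _ ≤ (1 / ‖b‖ ^ 2 : ℝ) • (‖b‖ ^ 2 • (1 : B H)) :=
            smul_le_smul_of_nonneg_left h2 (by positivity)
        _ = 1 := by rw [smul_smul, one_div, inv_mul_cancel₀ (by positivity), one_smul])
  rw [map_smul, smul_eq_mul, hF] at h1
  by_contra! hlt
  have : 0 < 1 / ‖b‖ ^ 2 * (ω (star b * b * q)).re := by positivity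
  linarith

lemma exists_negative_scalar (hD : IsMasa D) {ω : B H →ₗ[ℂ] ℂ} (ξ : H) {v : H}
    (hv : v ∈ Submodule.span ℂ ((fun p : B H => p ξ) '' {p | IsProj D p})) :
    ∀ q₀, IsProj D q₀ → (ω q₀).re < 0 →
      ∃ q, IsProj D q ∧ q₀ * q = q ∧ (ω q).re < 0 ∧ ∃ c : ℂ, q v = c • q ξ := by
  refine Submodule.span_induction (p := fun v _ => ∀ q₀, IsProj D q₀ → (ω q₀).re < 0 →
      ∃ q, IsProj D q ∧ q₀ * q = q ∧ (ω q).re < 0 ∧ ∃ c : ℂ, q v = c • q ξ) ?_ ?_ ?_ ?_ hv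
  · rintro _ ⟨p, hp, rfl⟩ q₀ hq₀ hneg
    have hsum : ω q₀ = ω (q₀ * p) + ω (q₀ * (1 - p)) := by
      rw [← map_add]; congr 1; noncomm_ring
    rw [hsum, Complex.add_re] at hneg
    by_cases h : (ω (q₀ * p)).re < 0
    · refine ⟨q₀ * p, hq₀.mul hD hp, ?_, h, 1, ?_⟩
      · rw [← mul_assoc, hq₀.2.isIdempotentElem.eq]
      · simp [hp.2.mul_apply]
    · refine ⟨q₀ * (1 - p), hq₀.mul hD hp.one_sub, ?_, by linarith, 0, ?_⟩
      · rw [← mul_assoc, hq₀.2.isIdempotentElem.eq]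
      · simp [hp.2.mul_apply]
  · intro q₀ hq₀ hneg
    exact ⟨q₀, hq₀, hq₀.2.isIdempotentElem.eq, hneg, 0, by simp⟩
  · intro v w _ _ ihv ihw q₀ hq₀ hneg
    obtain ⟨q, hq, hq1, hq2, c, hc⟩ := ihv q₀ hq₀ hneg
    obtain ⟨q', hq', hq1', hq2', c', hc'⟩ := ihw q hq hq2
    refine ⟨q', hq', ?_, hq2', c + c', ?_⟩
    · rw [← hq1', ← mul_assoc, hq1]
    · have h1 : ∀ u, q' (q u) = q' u := fun u => by
        rw [← mul_apply_eq_comp, hq.mul_eq_comm hq' hq1']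
      rw [map_add, hc', ← h1 v, hc, map_smul, h1, add_smul]
  · intro a v _ ih q₀ hq₀ hneg
    obtain ⟨q, hq, hq1, hq2, c, hc⟩ := ih q₀ hq₀ hneg
    exact ⟨q, hq, hq1, hq2, a * c, by rw [map_smul, hc, mul_smul]⟩

lemma exists_negative_scalar_finset (hD : IsMasa D) {ω : B H →ₗ[ℂ] ℂ} (ξ : H) {y : ℕ → H}
    (s : Finset ℕ)
    (hy : ∀ n ∈ s, y n ∈ Submodule.span ℂ ((fun p : B H => p ξ) '' {p | IsProj D p})) :
    ∀ q₀, IsProj D q₀ → (ω q₀).re < 0 →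
      ∃ q, IsProj D q ∧ q₀ * q = q ∧ (ω q).re < 0 ∧ ∀ n ∈ s, ∃ c : ℂ, q (y n) = c • q ξ := by
  classical
  induction s using Finset.induction_on with
  | empty => exact fun q₀ hq₀ hneg => ⟨q₀, hq₀, hq₀.2.isIdempotentElem.eq, hneg, by simp⟩
  | insert m s _ ih =>
    intro q₀ hq₀ hneg
    obtain ⟨q, hq, hq1, hq2, hc⟩ := ih (fun n hn => hy n (Finset.mem_insert_of_mem hn)) q₀ hq₀ hneg
    obtain ⟨q', hq', hq1', hq2', c', hc'⟩ :=
      exists_negative_scalar hD ξ (hy m (Finset.mem_insert_self _ _)) q hq hq2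
    have h1 : ∀ u, q' (q u) = q' u := fun u => by
      rw [← mul_apply_eq_comp, hq.mul_eq_comm hq' hq1']
    refine ⟨q', hq', by rw [← hq1', ← mul_assoc, hq1], hq2', fun n hn => ?_⟩
    rcases Finset.mem_insert.1 hn with rfl | hn
    · exact ⟨c', hc'⟩
    · obtain ⟨c, hc⟩ := hc n hn
      exact ⟨c, by rw [← h1, hc, map_smul, h1]⟩

/-- The cyclic subspace generated by a vector. -/
def cyc (D : StarSubalgebra ℂ (B H)) (ξ : H) : Submodule ℂ H :=
  D.toSubalgebra.toSubmodule.map (ContinuousLinearMap.apply ℂ H ξ : B H →ₗ[ℂ] H)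

lemma cyc_le_closure (hD : IsMasa D) (ξ : H) : (cyc D ξ).topologicalClosure ≤
    (Submodule.span ℂ ((fun p : B H => p ξ) '' {p | IsProj D p})).topologicalClosure := by
  refine Submodule.topologicalClosure_minimal _ ?_ (Submodule.isClosed_topologicalClosure _)
  rintro _ ⟨a, ha, rfl⟩
  refine map_mem_closure (ContinuousLinearMap.apply ℂ H ξ).continuous
    (mem_closure_span_proj hD ha) fun s hs => ?_
  have := Submodule.mem_map_of_mem (f := (ContinuousLinearMap.apply ℂ H ξ : B H →ₗ[ℂ] H)) hs
  rw [Submodule.map_span] at this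
  exact this

lemma exists_finite_approx {S : Submodule ℂ H} {x : ℕ → H} (hx : Summable fun n => ‖x n‖ ^ 2)
    (hxS : ∀ n, x n ∈ S.topologicalClosure) {δ : ℝ} (hδ : 0 < δ) :
    ∃ (s : Finset ℕ) (y : ℕ → H), (∀ n, y n ∈ S) ∧ (∀ n ∉ s, y n = 0) ∧
      Summable (fun n => ‖x n - y n‖ ^ 2) ∧ ∑' n, ‖x n - y n‖ ^ 2 < δ := by
  have htail := tendsto_sum_nat_add fun n => ‖x n‖ ^ 2
  obtain ⟨N, hN⟩ := (htail.eventually (gt_mem_nhds (half_pos hδ))).exists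
  have happ : ∀ n, ∃ z ∈ S, ‖x n - z‖ ^ 2 < δ / (2 * (N + 1)) := fun n => by
    have hpos : 0 < δ / (2 * (N + 1)) := by positivity
    obtain ⟨z, hz, hd⟩ := Metric.mem_closure_iff.1 (hxS n) (√(δ / (2 * (N + 1))))
      (Real.sqrt_pos.2 hpos)
    refine ⟨z, hz, ?_⟩
    rw [dist_eq_norm] at hd
    calc _ < √(δ / (2 * (N + 1))) ^ 2 := by gcongr
      _ = _ := Real.sq_sqrt hpos.le
  choose z hzS hz using happ
  have htl : ∀ n, ‖x (n + N) - (if n + N < N then z (n + N) else 0)‖ ^ 2 = ‖x (n + N)‖ ^ 2 :=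
    fun n => by simp
  have hs : Summable fun n => ‖x n - (if n < N then z n else 0)‖ ^ 2 := by
    rw [← summable_nat_add_iff N]
    simp only [htl]
    exact (summable_nat_add_iff N).2 hx
  refine ⟨Finset.range N, fun n => if n < N then z n else 0, fun n => ?_, fun n hn => ?_, hs, ?_⟩
  · dsimp only; split_ifs
    · exact hzS n
    · exact S.zero_mem
  · simp only [Finset.mem_range] at hn; simp [hn]
  · rw [← hs.sum_add_tsum_nat_add N]
    simp only [htl]
    have h1 : ∑ n ∈ Finset.range N, ‖x n - (if n < N then z n else 0)‖ ^ 2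
        ≤ ∑ n ∈ Finset.range N, δ / (2 * (N + 1)) :=
      Finset.sum_le_sum fun n hn => by
        rw [if_pos (Finset.mem_range.1 hn)]; exact (hz n).le
    have h2 : ∑ n ∈ Finset.range N, δ / (2 * (N + 1)) ≤ δ / 2 := by
      rw [Finset.sum_const, Finset.card_range, nsmul_eq_mul, mul_div_assoc', div_le_div_iff₀
        (by positivity) (by positivity)]
      nlinarith
    linarith

/-- Square summable families in a cyclic subspace are nearly constant multiples of the cyclic
vector on nonzero compressions. -/
lemma exists_near_const (hD : IsMasa D) (ξ : H) {x : ℕ → H} (hx : Summable fun n => ‖x n‖ ^ 2)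
    (hxξ : ∀ n, x n ∈ (cyc D ξ).topologicalClosure) {q₀ : B H} (hq₀ : IsProj D q₀)
    (hq₀ξ : q₀ ξ ≠ 0) {ε : ℝ} (hε : 0 < ε) :
    ∃ q, IsProj D q ∧ q₀ * q = q ∧ q ξ ≠ 0 ∧ ∃ c : ℕ →₀ ℂ, ∀ b ∈ D,
      Summable (fun n => ‖b (q (x n - c n • ξ))‖ ^ 2) ∧
      ∑' n, ‖b (q (x n - c n • ξ))‖ ^ 2 ≤ (ε * ‖b (q ξ)‖) ^ 2 := by
  classical
  have hpos : 0 < (ε * ‖q₀ ξ‖) ^ 2 := by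
    have := norm_pos_iff.2 hq₀ξ
    positivity
  obtain ⟨s, y, hyS, hys, hsum, hlt⟩ :=
    exists_finite_approx hx (fun n => cyc_le_closure hD ξ (hxξ n)) hpos
  set w : ℕ → H := fun n => x n - y n with hw
  let ω : B H →ₗ[ℂ] ℂ :=
    { toFun := fun T => ∑' n, ⟪w n, T (w n)⟫_ℂ - (ε ^ 2 : ℝ) * ⟪ξ, T ξ⟫_ℂ
      map_add' := fun T T' => by
        simp only [add_apply, inner_add_right]
        rw [(summable_inner_apply hsum hsum T).tsum_add (summable_inner_apply hsum hsum T')]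
        ring
      map_smul' := fun c T => by
        simp only [smul_apply, inner_smul_right, RingHom.id_apply, smul_eq_mul]
        rw [tsum_mul_left]
        ring }
  have hω : IsNormalFunctional H ω := by
    let ω₁ : B H →ₗ[ℂ] ℂ :=
      { toFun := fun T => ∑' n, ⟪w n, T (w n)⟫_ℂ
        map_add' := fun T T' => by
          simp only [add_apply, inner_add_right]
          rw [(summable_inner_apply hsum hsum T).tsum_add (summable_inner_apply hsum hsum T')]
        map_smul' := fun c T => by
          simp only [smul_apply, inner_smul_right, RingHom.id_apply,
            smul_eq_mul]
          rw [tsum_mul_left] }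
    let ω₂ : B H →ₗ[ℂ] ℂ := (innerSL ℂ ξ : H →ₗ[ℂ] ℂ) ∘ₗ
      (ContinuousLinearMap.apply ℂ H ξ : B H →ₗ[ℂ] H)
    have h1 : IsNormalFunctional H ω₁ := .of_family _ hsum hsum fun T => rfl
    have h2 : IsNormalFunctional H ω₂ := .of_inner ξ ξ _ fun T => rfl
    have h3 : ω = ω₁ + (-((ε ^ 2 : ℝ) : ℂ)) • ω₂ := by
      refine LinearMap.ext fun T => ?_
      change ∑' n, ⟪w n, T (w n)⟫_ℂ - (ε ^ 2 : ℝ) * ⟪ξ, T ξ⟫_ℂ =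
        ∑' n, ⟪w n, T (w n)⟫_ℂ + (-((ε ^ 2 : ℝ) : ℂ)) * ⟪ξ, T ξ⟫_ℂ
      ring
    rw [h3]; exact h1.add (h2.smul _)
  have hcontr : ∀ b : B H, Summable fun n => ‖b (w n)‖ ^ 2 := fun b => by
    refine Summable.of_nonneg_of_le (fun n => sq_nonneg _) (fun n => ?_) (hsum.mul_left (‖b‖ ^ 2))
    rw [← mul_pow]
    exact pow_le_pow_left₀ (norm_nonneg _) (b.le_opNorm _) 2
  have hωb : ∀ b : B H, (ω (star b * b)).re = ∑' n, ‖b (w n)‖ ^ 2 - (ε * ‖b ξ‖) ^ 2 := by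
    intro b
    have h1 : ∀ u, ⟪u, (star b * b) u⟫_ℂ = ((‖b u‖ ^ 2 : ℝ) : ℂ) := fun u => by
      rw [mul_apply_eq_comp, ContinuousLinearMap.star_eq_adjoint,
        ContinuousLinearMap.adjoint_inner_right, inner_self_eq_norm_sq_to_K]
      simp
    change (∑' n, ⟪w n, (star b * b) (w n)⟫_ℂ - (ε ^ 2 : ℝ) * ⟪ξ, (star b * b) ξ⟫_ℂ).re = _
    simp only [h1]
    rw [← Complex.ofReal_tsum, ← Complex.ofReal_mul, ← Complex.ofReal_sub, Complex.ofReal_re,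
      mul_pow]
  have hωp : ∀ q, IsProj D q → (ω q).re = ∑' n, ‖q (w n)‖ ^ 2 - (ε * ‖q ξ‖) ^ 2 := by
    intro q hq
    rw [← hωb q, hq.2.isSelfAdjoint.star_eq, hq.2.isIdempotentElem.eq]
  have hneg : (ω q₀).re < 0 := by
    rw [hωp q₀ hq₀, sub_neg]
    refine lt_of_le_of_lt ?_ hlt
    exact (hcontr q₀).tsum_le_tsum
      (fun n => pow_le_pow_left₀ (norm_nonneg _) (hq₀.2.norm_apply_le _) 2) hsum
  obtain ⟨q₁, hq₁, hq₁₀, hq₁n, hc⟩ :=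
    exists_negative_scalar_finset hD ξ s (fun n _ => hyS n) q₀ hq₀ hneg
  obtain ⟨q, hq, hqq, hqn, hqb⟩ := exists_negative_compression hD hω hq₁ hq₁n
  have h1 : ∀ u, q (q₁ u) = q u := fun u => by
    rw [← mul_apply_eq_comp, hq₁.mul_eq_comm hq hqq]
  choose! c hc using hc
  have hqw : ∀ n, q (w n) = q (x n - (if n ∈ s then c n else 0) • ξ) := fun n => by
    rw [hw]
    simp only [map_sub, map_smul]
    congr 1
    split_ifs with hn
    · rw [← h1, hc n hn, map_smul, h1]
    · simp [hys n hn]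
  refine ⟨q, hq, by rw [← hqq, ← mul_assoc, hq₁₀], ?_,
    Finsupp.onFinset s (fun n => if n ∈ s then c n else 0) (by simp_all), fun b hb => ?_⟩
  · intro h0
    rw [hωp q hq, h0] at hqn
    have : 0 ≤ ∑' n, ‖q (w n)‖ ^ 2 := tsum_nonneg fun _ => sq_nonneg _
    simp at hqn
    linarith
  · simp only [Finsupp.onFinset_apply, ← hqw]
    refine ⟨hcontr (b * q), ?_⟩
    have h2 := hqb b hb
    have h3 : star b * b * q = star (b * q) * (b * q) := by
      rw [star_mul, hq.2.isSelfAdjoint.star_eq]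
      have : q * star b * (b * q) = (q * (star b * b)) * q := by noncomm_ring
      rw [this, ← hD.comm (mul_mem (star_mem hb) hb : star b * b ∈ D) hq.1, mul_assoc _ q q,
        hq.2.isIdempotentElem.eq]
    rw [h3, hωb] at h2
    simpa using h2

end NearConstant

section Rectangles

variable {H : Type*} [NormedAddCommGroup H] [InnerProductSpace ℂ H] [CompleteSpace H]
  {D : StarSubalgebra ℂ (B H)}

/-- On the range of `q`, the family `x` is `ε`-close to the constant multiples `c • ξ`, uniformly
over the algebra `D`. -/
def NearConst (D : StarSubalgebra ℂ (B H)) (ξ : H) (x : ℕ → H) (ε : ℝ) (q : B H) (c : ℕ →₀ ℂ) :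
    Prop :=
  ∀ b ∈ D, Summable (fun n => ‖b (q (x n - c n • ξ))‖ ^ 2) ∧
      ∑' n, ‖b (q (x n - c n • ξ))‖ ^ 2 ≤ (ε * ‖b (q ξ)‖) ^ 2

lemma NearConst.of_mul_eq {ξ : H} {x : ℕ → H} {ε : ℝ} {q q' : B H} {c : ℕ →₀ ℂ}
    (h : NearConst D ξ x ε q c) (hq : IsProj D q) (hq' : IsProj D q') (hqq : q * q' = q') :
    NearConst D ξ x ε q' c := fun b hb => by
  have key : ∀ v, b (q' v) = (b * q') (q v) := fun v => by
    rw [mul_apply_eq_comp, ← mul_apply_eq_comp q',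
      hq.mul_eq_comm hq' hqq]
  have := h (b * q') (mul_mem hb hq'.1)
  simpa only [← key] using this

lemma inner_apply_ne {a : B H} (hD : IsMasa D) {G : B H →L[ℂ] ℂ} (ha : a ∈ D) (h : G a ≠ 0) :
    ∃ p, IsProj D p ∧ G p ≠ 0 := by
  by_contra! hcon
  apply h
  have h1 : (Submodule.span ℂ {p | IsProj D p}).topologicalClosure ≤ G.ker :=
    Submodule.topologicalClosure_minimal _ (Submodule.span_le.2 fun p hp => hcon p hp)
      G.isClosed_ker
  exact h1 (mem_closure_span_proj hD ha)

lemma projOn_cyc (hD : IsMasa D) (ξ : H) : IsProj D (projOn (cyc D ξ)) :=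
  isProj_projOn hD fun a ha w hw => by
    obtain ⟨b, hb, rfl⟩ := hw
    exact ⟨a * b, (mul_mem ha hb : a * b ∈ D), rfl⟩

lemma mem_cyc {a : B H} (ha : a ∈ D) (ξ : H) : a ξ ∈ cyc D ξ := ⟨a, ha, rfl⟩

lemma projOn_cyc_apply (ξ : H) : projOn (cyc D ξ) ξ = ξ :=
  projOn_apply (by simpa using mem_cyc D.one_mem ξ)

/-- A hereditary and dense property of projections is satisfied by some projection that does not
annihilate a prescribed vector functional. -/
lemma exists_good_of_inner_ne (hD : IsMasa D) (ξ : H) {P : B H → Prop}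
    (hered : ∀ q q', IsProj D q → IsProj D q' → q * q' = q' → P q → P q')
    (dens : ∀ q₀, IsProj D q₀ → q₀ ξ ≠ 0 → ∃ q, IsProj D q ∧ q₀ * q = q ∧ q ξ ≠ 0 ∧ P q)
    {q₀ : B H} (hq₀ : IsProj D q₀) {v : H} (hv : ⟪v, q₀ ξ⟫_ℂ ≠ 0) :
    ∃ q, IsProj D q ∧ q₀ * q = q ∧ P q ∧ ⟪v, q ξ⟫_ℂ ≠ 0 := by
  by_contra! hcon
  have hall : ∀ q, IsProj D q → q₀ * q = q → P q → ∀ a ∈ D, ⟪v, a (q ξ)⟫_ℂ = 0 := by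
    intro q hq h1 h2 a ha
    by_contra hne
    let G : B H →L[ℂ] ℂ := (innerSL ℂ v).comp (ContinuousLinearMap.apply ℂ H (q ξ))
    obtain ⟨p, hp, hp'⟩ := inner_apply_ne hD (G := G) ha (by simpa [G] using hne)
    have hpq : IsProj D (q * p) := hq.mul hD hp
    have e1 : q * (q * p) = q * p := by rw [← mul_assoc, hq.2.isIdempotentElem.eq]
    refine hp' ?_
    have := hcon (q * p) hpq (by rw [← mul_assoc, h1]) (hered _ _ hq hpq e1 h2)
    rw [hD.comm hq.1 hp.1] at this
    simpa [G] using this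
  let M : Submodule ℂ H :=
    { carrier := {w | ∀ q, IsProj D q → q₀ * q = q → P q → q w = 0}
      add_mem' := fun {a b} ha hb q h1 h2 h3 => by
        rw [map_add, ha q h1 h2 h3, hb q h1 h2 h3, add_zero]
      zero_mem' := fun q _ _ _ => map_zero q
      smul_mem' := fun c a ha q h1 h2 h3 => by rw [map_smul, ha q h1 h2 h3, smul_zero] }
  have hr : IsProj D (projOn M) := isProj_projOn hD fun a ha w hw q h1 h2 h3 => by
    have := hw q h1 h2 h3
    rw [← mul_apply_eq_comp, hD.comm h1.1 ha, mul_apply_eq_comp, this,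
      map_zero]
  have hqr : ∀ q, IsProj D q → q₀ * q = q → P q → q * projOn M = 0 := fun q h1 h2 h3 =>
    ContinuousLinearMap.ext fun w => by
      simpa using eqOn_projOn (S := q) (T := 0) (M := M)
        (fun u hu => by simpa using hu q h1 h2 h3) w
  set r := projOn M with hrdef
  have hrq₀ : IsProj D (r * q₀) := hr.mul hD hq₀
  have hrξ : (r * q₀) ξ = 0 := by
    by_contra hne
    obtain ⟨q, hq, h1, h2, h3⟩ := dens _ hrq₀ hne
    have e1 : q₀ * q = q := by
      rw [← h1, hD.comm hr.1 hq₀.1, ← mul_assoc, ← mul_assoc, hq₀.2.isIdempotentElem.eq]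
    have e2 : q * q = 0 := by
      calc q * q = q * (r * q₀ * q) := by rw [h1]
        _ = (q * r) * (q₀ * q) := by simp only [mul_assoc]
        _ = 0 := by rw [hqr q hq e1 h3, zero_mul]
    rw [hq.2.isIdempotentElem.eq] at e2
    simp [e2] at h2
  have he := projOn_cyc hD ξ
  have hev : projOn (cyc D ξ) v ∈ M := fun q h1 h2 h3 => by
    rw [← mul_apply_eq_comp, hD.comm h1.1 he.1, mul_apply_eq_comp]
    refine projOn_eq_zero ?_
    rintro _ ⟨a, ha, rfl⟩
    have := hall q h1 h2 h3 a ha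
    change ⟪a ξ, q v⟫_ℂ = 0
    rw [← h1.2.inner_left, ← inner_conj_symm, ← mul_apply_eq_comp,
      hD.comm h1.1 ha, mul_apply_eq_comp, this, map_zero]
  apply hv
  have hqe : projOn (cyc D ξ) (q₀ ξ) = q₀ ξ := projOn_apply (mem_cyc hq₀.1 ξ)
  rw [← hqe, ← he.2.inner_left, ← projOn_apply hev, hr.2.inner_left,
    ← mul_apply_eq_comp r, hrξ, inner_zero_right]

/-- The estimate behind the dichotomy for Schur idempotents: a normal functional that is given by
nearly constant families is close to a multiple of a vector functional. -/
lemma exists_near_scalar {ξ η : H} {x y : ℕ → H} {p q : B H} {R N : ℝ} {c d : ℕ →₀ ℂ}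
    (hR : 0 < R) (hN : 0 ≤ N)
    (hyR : ∀ a ∈ D, Summable (fun n => ‖a (p (y n))‖ ^ 2) ∧
      ∑' n, ‖a (p (y n))‖ ^ 2 ≤ (R * ‖a (p η)‖) ^ 2)
    (hx : NearConst D ξ x (1 / (10 * R)) q c)
    (hcN : ∑ n ∈ c.support, ‖c n‖ ^ 2 ≤ N ^ 2)
    (hy : NearConst D η y (1 / (10 * (N + 1))) p d)
    {T : B H} {a b : B H} (ha : a ∈ D) (hb : b ∈ D) :
    ‖∑' n, ⟪a (p (y n)), T (b (q (x n)))⟫_ℂ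
        - (∑ n ∈ c.support, c n * (starRingEnd ℂ) (d n)) * ⟪a (p η), T (b (q ξ))⟫_ℂ‖
      ≤ 1 / 5 * ‖T‖ * (‖a (p η)‖ * ‖b (q ξ)‖) := by
  obtain ⟨sy, by'⟩ := hyR a ha
  obtain ⟨sx, bx⟩ := hx b hb
  obtain ⟨sd, bd⟩ := hy a ha
  have sc : Summable fun n => ‖c n • b (q ξ)‖ ^ 2 :=
    summable_of_ne_finset_zero (s := c.support) fun n hn => by
      simp [Finsupp.notMem_support_iff.1 hn]
  have bc : ∑' n, ‖c n • b (q ξ)‖ ^ 2 ≤ (N * ‖b (q ξ)‖) ^ 2 := by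
    rw [tsum_eq_sum (s := c.support) fun n hn => by simp [Finsupp.notMem_support_iff.1 hn]]
    simp only [norm_smul, mul_pow]
    rw [← Finset.sum_mul]
    gcongr
  have e1 := norm_tsum_inner_apply_le sx sy T (by positivity) (by positivity) bx by'
  have e2 := norm_tsum_inner_apply_le sc sd T (by positivity) (by positivity) bc bd
  have s1 := summable_inner_apply sx sy T
  have s2 := summable_inner_apply sc sd T
  have s3 : Summable fun n => c n * (starRingEnd ℂ) (d n) * ⟪a (p η), T (b (q ξ))⟫_ℂ :=
    summable_of_ne_finset_zero (s := c.support) fun n hn => by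
      simp [Finsupp.notMem_support_iff.1 hn]
  have key : ∑' n, ⟪a (p (y n)), T (b (q (x n)))⟫_ℂ
      = ∑' n, ⟪a (p (y n)), T (b (q (x n - c n • ξ)))⟫_ℂ
        + ∑' n, ⟪a (p (y n - d n • η)), T (c n • b (q ξ))⟫_ℂ
        + (∑ n ∈ c.support, c n * (starRingEnd ℂ) (d n)) * ⟪a (p η), T (b (q ξ))⟫_ℂ := by
    rw [Finset.sum_mul, ← tsum_eq_sum (L := .unconditional ℕ) (s := c.support)
      (f := fun n => c n * (starRingEnd ℂ) (d n) * ⟪a (p η), T (b (q ξ))⟫_ℂ)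
      fun n hn => by simp [Finsupp.notMem_support_iff.1 hn],
      ← s1.tsum_add s2, ← (s1.add s2).tsum_add s3]
    refine tsum_congr fun n => ?_
    simp only [map_sub, map_smul, inner_sub_left, inner_sub_right, inner_smul_left,
      inner_smul_right]
    ring
  rw [key, add_sub_cancel_right]
  refine (norm_add_le _ _).trans ((add_le_add e1 e2).trans ?_)
  have h1 : 1 / (10 * R) * ‖b (q ξ)‖ * (R * ‖a (p η)‖) = 1 / 10 * (‖a (p η)‖ * ‖b (q ξ)‖) := by
    field_simp
  have h2 : N * ‖b (q ξ)‖ * (1 / (10 * (N + 1)) * ‖a (p η)‖)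
      ≤ 1 / 10 * (‖a (p η)‖ * ‖b (q ξ)‖) := by
    have : N * (1 / (10 * (N + 1))) ≤ 1 / 10 := by
      rw [mul_one_div, div_le_div_iff₀ (by positivity) (by positivity)]; linarith
    calc _ = N * (1 / (10 * (N + 1))) * (‖a (p η)‖ * ‖b (q ξ)‖) := by ring
      _ ≤ _ := by gcongr
  calc _ ≤ ‖T‖ * (1 / 10 * (‖a (p η)‖ * ‖b (q ξ)‖)) + ‖T‖ * (1 / 10 * (‖a (p η)‖ * ‖b (q ξ)‖)) := by
        rw [h1]; gcongr
    _ = _ := by ring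

lemma NearConst.exists_bound {η : H} {y : ℕ → H} {ε : ℝ} {p : B H} {d : ℕ →₀ ℂ}
    (h : NearConst D η y ε p d) :
    ∃ R, 0 < R ∧ ∀ a ∈ D, Summable (fun n => ‖a (p (y n))‖ ^ 2) ∧
      ∑' n, ‖a (p (y n))‖ ^ 2 ≤ (R * ‖a (p η)‖) ^ 2 := by
  set S : ℝ := ∑ n ∈ d.support, ‖d n‖ ^ 2 with hS
  have hS0 : 0 ≤ S := Finset.sum_nonneg fun _ _ => sq_nonneg _
  refine ⟨1 + 2 * ε ^ 2 + 2 * S, by positivity, fun a ha => ?_⟩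
  obtain ⟨s1, b1⟩ := h a ha
  have s2 : Summable fun n => ‖d n • a (p η)‖ ^ 2 :=
    summable_of_ne_finset_zero (s := d.support) fun n hn => by
      simp [Finsupp.notMem_support_iff.1 hn]
  have b2 : ∑' n, ‖d n • a (p η)‖ ^ 2 = S * ‖a (p η)‖ ^ 2 := by
    rw [tsum_eq_sum (s := d.support) fun n hn => by simp [Finsupp.notMem_support_iff.1 hn]]
    simp only [norm_smul, mul_pow]
    rw [← Finset.sum_mul]
  have hle : ∀ n, ‖a (p (y n))‖ ^ 2
      ≤ 2 * ‖a (p (y n - d n • η))‖ ^ 2 + 2 * ‖d n • a (p η)‖ ^ 2 := fun n => by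
    have h1 : a (p (y n)) = a (p (y n - d n • η)) + d n • a (p η) := by simp
    have h2 := norm_add_le (a (p (y n - d n • η))) (d n • a (p η))
    rw [← h1] at h2
    nlinarith [norm_nonneg (a (p (y n))), sq_nonneg (‖a (p (y n - d n • η))‖ - ‖d n • a (p η)‖)]
  have s3 := (s1.mul_left 2).add (s2.mul_left 2)
  have s4 := Summable.of_nonneg_of_le (fun n => sq_nonneg _) hle s3
  refine ⟨s4, (s4.tsum_le_tsum hle s3).trans ?_⟩
  rw [(s1.mul_left 2).tsum_add (s2.mul_left 2), tsum_mul_left, tsum_mul_left, b2, mul_pow]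
  have h5 : 0 ≤ ‖a (p η)‖ ^ 2 := sq_nonneg _
  rw [mul_pow] at b1
  have h6 : 2 * ε ^ 2 + 2 * S ≤ (1 + 2 * ε ^ 2 + 2 * S) ^ 2 := by nlinarith [sq_nonneg ε]
  calc _ ≤ 2 * (ε ^ 2 * ‖a (p η)‖ ^ 2) + 2 * (S * ‖a (p η)‖ ^ 2) := by gcongr
    _ = (2 * ε ^ 2 + 2 * S) * ‖a (p η)‖ ^ 2 := by ring
    _ ≤ _ := by gcongr

/-- The rectangle `(p, q)` is contained in the support of `Φ`. -/
def Full (Φ : B H →L[ℂ] B H) (p q : B H) : Prop := ∀ T, Φ (p * T * q) = p * T * q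

/-- The rectangle `(p, q)` is disjoint from the support of `Φ`. -/
def Emp (Φ : B H →L[ℂ] B H) (p q : B H) : Prop := ∀ T, Φ (p * T * q) = 0

lemma full_or_emp_of_near_scalar {Φ : B H →L[ℂ] B H} (hΦ : IsSchurIdempotent D Φ) {p q : B H}
    (hp : IsProj D p) (hq : IsProj D q) {γ : ℂ}
    (h : ∀ T, ‖p * (Φ T - γ • T) * q‖ ≤ 1 / 5 * ‖T‖) : Full Φ p q ∨ Emp Φ p q := by
  have hbim := hΦ.1.2 p hp.1 q hq.1
  have hid : ∀ T, Φ (Φ T) = Φ T := fun T => by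
    rw [← ContinuousLinearMap.comp_apply, hΦ.2]
  have hcorner : ∀ T, ‖Φ (p * T * q) - γ • (p * T * q)‖ ≤ 1 / 5 * ‖p * T * q‖ := fun T => by
    have := h (p * T * q)
    rw [mul_sub, sub_mul, ← hbim, mul_smul_comm, smul_mul_assoc] at this
    have e : p * (p * T * q) * q = p * T * q := by
      simp only [mul_assoc, hq.2.isIdempotentElem.eq]
      rw [← mul_assoc p p, hp.2.isIdempotentElem.eq]
    rwa [e] at this
  by_cases hγ : 1 / 5 < ‖1 - γ‖
  · right
    intro T
    have := hcorner (Φ T)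
    rw [hbim, hid, ← hbim] at this
    by_contra hne
    rw [hbim, ← hbim, show Φ (p * T * q) - γ • Φ (p * T * q) = (1 - γ) • Φ (p * T * q) by
      rw [sub_smul, one_smul], norm_smul] at this
    nlinarith [norm_pos_iff.2 hne]
  · left
    intro T
    have := hcorner (T - Φ T)
    rw [mul_sub, sub_mul, ← hbim, map_sub, hid, sub_self, zero_sub, norm_neg, norm_smul] at this
    by_contra hne
    have h1 : 0 < ‖p * T * q - Φ (p * T * q)‖ := norm_pos_iff.2 (sub_ne_zero.2 (Ne.symm hne))
    have h2 : ‖(1 : ℂ)‖ ≤ ‖1 - γ‖ + ‖γ‖ := by simpa using norm_add_le (1 - γ) γ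
    rw [norm_one] at h2
    nlinarith

end Rectangles

section Existence

variable {H : Type*} [NormedAddCommGroup H] [InnerProductSpace ℂ H] [CompleteSpace H]
  {D : StarSubalgebra ℂ (B H)}

lemma norm_compress_le {M N : Submodule ℂ H} {A : B H} {C : ℝ} (hC : 0 ≤ C)
    (h : ∀ v ∈ M, ∀ w ∈ N, ‖⟪v, A w⟫_ℂ‖ ≤ C * (‖v‖ * ‖w‖)) : ‖projOn M * A * projOn N‖ ≤ C := by
  have h1 : ∀ w ∈ N, ∀ v ∈ closure (M : Set H), ‖⟪v, A w⟫_ℂ‖ ≤ C * (‖v‖ * ‖w‖) := fun w hw =>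
    fun v hv => closure_minimal (t := {v | ‖⟪v, A w⟫_ℂ‖ ≤ C * (‖v‖ * ‖w‖)})
      (fun v hv => h v hv w hw)
      (isClosed_le (by fun_prop) (by fun_prop)) hv
  have h2 : ∀ v ∈ closure (M : Set H), ∀ w ∈ closure (N : Set H),
      ‖⟪v, A w⟫_ℂ‖ ≤ C * (‖v‖ * ‖w‖) := fun v hv =>
    fun w hw => closure_minimal (t := {w | ‖⟪v, A w⟫_ℂ‖ ≤ C * (‖v‖ * ‖w‖)})
      (fun w hw => h1 w hw v hv)
      (isClosed_le (by fun_prop) (by fun_prop)) hw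
  refine ContinuousLinearMap.opNorm_le_bound _ hC fun u => ?_
  set z := (projOn M * A * projOn N) u with hz
  have e1 : ⟪z, z⟫_ℂ = ⟪z, A (projOn N u)⟫_ℂ := by
    have : z = projOn M (A (projOn N u)) := rfl
    nth_rewrite 2 [this]
    rw [← (projOn_star M).inner_left, this, (projOn_star M).mul_apply]
  have e2 := h2 z (projOn_mem_closure M _) (projOn N u) (projOn_mem_closure N u)
  rw [← e1, inner_self_eq_norm_sq_to_K] at e2
  have e3 : ‖z‖ ^ 2 ≤ C * (‖z‖ * ‖projOn N u‖) := by simpa using e2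
  have e4 := (projOn_star N).norm_apply_le u
  by_cases hz0 : ‖z‖ = 0
  · rw [hz0]; positivity
  · have hzp : 0 < ‖z‖ := lt_of_le_of_ne (norm_nonneg _) (Ne.symm hz0)
    have e5 : ‖z‖ ≤ C * ‖projOn N u‖ := by
      refine le_of_mul_le_mul_left ?_ hzp
      linarith
    exact e5.trans (mul_le_mul_of_nonneg_left e4 hC)

/-- A rectangle that meets the support of a Schur idempotent contains a nonzero rectangle lying
inside the support. -/
lemma exists_full (hD : IsMasa D) {Φ : B H →L[ℂ] B H} (hΦ : IsSchurIdempotent D Φ) {p q : B H}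
    (hp : IsProj D p) (hq : IsProj D q) (h : ¬ Emp Φ p q) :
    ∃ p' q', IsProj D p' ∧ IsProj D q' ∧ p * p' = p' ∧ q * q' = q' ∧ p' ≠ 0 ∧ q' ≠ 0 ∧
      Full Φ p' q' := by
  simp only [Emp, not_forall] at h
  obtain ⟨T₀, hT₀⟩ := h
  rw [hΦ.1.2 p hp.1 q hq.1] at hT₀
  set S := Φ T₀ with hS
  obtain ⟨ξ, hξ⟩ : ∃ ξ, (p * S * q) ξ ≠ 0 := by
    by_contra! hcon
    exact hT₀ (ContinuousLinearMap.ext fun v => by simpa using hcon v)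
  set η := (p * S * q) ξ with hη
  have hη0 : ⟪S (q ξ), p η⟫_ℂ ≠ 0 := by
    rw [← hp.2.inner_left]
    exact inner_self_ne_zero.2 hξ
  let ω₀ : B H →ₗ[ℂ] ℂ :=
    ((innerSL ℂ η).comp (ContinuousLinearMap.apply ℂ H ξ : B H →L[ℂ] H) : B H →ₗ[ℂ] ℂ)
  have hω₀ : IsNormalFunctional H ω₀ := .of_inner ξ η ω₀ fun T => rfl
  obtain ⟨x₀, y₀, hx₀, hy₀, hω⟩ := isNormalMap_of_wStarContinuous hΦ.1.1 ω₀ hω₀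
  set e := projOn (cyc D ξ) with he
  set f := projOn (cyc D η) with hf
  have heD : IsProj D e := projOn_cyc hD ξ
  have hfD : IsProj D f := projOn_cyc hD η
  have hx : Summable fun n => ‖e (x₀ n)‖ ^ 2 :=
    Summable.of_nonneg_of_le (fun _ => sq_nonneg _) (fun n => by
      have := heD.2.norm_apply_le (x₀ n); gcongr) hx₀
  have hy : Summable fun n => ‖f (y₀ n)‖ ^ 2 :=
    Summable.of_nonneg_of_le (fun _ => sq_nonneg _) (fun n => by
      have := hfD.2.norm_apply_le (y₀ n); gcongr) hy₀
  have hform : ∀ T, ∀ a ∈ D, ∀ b ∈ D,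
      ⟪a η, Φ T (b ξ)⟫_ℂ = ∑' n, ⟪a (f (y₀ n)), T (b (e (x₀ n)))⟫_ℂ := fun T a ha b hb => by
    have hae : star (a * f) ∈ D := star_mem (mul_mem ha hfD.1 : a * f ∈ D)
    have h1 := hω (star (a * f) * T * (b * e))
    change ⟪η, Φ (star (a * f) * T * (b * e)) ξ⟫_ℂ = _ at h1
    rw [hΦ.1.2 _ hae _ (mul_mem hb heD.1)] at h1
    simp only [mul_apply_eq_comp, ContinuousLinearMap.star_eq_adjoint,
      ContinuousLinearMap.adjoint_inner_right] at h1
    rwa [hf, he, projOn_cyc_apply, projOn_cyc_apply] at h1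
  have hered : ∀ (ζ : H) (z : ℕ → H) (ε : ℝ) (r r' : B H), IsProj D r → IsProj D r' → r * r' = r' →
      (∃ c, NearConst D ζ z ε r c) → ∃ c, NearConst D ζ z ε r' c :=
    fun ζ z ε r r' h1 h2 h3 ⟨c, hc⟩ => ⟨c, hc.of_mul_eq h1 h2 h3⟩
  obtain ⟨p₁, hp₁, hpp₁, ⟨d₀, hd₀⟩, hne₁⟩ := exists_good_of_inner_ne hD η
    (P := fun r => ∃ d, NearConst D η (fun n => f (y₀ n)) 1 r d) (hered _ _ _)
    (fun r hr hrη => exists_near_const hD η hy (fun n => projOn_mem_closure _ _) hr hrη one_pos)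
    hp hη0
  obtain ⟨R, hR, hyR⟩ := hd₀.exists_bound
  have hne₁' : ⟪(star S) (p₁ η), q ξ⟫_ℂ ≠ 0 := by
    rwa [ContinuousLinearMap.star_eq_adjoint, ContinuousLinearMap.adjoint_inner_left, ne_eq,
      inner_eq_zero_symm]
  obtain ⟨q₁, hq₁, hqq₁, ⟨c, hc⟩, hne₂⟩ := exists_good_of_inner_ne hD ξ
    (P := fun r => ∃ d, NearConst D ξ (fun n => e (x₀ n)) (1 / (10 * R)) r d) (hered _ _ _)
    (fun r hr hrη => exists_near_const hD ξ hx (fun n => projOn_mem_closure _ _) hr hrη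
      (by positivity)) hq hne₁'
  rw [ContinuousLinearMap.star_eq_adjoint, ContinuousLinearMap.adjoint_inner_left, ne_eq,
      inner_eq_zero_symm] at hne₂
  set N : ℝ := 1 + ∑ n ∈ c.support, ‖c n‖ ^ 2 with hN
  have hN1 : 1 ≤ N := by
    have : 0 ≤ ∑ n ∈ c.support, ‖c n‖ ^ 2 := Finset.sum_nonneg fun _ _ => sq_nonneg _
    linarith
  obtain ⟨p₂, hp₂, hpp₂, ⟨d, hd⟩, hne₃⟩ := exists_good_of_inner_ne hD η
    (P := fun r => ∃ d, NearConst D η (fun n => f (y₀ n)) (1 / (10 * (N + 1))) r d) (hered _ _ _)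
    (fun r hr hrη => exists_near_const hD η hy (fun n => projOn_mem_closure _ _) hr hrη
      (by positivity)) hp₁ hne₂
  have hyR₂ : ∀ a ∈ D, Summable (fun n => ‖a (p₂ (f (y₀ n)))‖ ^ 2) ∧
      ∑' n, ‖a (p₂ (f (y₀ n)))‖ ^ 2 ≤ (R * ‖a (p₂ η)‖) ^ 2 := fun a ha => by
    have e1 : ∀ v, (a * p₂) (p₁ v) = a (p₂ v) := fun v => by
      rw [mul_apply_eq_comp, ← mul_apply_eq_comp p₂,
        hp₁.mul_eq_comm hp₂ hpp₂]
    simpa only [e1] using hyR (a * p₂) (mul_mem ha hp₂.1)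
  set γ : ℂ := ∑ n ∈ c.support, c n * (starRingEnd ℂ) (d n) with hγ
  have hest : ∀ T, ‖projOn (cyc D (p₂ η)) * (Φ T - γ • T) * projOn (cyc D (q₁ ξ))‖
      ≤ 1 / 5 * ‖T‖ := fun T => by
    refine norm_compress_le (by positivity) ?_
    rintro _ ⟨a, ha, rfl⟩ _ ⟨b, hb, rfl⟩
    have := exists_near_scalar hR (by linarith) hyR₂ hc (by nlinarith) hd (T := T) ha hb
    rw [← hγ] at this
    have e1 := hform T (a * p₂) (mul_mem ha hp₂.1) (b * q₁) (mul_mem hb hq₁.1)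
    simp only [mul_apply_eq_comp] at e1
    change ‖⟪a (p₂ η), (Φ T - γ • T) (b (q₁ ξ))⟫_ℂ‖ ≤ _ * (‖a (p₂ η)‖ * ‖b (q₁ ξ)‖)
    rw [sub_apply, inner_sub_right, e1, smul_apply,
      inner_smul_right]
    exact this
  have hpt := projOn_cyc hD (p₂ η)
  have hqt := projOn_cyc hD (q₁ ξ)
  have hsub : ∀ {r r₂ : B H} {ζ : H}, IsProj D r → IsProj D r₂ → r * r₂ = r₂ →
      r * projOn (cyc D (r₂ ζ)) = projOn (cyc D (r₂ ζ)) := fun {r r₂ ζ} h1 h2 h3 =>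
    ContinuousLinearMap.ext fun u => eqOn_projOn (S := r) (T := 1) (fun w hw => by
      obtain ⟨a, ha, rfl⟩ := hw
      change r (a (r₂ ζ)) = a (r₂ ζ)
      rw [← mul_apply_eq_comp, hD.comm h1.1 ha, mul_apply_eq_comp,
        ← mul_apply_eq_comp r, h3]) u
  have hpp₂' : p * p₂ = p₂ := by rw [← hpp₂, ← mul_assoc, hpp₁]
  have hvec : ⟪p₂ η, S (q₁ ξ)⟫_ℂ ≠ 0 := by rwa [ne_eq, inner_eq_zero_symm]
  refine ⟨_, _, hpt, hqt, hsub hp hp₂ hpp₂', hsub hq hq₁ hqq₁, fun h0 => ?_, fun h0 => ?_, ?_⟩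
  · have := projOn_cyc_apply (D := D) (p₂ η)
    rw [h0] at this
    apply hvec
    rw [← this]
    simp
  · have := projOn_cyc_apply (D := D) (q₁ ξ)
    rw [h0] at this
    apply hvec
    rw [← this]
    simp
  · refine (full_or_emp_of_near_scalar hΦ hpt hqt hest).resolve_right fun hemp => hvec ?_
    have := hemp T₀
    rw [hΦ.1.2 _ hpt.1 _ hqt.1] at this
    have := congrArg (fun A : B H => ⟪p₂ η, A (q₁ ξ)⟫_ℂ) this
    simp only [mul_apply_eq_comp, zero_apply, inner_zero_right,
      ← hpt.2.inner_left, projOn_cyc_apply] at this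
    exact this

end Existence

section Blocks

variable {H : Type*} [NormedAddCommGroup H] [InnerProductSpace ℂ H]

lemma IsStarProjection.exists_unit [CompleteSpace H] {p : B H} (hp : IsStarProjection p)
    (h : p ≠ 0) : ∃ f, ‖f‖ = 1 ∧ p f = f := by
  obtain ⟨v, hv⟩ : ∃ v, p v ≠ 0 := by
    by_contra! hcon
    exact h (ContinuousLinearMap.ext fun v => by simpa using hcon v)
  refine ⟨(‖p v‖⁻¹ : ℂ) • p v, ?_, ?_⟩
  · rw [norm_smul, norm_inv, Complex.norm_real, norm_norm,
      inv_mul_cancel₀ (norm_ne_zero_iff.2 hv)]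
  · rw [map_smul, hp.mul_apply]

/-- The rank one operator `v ↦ ⟪g, v⟫ f`. -/
def rk (f g : H) : B H := (innerSL ℂ g).smulRight f

@[simp] lemma rk_apply (f g v : H) : rk f g v = ⟪g, v⟫_ℂ • f := by simp [rk]

variable [CompleteSpace H] {D : StarSubalgebra ℂ (B H)} {Φ : B H →L[ℂ] B H}

lemma mul_rk_mul {p q : B H} (hq : IsStarProjection q) {f g : H} (hf : p f = f)
    (hg : q g = g) : p * rk f g * q = rk f g := by
  ext v
  simp only [mul_apply_eq_comp, rk_apply, map_smul, hf]
  rw [← hq.inner_left, hg]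

lemma eq_zero_of_full_of_emp {p q : B H} (hp : IsStarProjection p) (hq : IsStarProjection q)
    (h1 : Full Φ p q) (h2 : Emp Φ p q) : p = 0 ∨ q = 0 := by
  by_contra! hne
  obtain ⟨f, hf, hpf⟩ := hp.exists_unit hne.1
  obtain ⟨g, hg, hqg⟩ := hq.exists_unit hne.2
  have h3 := (h1 (rk f g)).symm.trans (h2 _)
  rw [mul_rk_mul hq hpf hqg] at h3
  have := congrArg (fun A : B H => A g) h3
  simp only [rk_apply, inner_self_eq_norm_sq_to_K, hg] at this
  simp only [Complex.ofReal_one, Complex.coe_algebraMap, one_pow, one_smul,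
    zero_apply] at this
  simp [this] at hf

lemma Full.left {p p' q : B H} (h : Full Φ p q) (hp : p * p' = p') : Full Φ p' q := fun T => by
  have := h (p' * T)
  rwa [← mul_assoc, hp] at this

lemma Full.right {p q q' : B H} (h : Full Φ p q) (hp : q' * q = q') : Full Φ p q' := fun T => by
  have := h (T * q')
  rwa [mul_assoc, mul_assoc, hp, ← mul_assoc] at this

lemma Emp.left {p p' q : B H} (h : Emp Φ p q) (hp : p * p' = p') : Emp Φ p' q := fun T => by
  have := h (p' * T)
  rwa [← mul_assoc, hp] at this

lemma Emp.right {p q q' : B H} (h : Emp Φ p q) (hp : q' * q = q') : Emp Φ p q' := fun T => by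
  have := h (T * q')
  rwa [mul_assoc, mul_assoc, hp, ← mul_assoc] at this

/-- The support of a contractive Schur idempotent does not contain exactly three of the four
corners of a `2 × 2` grid. -/
lemma not_three_full (hc : ‖Φ‖ ≤ 1) {p₁ p₂ q₁ q₂ : B H} (hp₁ : IsStarProjection p₁)
    (hp₂ : IsStarProjection p₂) (hq₁ : IsStarProjection q₁) (hq₂ : IsStarProjection q₂)
    (hp : p₁ * p₂ = 0) (hq : q₁ * q₂ = 0) (h11 : Full Φ p₁ q₁) (h12 : Full Φ p₁ q₂)
    (h21 : Full Φ p₂ q₁) (h22 : Emp Φ p₂ q₂) (n1 : p₁ ≠ 0) (n2 : p₂ ≠ 0) (m1 : q₁ ≠ 0)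
    (m2 : q₂ ≠ 0) : False := by
  obtain ⟨f₁, hf₁, e₁⟩ := hp₁.exists_unit n1
  obtain ⟨f₂, hf₂, e₂⟩ := hp₂.exists_unit n2
  obtain ⟨g₁, hg₁, d₁⟩ := hq₁.exists_unit m1
  obtain ⟨g₂, hg₂, d₂⟩ := hq₂.exists_unit m2
  have of : ⟪f₁, f₂⟫_ℂ = 0 := by
    rw [← e₁, ← e₂, hp₁.inner_left, ← mul_apply_eq_comp p₁, hp]; simp
  have og : ⟪g₁, g₂⟫_ℂ = 0 := by
    rw [← d₁, ← d₂, hq₁.inner_left, ← mul_apply_eq_comp q₁, hq]; simp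
  have og' : ⟪g₂, g₁⟫_ℂ = 0 := inner_eq_zero_symm.1 og
  have og1 : ⟪g₁, g₁⟫_ℂ = 1 := by rw [inner_self_eq_norm_sq_to_K, hg₁]; simp
  have og2 : ⟪g₂, g₂⟫_ℂ = 1 := by rw [inner_self_eq_norm_sq_to_K, hg₂]; simp
  have hnorm : ∀ a b : ℂ, ‖a • f₁ + b • f₂‖ ^ 2 = ‖a‖ ^ 2 + ‖b‖ ^ 2 := fun a b => by
    have := norm_add_sq_eq_norm_sq_add_norm_sq_of_inner_eq_zero (𝕜 := ℂ) (a • f₁) (b • f₂)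
      (by rw [inner_smul_left, inner_smul_right, of]; simp)
    rw [sq, this, norm_smul, norm_smul, hf₁, hf₂]; ring
  have hnormg : ‖(2 : ℂ) • g₁ + g₂‖ ^ 2 = 5 := by
    have := norm_add_sq_eq_norm_sq_add_norm_sq_of_inner_eq_zero (𝕜 := ℂ) ((2 : ℂ) • g₁) g₂
      (by rw [inner_smul_left, og]; simp)
    rw [sq, this, norm_smul, hg₁, hg₂]; norm_num
  set X : B H := rk f₁ g₁ + rk f₁ g₂ + rk f₂ g₁ - rk f₂ g₂ with hX
  have hXv : ∀ v, ‖X v‖ ≤ √2 * ‖v‖ := fun v => by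
    have hbes : ‖⟪g₁, v⟫_ℂ‖ ^ 2 + ‖⟪g₂, v⟫_ℂ‖ ^ 2 ≤ ‖v‖ ^ 2 := by
      have ho : Orthonormal ℂ ![g₁, g₂] := by
        rw [orthonormal_iff_ite]
        intro i j
        fin_cases i <;> fin_cases j <;> simp [og, og', hg₁, hg₂]
      have := ho.sum_inner_products_le (x := v) (s := Finset.univ)
      simpa using this
    have e : X v = (⟪g₁, v⟫_ℂ + ⟪g₂, v⟫_ℂ) • f₁ + (⟪g₁, v⟫_ℂ - ⟪g₂, v⟫_ℂ) • f₂ := by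
      simp only [hX, sub_apply, add_apply, rk_apply]
      module
    have hpar := parallelogram_law_with_norm ℂ ⟪g₁, v⟫_ℂ ⟪g₂, v⟫_ℂ
    have hsq : ‖X v‖ ^ 2 ≤ (√2 * ‖v‖) ^ 2 := by
      rw [e, hnorm, mul_pow, Real.sq_sqrt (by norm_num)]
      nlinarith
    exact (abs_le_of_sq_le_sq' hsq (by positivity)).2
  have hX1 : ‖X‖ ≤ √2 := ContinuousLinearMap.opNorm_le_bound _ (by positivity) hXv
  have hΦX : Φ X = rk f₁ g₁ + rk f₁ g₂ + rk f₂ g₁ := by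
    have a1 := h11 (rk f₁ g₁)
    have a2 := h12 (rk f₁ g₂)
    have a3 := h21 (rk f₂ g₁)
    have a4 := h22 (rk f₂ g₂)
    rw [mul_rk_mul hq₁ e₁ d₁] at a1
    rw [mul_rk_mul hq₂ e₁ d₂] at a2
    rw [mul_rk_mul hq₁ e₂ d₁] at a3
    rw [mul_rk_mul hq₂ e₂ d₂] at a4
    rw [hX, map_sub, map_add, map_add, a1, a2, a3, a4, sub_zero]
  have hval : Φ X ((2 : ℂ) • g₁ + g₂) = (3 : ℂ) • f₁ + (2 : ℂ) • f₂ := by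
    rw [hΦX]
    simp only [add_apply, rk_apply, inner_add_right, inner_smul_right, og, og',
      og1, og2]
    module
  have h1 : ‖Φ X‖ ≤ √2 := by
    calc ‖Φ X‖ ≤ 1 * ‖X‖ := Φ.le_of_opNorm_le hc X
      _ ≤ √2 := by rw [one_mul]; exact hX1
  have h2 := (Φ X).le_of_opNorm_le h1 ((2 : ℂ) • g₁ + g₂)
  rw [hval] at h2
  have h3 : ‖(3 : ℂ) • f₁ + (2 : ℂ) • f₂‖ ^ 2 ≤ (√2 * ‖(2 : ℂ) • g₁ + g₂‖) ^ 2 := by gcongr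
  rw [hnorm, mul_pow, Real.sq_sqrt (by norm_num), hnormg] at h3
  norm_num at h3

lemma IsSchurIdempotent.one_sub (hΦ : IsSchurIdempotent D Φ) :
    IsSchurIdempotent D (ContinuousLinearMap.id ℂ (B H) - Φ) := by
  refine ⟨⟨?_, fun A hA C hC T => ?_⟩, ?_⟩
  · exact (IsNormalMap.id.sub (isNormalMap_of_wStarContinuous hΦ.1.1)).continuous
  · simp only [sub_apply, ContinuousLinearMap.id_apply]
    rw [hΦ.1.2 A hA C hC, mul_sub, sub_mul]
  · have := hΦ.2
    ext1 T
    have h2 := congrArg (fun Ψ : B H →L[ℂ] B H => Ψ T) this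
    simp only [ContinuousLinearMap.comp_apply] at h2
    simp [h2]

lemma emp_one_sub_iff {p q : B H} :
    Emp (ContinuousLinearMap.id ℂ (B H) - Φ) p q ↔ Full Φ p q := by
  simp only [Emp, Full, sub_apply, ContinuousLinearMap.id_apply, sub_eq_zero]
  exact ⟨fun h T => (h T).symm, fun h T => (h T).symm⟩

lemma full_one_sub_iff {p q : B H} :
    Full (ContinuousLinearMap.id ℂ (B H) - Φ) p q ↔ Emp Φ p q := by
  simp [Emp, Full]

lemma exists_emp (hD : IsMasa D) (hΦ : IsSchurIdempotent D Φ) {p q : B H}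
    (hp : IsProj D p) (hq : IsProj D q) (h : ¬ Full Φ p q) :
    ∃ p' q', IsProj D p' ∧ IsProj D q' ∧ p * p' = p' ∧ q * q' = q' ∧ p' ≠ 0 ∧ q' ≠ 0 ∧
      Emp Φ p' q' := by
  simpa only [full_one_sub_iff] using exists_full hD hΦ.one_sub hp hq (mt emp_one_sub_iff.1 h)

/-- A maximal rectangle inside the support of `Φ` whose row and column strips otherwise avoid the
support. -/
structure IsBlock (D : StarSubalgebra ℂ (B H)) (Φ : B H →L[ℂ] B H) (p q : B H) : Prop where
  left : IsProj D p
  right : IsProj D q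
  left_ne : p ≠ 0
  right_ne : q ≠ 0
  full : Full Φ p q
  emp_right : Emp Φ p (1 - q)
  emp_left : Emp Φ (1 - p) q

/-- The largest projection `p` with `(p, q)` inside the support. -/
lemma exists_max_left (hD : IsMasa D) (hΦ : IsSchurIdempotent D Φ) {q : B H} (hq : IsProj D q) :
    ∃ p, IsProj D p ∧ Full Φ p q ∧ ∀ p', IsProj D p' → Full Φ p' q → p * p' = p' := by
  let M : Submodule ℂ H := ⨅ T : B H, ((star (Φ (T * q) - T * q) : B H) : H →ₗ[ℂ] H).ker
  have hM : ∀ v, v ∈ M ↔ ∀ T, star (Φ (T * q) - T * q) v = 0 := fun v => by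
    simp [M, Submodule.mem_iInf]
  have hl : ∀ A ∈ D, ∀ T, Φ (A * T) = A * Φ T := fun A hA T => by
    simpa using hΦ.1.2 A hA 1 D.one_mem T
  have hp : IsProj D (projOn M) := isProj_projOn hD fun a ha v hv => by
    rw [hM] at hv ⊢
    intro T
    have := hv (star a * T)
    rw [mul_assoc, hl _ (star_mem ha), ← mul_sub, star_mul, star_star,
      mul_apply_eq_comp] at this
    exact this
  refine ⟨_, hp, fun T => ?_, fun p' hp' hfull => ?_⟩
  · have h1 : star (Φ (T * q) - T * q) * projOn M = 0 := ContinuousLinearMap.ext fun v => by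
      simpa using eqOn_projOn (S := star (Φ (T * q) - T * q)) (T := 0) (M := M)
        (fun u hu => by simpa using (hM u).1 hu T) v
    have h2 := congrArg star h1
    rw [star_mul, star_star, hp.2.isSelfAdjoint.star_eq, star_zero, mul_sub, sub_eq_zero] at h2
    rw [mul_assoc, hl _ hp.1, h2]
  · ext v
    refine projOn_apply ((hM _).2 fun T => ?_)
    have h1 := hfull T
    rw [mul_assoc, hl _ hp'.1, ← sub_eq_zero, ← mul_sub] at h1
    have h2 := congrArg star h1
    rw [star_mul, star_zero, hp'.2.isSelfAdjoint.star_eq] at h2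
    exact congrArg (fun A : B H => A v) h2

/-- The largest projection `q` with `(p, q)` inside the support. -/
lemma exists_max_right (hD : IsMasa D) (hΦ : IsSchurIdempotent D Φ) {p : B H} (hp : IsProj D p) :
    ∃ q, IsProj D q ∧ Full Φ p q ∧ ∀ q', IsProj D q' → Full Φ p q' → q * q' = q' := by
  let M : Submodule ℂ H := ⨅ T : B H, ((Φ (p * T) - p * T : B H) : H →ₗ[ℂ] H).ker
  have hM : ∀ v, v ∈ M ↔ ∀ T, (Φ (p * T) - p * T) v = 0 := fun v => by
    simp only [M, Submodule.mem_iInf]; rfl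
  have hr : ∀ A ∈ D, ∀ T, Φ (T * A) = Φ T * A := fun A hA T => by
    simpa using hΦ.1.2 1 D.one_mem A hA T
  have hq : IsProj D (projOn M) := isProj_projOn hD fun a ha v hv => by
    rw [hM] at hv ⊢
    intro T
    have := hv (T * a)
    rw [← mul_assoc, hr _ ha, ← sub_mul, mul_apply_eq_comp] at this
    exact this
  refine ⟨_, hq, fun T => ?_, fun q' hq' hfull => ?_⟩
  · have h1 : (Φ (p * T) - p * T) * projOn M = 0 := ContinuousLinearMap.ext fun v => by
      simpa using eqOn_projOn (S := Φ (p * T) - p * T) (T := 0) (M := M)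
        (fun u hu => by simpa using (hM u).1 hu T) v
    rw [sub_mul, sub_eq_zero] at h1
    rw [hr _ hq.1, h1]
  · ext v
    refine projOn_apply ((hM _).2 fun T => ?_)
    have h1 := hfull T
    rw [hr _ hq'.1, ← sub_eq_zero, ← sub_mul] at h1
    exact congrArg (fun A : B H => A v) h1

lemma ne_zero_of_mul_eq {p q : B H} (h : p * q = q) (hq : q ≠ 0) : p ≠ 0 := fun h0 =>
  hq (by rw [← h, h0, zero_mul])

lemma one_sub_mul_eq_iff {p q : B H} : (1 - p) * q = q ↔ p * q = 0 := by
  rw [sub_mul, one_mul, sub_eq_self]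

lemma mul_eq_zero_comm' (hD : IsMasa D) {p q : B H} (hp : IsProj D p) (hq : IsProj D q)
    (h : p * q = 0) : q * p = 0 := by rw [hD.comm hq.1 hp.1, h]

/-- Every nonzero rectangle inside the support is contained in a block. -/
lemma exists_isBlock (hD : IsMasa D) (hΦ : IsSchurIdempotent D Φ) (hc : ‖Φ‖ ≤ 1) {p₀ q₀ : B H}
    (hp₀ : IsProj D p₀) (hq₀ : IsProj D q₀) (n : p₀ ≠ 0) (m : q₀ ≠ 0) (h : Full Φ p₀ q₀) :
    ∃ p q, IsBlock D Φ p q ∧ p * p₀ = p₀ ∧ q * q₀ = q₀ := by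
  obtain ⟨p, hp, hf1, hmax1⟩ := exists_max_left hD hΦ hq₀
  obtain ⟨q, hq, hf2, hmax2⟩ := exists_max_right hD hΦ hp
  have hpp := hmax1 p₀ hp₀ h
  have hqq := hmax2 q₀ hq₀ hf1
  have np := ne_zero_of_mul_eq hpp n
  have nq := ne_zero_of_mul_eq hqq m
  refine ⟨p, q, ⟨hp, hq, np, nq, hf2, ?_, ?_⟩, hpp, hqq⟩
  · by_contra hemp
    obtain ⟨p', q', hp', hq', e1, e2, n1, n2, hf3⟩ := exists_full hD hΦ hp hq.one_sub hemp
    have hqq' : q * q' = 0 := one_sub_mul_eq_iff.1 e2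
    by_cases hfull : Full Φ p q'
    · exact n2 ((hmax2 q' hq' hfull).symm.trans hqq')
    · obtain ⟨p'', q'', hp'', hq'', e3, e4, n3, n4, hem⟩ := exists_emp hD hΦ hp hq' hfull
      have hf4 : Full Φ p' q'' := hf3.right (hq'.mul_eq_comm hq'' e4)
      have hz : p' * p'' = 0 := by
        have hpr := hp'.mul hD hp''
        refine (eq_zero_of_full_of_emp hpr.2 hq''.2
          (hf4.left (by rw [← mul_assoc, hp'.2.isIdempotentElem.eq]))
          (hem.left ?_)).resolve_right n4
        rw [hD.comm hp'.1 hp''.1, ← mul_assoc, hp''.2.isIdempotentElem.eq]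
      refine not_three_full hc hp'.2 hp''.2 hq.2 hq''.2 hz ?_ (hf2.left e1) hf4 (hf2.left e3) hem
        n1 n3 nq n4
      rw [← e4, ← mul_assoc, hqq', zero_mul]
  · by_contra hemp
    obtain ⟨p', q', hp', hq', e1, e2, n1, n2, hf3⟩ := exists_full hD hΦ hp.one_sub hq hemp
    have hpp' : p * p' = 0 := one_sub_mul_eq_iff.1 e1
    by_cases hfull : Full Φ p' q₀
    · exact n1 ((hmax1 p' hp' hfull).symm.trans hpp')
    · obtain ⟨p'', q'', hp'', hq'', e3, e4, n3, n4, hem⟩ := exists_emp hD hΦ hp' hq₀ hfull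
      have hf4 : Full Φ p'' q' := hf3.left e3
      have hz : q' * q'' = 0 := by
        have hpr := hq'.mul hD hq''
        refine (eq_zero_of_full_of_emp hp''.2 hpr.2
          (hf4.right ?_) (hem.right ?_)).resolve_left n3
        · rw [hD.comm hq'.1 hq''.1, mul_assoc, hq'.2.isIdempotentElem.eq]
        · rw [mul_assoc, hq''.2.isIdempotentElem.eq]
      refine not_three_full hc hp.2 hp''.2 hq'.2 hq''.2 ?_ hz
        (hf2.right (hq.mul_eq_comm hq' e2)) (hf1.right (hq₀.mul_eq_comm hq'' e4)) hf4 hem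
        np n3 n2 n4
      rw [← e3, ← mul_assoc, hpp', zero_mul]

lemma IsBlock.disjoint_or_eq (hD : IsMasa D) {p q p' q' : B H} (h : IsBlock D Φ p q)
    (h' : IsBlock D Φ p' q') : (p * p' = 0 ∧ q * q' = 0) ∨ (p = p' ∧ q = q') := by
  have hpp := h.left.mul hD h'.left
  have hqq := h.right.mul hD h'.right
  have e1 : p * (p * p') = p * p' := by rw [← mul_assoc, h.left.2.isIdempotentElem.eq]
  have e2 : p' * (p * p') = p * p' := by
    rw [hD.comm h.left.1 h'.left.1, ← mul_assoc, h'.left.2.isIdempotentElem.eq]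
  have e3 : (q * q') * q = q * q' := by
    rw [hD.comm h.right.1 h'.right.1, mul_assoc, h.right.2.isIdempotentElem.eq]
  have e4 : (q * q') * q' = q * q' := by rw [mul_assoc, h'.right.2.isIdempotentElem.eq]
  have antisymm : ∀ {a b : B H}, IsProj D a → IsProj D b → a * (1 - b) = 0 → b * (1 - a) = 0 →
      a = b := fun {a b} ha hb h1 h2 => by
    rw [mul_sub, mul_one, sub_eq_zero] at h1 h2
    rw [h1, hD.comm ha.1 hb.1, ← h2]
  have hmul1 : ∀ {a b : B H}, IsProj D a → IsProj D b →
      (a * (1 - b)) * a = a * (1 - b) := fun {a b} ha hb => by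
    rw [hD.comm ha.1 hb.one_sub.1, mul_assoc, ha.2.isIdempotentElem.eq]
  have hmul2 : ∀ {a b : B H}, IsProj D b →
      (a * (1 - b)) * (1 - b) = a * (1 - b) := fun {a b} hb => by
    rw [mul_assoc, hb.one_sub.2.isIdempotentElem.eq]
  have hmul3 : ∀ {a b : B H}, IsProj D a → a * (a * (1 - b)) = a * (1 - b) := fun {a b} ha => by
    rw [← mul_assoc, ha.2.isIdempotentElem.eq]
  have hmul4 : ∀ {a b : B H}, IsProj D a → IsProj D b →
      (1 - b) * (a * (1 - b)) = a * (1 - b) := fun {a b} ha hb => by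
    rw [hD.comm ha.1 hb.one_sub.1, ← mul_assoc, hb.one_sub.2.isIdempotentElem.eq]
  have hq_eq : p * p' ≠ 0 → q = q' := fun hne => by
    have h1 : q * (1 - q') = 0 :=
      (eq_zero_of_full_of_emp (Φ := Φ) hpp.2 (h.right.mul hD h'.right.one_sub).2
        ((h.full.left e1).right (hmul1 h.right h'.right))
        ((h'.emp_right.left e2).right (hmul2 h'.right))).resolve_left hne
    have h2 : q' * (1 - q) = 0 :=
      (eq_zero_of_full_of_emp (Φ := Φ) hpp.2 (h'.right.mul hD h.right.one_sub).2
        ((h'.full.left e2).right (hmul1 h'.right h.right))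
        ((h.emp_right.left e1).right (hmul2 h.right))).resolve_left hne
    exact antisymm h.right h'.right h1 h2
  have hp_eq : q * q' ≠ 0 → p = p' := fun hne => by
    have h1 : p * (1 - p') = 0 :=
      (eq_zero_of_full_of_emp (Φ := Φ) (h.left.mul hD h'.left.one_sub).2 hqq.2
        ((h.full.left (hmul3 h.left)).right e3)
        ((h'.emp_left.left (hmul4 h.left h'.left)).right e4)).resolve_right hne
    have h2 : p' * (1 - p) = 0 :=
      (eq_zero_of_full_of_emp (Φ := Φ) (h'.left.mul hD h.left.one_sub).2 hqq.2
        ((h'.full.left (hmul3 h'.left)).right e4)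
        ((h.emp_left.left (hmul4 h'.left h.left)).right e3)).resolve_right hne
    exact antisymm h.left h'.left h1 h2
  by_cases h1 : p * p' = 0
  · by_cases h2 : q * q' = 0
    · exact Or.inl ⟨h1, h2⟩
    · exact absurd (by rw [← hp_eq h2, h.left.2.isIdempotentElem.eq] at h1; exact h1) h.left_ne
  · have hq := hq_eq h1
    exact Or.inr ⟨hp_eq (by rw [← hq, h.right.2.isIdempotentElem.eq]; exact h.right_ne), hq⟩

end Blocks

section Decomp

variable {H : Type*} [NormedAddCommGroup H] [InnerProductSpace ℂ H] {ι : Type*}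

/-- A complete family of mutually orthogonal projections. -/
structure IsDecomp [CompleteSpace H] (P : ι → B H) : Prop where
  proj : ∀ i, IsStarProjection (P i)
  orth : ∀ i j, i ≠ j → P i * P j = 0
  hasSum : ∀ x, HasSum (fun i => P i x) x

variable [CompleteSpace H]

lemma hasSum_norm_sq_of_hasSum {P : ι → B H} (hP : ∀ i, IsStarProjection (P i)) {x y : H}
    (h : HasSum (fun i => P i x) y) : HasSum (fun i => ‖P i x‖ ^ 2) (RCLike.re ⟪x, y⟫_ℂ) := by
  have h1 := (h.mapL (innerSL ℂ x)).mapL Complex.reCLM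
  simp only [innerSL_apply_apply, ← (hP _).norm_apply_sq] at h1
  exact h1

lemma IsDecomp.hasSum_norm_sq {P : ι → B H} (hP : IsDecomp P) (x : H) :
    HasSum (fun i => ‖P i x‖ ^ 2) (‖x‖ ^ 2) := by
  have := hasSum_norm_sq_of_hasSum hP.proj (hP.hasSum x)
  rwa [inner_self_eq_norm_sq] at this

lemma isStarProjection_sum {P : ι → B H} (hP : ∀ i, IsStarProjection (P i))
    (ho : ∀ i j, i ≠ j → P i * P j = 0) (F : Finset ι) : IsStarProjection (∑ i ∈ F, P i) := by
  classical
  induction F using Finset.induction_on with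
  | empty => simpa using IsStarProjection.zero _
  | insert i F hi ih =>
    rw [Finset.sum_insert hi]
    refine (hP i).add ih ?_
    rw [Finset.mul_sum]
    exact Finset.sum_eq_zero fun j hj => ho i j fun h => hi (h ▸ hj)

lemma IsDecomp.of_ker {P : ι → B H} (hP : ∀ i, IsStarProjection (P i))
    (ho : ∀ i j, i ≠ j → P i * P j = 0) (hk : ∀ x, (∀ i, P i x = 0) → x = 0) : IsDecomp P := by
  classical
  refine ⟨hP, ho, fun x => ?_⟩
  have hF : ∀ F : Finset ι, ∑ i ∈ F, ‖P i x‖ ^ 2 = ‖(∑ i ∈ F, P i) x‖ ^ 2 := fun F => by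
    have h1 := (isStarProjection_sum hP ho F).norm_apply_sq x
    rw [sum_apply, inner_sum] at h1
    simp only [← (hP _).norm_apply_sq] at h1
    rw [sum_apply]
    exact_mod_cast h1.symm
  have hsum : Summable fun i => ‖P i x‖ ^ 2 :=
    summable_of_sum_le (fun _ => sq_nonneg _) (c := ‖x‖ ^ 2) fun F => by
      rw [hF]
      have := (isStarProjection_sum hP ho F).norm_apply_le x
      gcongr
  have hs : Summable fun i => P i x := by
    rw [summable_iff_vanishing_norm]
    intro ε hε
    obtain ⟨s, hs⟩ := summable_iff_vanishing_norm.1 hsum (ε ^ 2) (by positivity)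
    refine ⟨s, fun t ht => ?_⟩
    have h1 := hs t ht
    rw [hF, Real.norm_of_nonneg (sq_nonneg _), sum_apply] at h1
    exact lt_of_pow_lt_pow_left₀ 2 hε.le h1
  obtain ⟨y, hy⟩ := hs
  have : x - y = 0 := hk _ fun j => by
    have h1 := hy.mapL (P j)
    have h2 : HasSum (fun i => P j (P i x)) (P j x) := by
      have := hasSum_single (f := fun i => P j (P i x)) j fun i hi => by
        rw [← mul_apply_eq_comp, ho j i (Ne.symm hi), zero_apply]
      rwa [(hP j).mul_apply] at this
    rw [map_sub, h1.unique h2, sub_self]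
  have hxy := sub_eq_zero.1 this
  rwa [← hxy] at hy

end Decomp

section BlockMaps

universe u

variable {H : Type u} [NormedAddCommGroup H] [InnerProductSpace ℂ H] [CompleteSpace H]
  {D : StarSubalgebra ℂ (B H)} {Φ : B H →L[ℂ] B H}

lemma mul_map_mul_eq_zero_of_emp_right (hΦ : IsSchurIdempotent D Φ) {p q r : B H}
    (hp : IsProj D p) (hr : IsProj D r) (h : Emp Φ p q) (hqr : r * q = r) (T : B H) :
    p * Φ T * r = 0 := by
  rw [← hΦ.1.2 p hp.1 r hr.1]
  exact h.right hqr T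

/-- A contractive Schur idempotent is a block diagonal truncation. -/
theorem exists_block_decomp (hD : IsMasa D) (hΦ : IsSchurIdempotent D Φ) (hc : ‖Φ‖ ≤ 1) :
    ∃ (ι : Type u) (P Q : ι → B H), IsDecomp P ∧ IsDecomp Q ∧ (∀ i, IsProj D (P i)) ∧
      (∀ i, IsProj D (Q i)) ∧ (∀ T i, P i * Φ T * Q i = P i * T * Q i) ∧
      ∀ T i j, i ≠ j → P i * Φ T * Q j = 0 := by
  let β : Type u := {b : B H × B H // IsBlock D Φ b.1 b.2}
  have hann : ∀ R : β → B H, (∀ b, IsProj D (R b)) → ∃ R₀, IsProj D R₀ ∧ (∀ b, R b * R₀ = 0) ∧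
      ∀ x, (∀ b, R b x = 0) → R₀ x = x := fun R hR => by
    let M : Submodule ℂ H := ⨅ b, (R b : H →ₗ[ℂ] H).ker
    have hM : ∀ v, v ∈ M ↔ ∀ b, R b v = 0 := fun v => by
      simp only [M, Submodule.mem_iInf]; rfl
    refine ⟨projOn M, isProj_projOn hD fun a ha v hv => ?_, fun b => ?_, fun x hx =>
      projOn_apply ((hM x).2 hx)⟩
    · rw [hM] at hv ⊢
      intro b
      rw [← mul_apply_eq_comp, hD.comm (hR b).1 ha, mul_apply_eq_comp, hv,
        map_zero]
    · ext v
      simpa using eqOn_projOn (S := R b) (T := 0) (M := M)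
        (fun u hu => by simpa using (hM u).1 hu b) v
  obtain ⟨P₀, hP₀, hP₀b, hP₀x⟩ := hann (fun b => b.1.1) fun b => b.2.left
  obtain ⟨Q₀, hQ₀, hQ₀b, hQ₀x⟩ := hann (fun b => b.1.2) fun b => b.2.right
  have hP₀b' : ∀ b : β, P₀ * b.1.1 = 0 := fun b => mul_eq_zero_comm' hD b.2.left hP₀ (hP₀b b)
  have hQ₀b' : ∀ b : β, Q₀ * b.1.2 = 0 := fun b => mul_eq_zero_comm' hD b.2.right hQ₀ (hQ₀b b)
  have hempP : Emp Φ P₀ 1 := by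
    by_contra h
    obtain ⟨p', q', hp', hq', e1, e2, n1, n2, hf⟩ := exists_full hD hΦ hP₀ IsProj.one h
    obtain ⟨p, q, hb, e3, e4⟩ := exists_isBlock hD hΦ hc hp' hq' n1 n2 hf
    apply n1
    rw [← e1, ← e3, ← mul_assoc, hP₀b' ⟨(p, q), hb⟩, zero_mul]
  have hempQ : Emp Φ 1 Q₀ := by
    by_contra h
    obtain ⟨p', q', hp', hq', e1, e2, n1, n2, hf⟩ := exists_full hD hΦ IsProj.one hQ₀ h
    obtain ⟨p, q, hb, e3, e4⟩ := exists_isBlock hD hΦ hc hp' hq' n1 n2 hf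
    apply n2
    rw [← e2, ← e4, ← mul_assoc, hQ₀b' ⟨(p, q), hb⟩, zero_mul]
  let P : β ⊕ Bool → B H := Sum.elim (fun b => b.1.1) fun c => if c then P₀ else 0
  let Q : β ⊕ Bool → B H := Sum.elim (fun b => b.1.2) fun c => if c then 0 else Q₀
  have hP : ∀ i, IsProj D (P i) := by
    rintro (b | (_ | _))
    exacts [b.2.left, IsProj.zero, hP₀]
  have hQ : ∀ i, IsProj D (Q i) := by
    rintro (b | (_ | _))
    exacts [b.2.right, hQ₀, IsProj.zero]
  have hdisj : ∀ b b' : β, b ≠ b' → b.1.1 * b'.1.1 = 0 ∧ b.1.2 * b'.1.2 = 0 := fun b b' hne =>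
    (b.2.disjoint_or_eq hD b'.2).resolve_right fun h => hne (Subtype.ext (Prod.ext h.1 h.2))
  refine ⟨β ⊕ Bool, P, Q, .of_ker (fun i => (hP i).2) ?_ ?_, .of_ker (fun i => (hQ i).2) ?_ ?_,
    hP, hQ, ?_, ?_⟩
  · rintro (b | (_ | _)) (b' | (_ | _)) hne <;> simp only [P, Sum.elim_inl, Sum.elim_inr, if_true,
      Bool.false_eq_true, if_false, mul_zero, zero_mul, hP₀b, hP₀b']
    · exact (hdisj b b' fun h => hne (by rw [h])).1
    · exact absurd rfl hne
  · intro x hx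
    have h1 := hP₀x x fun b => hx (Sum.inl b)
    rw [← h1]
    exact hx (Sum.inr true)
  · rintro (b | (_ | _)) (b' | (_ | _)) hne <;> simp only [Q, Sum.elim_inl, Sum.elim_inr, if_true,
      Bool.false_eq_true, if_false, mul_zero, zero_mul, hQ₀b, hQ₀b']
    · exact (hdisj b b' fun h => hne (by rw [h])).2
    · exact absurd rfl hne
  · intro x hx
    have h1 := hQ₀x x fun b => hx (Sum.inl b)
    rw [← h1]
    exact hx (Sum.inr false)
  · rintro T (b | (_ | _))
    · change b.1.1 * Φ T * b.1.2 = _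
      rw [← hΦ.1.2 _ b.2.left.1 _ b.2.right.1]
      exact b.2.full T
    · simp [P]
    · simp [Q]
  · have hQe : ∀ (r : B H), IsProj D r → ∀ T, r * Φ T * Q₀ = 0 := fun r hr T => by
      rw [← hΦ.1.2 _ hr.1 _ hQ₀.1]
      exact hempQ.left (one_mul r) T
    have hPe : ∀ (r : B H), IsProj D r → ∀ T, P₀ * Φ T * r = 0 := fun r hr T =>
      mul_map_mul_eq_zero_of_emp_right hΦ hP₀ hr hempP (mul_one r) T
    rintro T (b | (_ | _)) (b' | (_ | _)) hne
    · refine mul_map_mul_eq_zero_of_emp_right hΦ b.2.left b'.2.right b.2.emp_right ?_ T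
      rw [mul_sub, mul_one, (hdisj b' b fun h => hne (by rw [h])).2, sub_zero]
    · exact hQe _ b.2.left T
    · simp [Q]
    · simp [P]
    · simp [P]
    · simp [P]
    · exact hPe _ b'.2.right T
    · exact hPe _ hQ₀ T
    · exact absurd rfl hne

end BlockMaps

section BlockMap

variable {H : Type*} [NormedAddCommGroup H] [InnerProductSpace ℂ H] [CompleteSpace H]
  {ι : Type*} {P Q : ι → B H}

lemma IsDecomp.isBddFam (hP : IsDecomp P) : IsBddFam P 1 :=
  ⟨zero_le_one, fun x => ⟨(hP.hasSum_norm_sq x).summable, by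
    rw [(hP.hasSum_norm_sq x).tsum_eq, one_mul]⟩⟩

lemma IsDecomp.ext (hP : IsDecomp P) (hQ : IsDecomp Q) {S T : B H}
    (h : ∀ i j, P i * S * Q j = P i * T * Q j) : S = T := by
  have h1 : ∀ i x, P i (S x) = P i (T x) := fun i x => by
    have hS := (hQ.hasSum x).mapL (P i * S)
    have hT := (hQ.hasSum x).mapL (P i * T)
    have : ∀ j, (P i * S) (Q j x) = (P i * T) (Q j x) := fun j => by
      simpa using congrArg (fun A : B H => A x) (h i j)
    simp only [this] at hS
    exact hS.unique hT
  ext x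
  have hS := hP.hasSum (S x)
  simp only [h1] at hS
  exact hS.unique (hP.hasSum (T x))

/-- `Θ` is the block diagonal truncation attached to `P` and `Q`. -/
structure IsBlockMap (P Q : ι → B H) (Θ : B H →L[ℂ] B H) : Prop where
  left : IsDecomp P
  right : IsDecomp Q
  diag : ∀ T i, P i * Θ T * Q i = P i * T * Q i
  off : ∀ T i j, i ≠ j → P i * Θ T * Q j = 0

lemma IsDecomp.exists_isBlockMap (hP : IsDecomp P) (hQ : IsDecomp Q) :
    ∃ Θ : B H →L[ℂ] B H, IsBlockMap P Q Θ := by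
  obtain ⟨Θ, hΘ, -⟩ := exists_kraus hQ.isBddFam hP.isBddFam
  have key : ∀ i j, i ≠ j → ∀ k, P k * P i = 0 ∨ Q k * Q j = 0 := fun i j hij k => by
    by_cases h : k = i
    · exact Or.inr (hQ.orth k j fun h' => hij (h ▸ h'))
    · exact Or.inl (hP.orth k i h)
  refine ⟨Θ, hP, hQ, fun T i => ?_, fun T i j hij => ?_⟩
  · refine ContinuousLinearMap.ext fun x => ext_inner_left ℂ fun y => ?_
    simp only [mul_apply_eq_comp]
    rw [← (hP.proj i).inner_left, hΘ, tsum_eq_single i, (hP.proj i).mul_apply,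
      (hQ.proj i).mul_apply, (hP.proj i).inner_left]
    intro k hk
    rw [← mul_apply_eq_comp (P k), hP.orth k i hk]
    simp
  · refine ContinuousLinearMap.ext fun x => ext_inner_left ℂ fun y => ?_
    simp only [mul_apply_eq_comp, zero_apply, inner_zero_right]
    rw [← (hP.proj i).inner_left, hΘ]
    refine (tsum_congr fun k => ?_).trans tsum_zero
    rw [← mul_apply_eq_comp (P k), ← mul_apply_eq_comp (Q k)]
    rcases key i j hij k with h | h <;> simp [h]

namespace IsBlockMap

variable {Θ : B H →L[ℂ] B H}

lemma mul_mul [DecidableEq ι] (h : IsBlockMap P Q Θ) (T : B H) (i j : ι) :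
    P i * Θ T * Q j = if i = j then P i * T * Q j else 0 := by
  split_ifs with hij
  · rw [← hij]; exact h.diag T i
  · exact h.off T i j hij

lemma apply_eq (h : IsBlockMap P Q Θ) {S T : B H} (hd : ∀ i, P i * S * Q i = P i * T * Q i)
    (ho : ∀ i j, i ≠ j → P i * S * Q j = 0) : Θ T = S :=
  h.left.ext h.right fun i j => by
    classical
    rw [h.mul_mul]
    split_ifs with hij
    · rw [← hij, hd]
    · rw [ho i j hij]

lemma inner_apply (h : IsBlockMap P Q Θ) (T : B H) (x y : H) :
    HasSum (fun i => ⟪P i y, T (Q i x)⟫_ℂ) ⟪y, Θ T x⟫_ℂ := by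
  have h1 := (h.left.hasSum (Θ T x)).mapL (innerSL ℂ y)
  have h2 : ∀ i, P i (Θ T x) = P i (T (Q i x)) := fun i => by
    have h3 := (h.right.hasSum x).mapL (P i * Θ T)
    have h4 := hasSum_single (f := fun j => (P i * Θ T) (Q j x)) i fun j hj => by
      simpa using congrArg (fun A : B H => A x) (h.off T i j hj.symm)
    have h5 := h3.unique h4
    have h6 := congrArg (fun A : B H => A x) (h.diag T i)
    simp only [mul_apply_eq_comp] at h5 h6
    rw [h5, h6]
  simpa only [innerSL_apply_apply, h2, ← (h.left.proj _).inner_left] using h1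

lemma isNormalMap (h : IsBlockMap P Q Θ) : IsNormalMap (Θ : B H →ₗ[ℂ] B H) :=
  isNormalMap_of_form h.right.isBddFam h.left.isBddFam _ fun T x y =>
    (h.inner_apply T x y).tsum_eq.symm

lemma mul_self (h : IsBlockMap P Q Θ) : Θ * Θ = Θ :=
  ContinuousLinearMap.ext fun T => h.apply_eq (fun _ => rfl) fun i j => h.off T i j

lemma bimod (h : IsBlockMap P Q Θ) {p q : B H} (hp : ∀ i, P i * p = p * P i)
    (hq : ∀ i, Q i * q = q * Q i) (T : B H) : Θ (p * T * q) = p * Θ T * q := by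
  have key : ∀ S i j, P i * (p * S * q) * Q j = p * (P i * S * Q j) * q := fun S i j => by
    calc P i * (p * S * q) * Q j = (P i * p) * S * (q * Q j) := by noncomm_ring
      _ = _ := by rw [hp, ← hq]; noncomm_ring
  refine h.apply_eq (fun i => ?_) fun i j hij => ?_
  · rw [key, key, h.diag]
  · rw [key, h.off T i j hij, mul_zero, zero_mul]

lemma commute (h : IsBlockMap P Q Θ) {Ψ : B H →L[ℂ] B H}
    (hΨ : ∀ i j T, Ψ (P i * T * Q j) = P i * Ψ T * Q j) : Θ * Ψ = Ψ * Θ :=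
  ContinuousLinearMap.ext fun T => h.apply_eq
    (fun i => by rw [mul_apply_eq_comp, ← hΨ, h.diag, hΨ]; rfl)
    fun i j hij => by rw [mul_apply_eq_comp, ← hΨ, h.off T i j hij, map_zero]

/-- Block truncations do not increase the Arveson distance. -/
lemma annBound (h : IsBlockMap P Q Θ) {X Y : Submodule ℂ (B H)}
    (hY : ∀ i j, ∀ T ∈ Y, P i * T * Q j ∈ Y) (hXY : ∀ T ∈ X, Θ T ∈ Y) {T : B H} {c : ℝ}
    (hc : 0 ≤ c) (hT : AnnBound T X c) : AnnBound (Θ T) Y c := by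
  intro ξ η hS
  have h1 : ∀ i, ‖⟪P i η, T (Q i ξ)⟫_ℂ‖ ≤ c * (‖P i η‖ * ‖Q i ξ‖) := fun i => by
    refine (hT (Q i ξ) (P i η) fun S hSX => ?_).trans_eq (by ring)
    have h2 := hS _ (hY i i _ (hXY S hSX))
    rw [h.diag] at h2
    rw [(h.left.proj i).inner_left]
    exact h2
  have hP := h.left.hasSum_norm_sq η
  have hQ := h.right.hasSum_norm_sq ξ
  obtain ⟨h3, h4⟩ := summable_mul_and_tsum_le (fun i => norm_nonneg (P i η))
    (fun i => norm_nonneg (Q i ξ)) (norm_nonneg η) (norm_nonneg ξ) hP.summable hQ.summable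
    hP.tsum_eq.le hQ.tsum_eq.le
  rw [← (h.inner_apply T ξ η).tsum_eq]
  have h5 : Summable fun i => ‖⟪P i η, T (Q i ξ)⟫_ℂ‖ :=
    Summable.of_nonneg_of_le (fun _ => norm_nonneg _) h1 (h3.mul_left _)
  calc _ ≤ ∑' i, ‖⟪P i η, T (Q i ξ)⟫_ℂ‖ := norm_tsum_le_tsum_norm h5
    _ ≤ ∑' i, c * (‖P i η‖ * ‖Q i ξ‖) := h5.tsum_le_tsum h1 (h3.mul_left _)
    _ = c * ∑' i, ‖P i η‖ * ‖Q i ξ‖ := tsum_mul_left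
    _ ≤ c * (‖η‖ * ‖ξ‖) := mul_le_mul_of_nonneg_left h4 hc
    _ = _ := by ring

end IsBlockMap

lemma card_filter_powerset_mem_notMem {ι : Type*} [DecidableEq ι] {s : Finset ι} {i j : ι}
    (hi : i ∈ s) (hj : j ∈ s) (hij : i ≠ j) :
    4 * (s.powerset.filter fun F => i ∈ F ∧ j ∉ F).card = s.powerset.card := by
  have h1 : (s.powerset.filter fun F => i ∈ F ∧ j ∉ F).card =
      ((s.erase i).erase j).powerset.card := by
    refine Finset.card_nbij' (fun F => F.erase i) (fun G => insert i G) ?_ ?_ ?_ ?_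
    · intro F hF
      simp only [Finset.coe_filter, Finset.mem_powerset, Set.mem_ofPred_eq, Finset.coe_powerset,
        Set.mem_preimage, Set.mem_powerset_iff, Finset.coe_subset] at hF ⊢
      intro k hk
      grind
    · intro G hG
      simp only [Finset.coe_filter, Finset.mem_powerset, Set.mem_ofPred_eq, Finset.coe_powerset,
        Set.mem_preimage, Set.mem_powerset_iff, Finset.coe_subset] at hG ⊢
      grind
    · intro F hF
      simp only [Finset.coe_filter, Set.mem_ofPred_eq] at hF
      exact Finset.insert_erase hF.2.1
    · intro G hG
      simp only [Finset.coe_powerset, Set.mem_preimage, Set.mem_powerset_iff,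
        Finset.coe_subset] at hG
      exact Finset.erase_insert fun h => by simpa using hG h
  have h2 : ((s.erase i).erase j).card + 2 = s.card := by
    have h3 := Finset.card_erase_add_one hi
    have h4 := Finset.card_erase_add_one (Finset.mem_erase.2 ⟨hij.symm, hj⟩)
    omega
  rw [h1, Finset.card_powerset, Finset.card_powerset, ← h2, pow_add]
  ring

/-- Averaging over all partitions of a finite set into two pieces. -/
lemma norm_sum_offDiag_le {ι : Type*} [DecidableEq ι] (s : Finset ι) (f : ι → ι → ℂ) {c : ℝ}
    (h : ∀ F ⊆ s, ‖∑ i ∈ F, ∑ j ∈ s \ F, f i j‖ ≤ c) :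
    ‖∑ i ∈ s, ∑ j ∈ s, if i = j then 0 else f i j‖ ≤ 4 * c := by
  have h1 : ∀ F ∈ s.powerset, ∑ i ∈ F, ∑ j ∈ s \ F, f i j =
      ∑ i ∈ s, ∑ j ∈ s, if i ∈ F ∧ j ∉ F then f i j else 0 := fun F hF => by
    rw [Finset.mem_powerset] at hF
    rw [← Finset.inter_eq_right.2 hF, ← Finset.filter_mem_eq_inter, Finset.sum_filter]
    refine Finset.sum_congr rfl fun i hi => ?_
    split_ifs with hiF
    · rw [Finset.filter_mem_eq_inter, Finset.inter_eq_right.2 hF, Finset.sdiff_eq_filter,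
        Finset.sum_filter]
      refine Finset.sum_congr rfl fun j hj => ?_
      simp [hiF]
    · simp [hiF]
  have h2 : 4 * ∑ F ∈ s.powerset, ∑ i ∈ F, ∑ j ∈ s \ F, f i j =
      s.powerset.card * ∑ i ∈ s, ∑ j ∈ s, if i = j then 0 else f i j := by
    rw [Finset.sum_congr rfl h1, Finset.sum_comm, Finset.mul_sum, Finset.mul_sum]
    refine Finset.sum_congr rfl fun i hi => ?_
    rw [Finset.sum_comm, Finset.mul_sum, Finset.mul_sum]
    refine Finset.sum_congr rfl fun j hj => ?_
    rw [← Finset.sum_filter, Finset.sum_const, nsmul_eq_mul]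
    split_ifs with hij
    · subst hij
      simp
    · rw [← card_filter_powerset_mem_notMem hi hj hij]
      push_cast
      ring
  have h3 : ‖∑ F ∈ s.powerset, ∑ i ∈ F, ∑ j ∈ s \ F, f i j‖ ≤ s.powerset.card * c := by
    refine (norm_sum_le_of_le _ fun F hF => h F (Finset.mem_powerset.1 hF)).trans_eq ?_
    rw [Finset.sum_const, nsmul_eq_mul]
  have h4 : (0 : ℝ) < s.powerset.card := by
    exact_mod_cast Finset.card_pos.2 (Finset.powerset_nonempty s)
  have h5 := congrArg norm h2
  rw [norm_mul, norm_mul, Complex.norm_natCast] at h5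
  have h6 : ‖(4 : ℂ)‖ = 4 := by simp
  rw [h6] at h5
  nlinarith

lemma IsBlockMap.annBound_sub {Θ : B H →L[ℂ] B H} (h : IsBlockMap P Q Θ)
    {X Y : Submodule ℂ (B H)}
    (hY : ∀ i j, ∀ T ∈ Y, P i * T * Q j ∈ Y) (hXY : ∀ T ∈ X, T - Θ T ∈ Y) {T : B H} {c : ℝ}
    (hc : 0 ≤ c) (hT : AnnBound T X c) : AnnBound (T - Θ T) Y (4 * c) := by
  classical
  intro ξ η hS
  have hlim : Filter.Tendsto (fun s : Finset ι =>
      ⟪∑ i ∈ s, P i η, (T - Θ T) (∑ j ∈ s, Q j ξ)⟫_ℂ) Filter.atTop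
      (nhds ⟪η, (T - Θ T) ξ⟫_ℂ) := by
    have h1 : Filter.Tendsto (fun s : Finset ι => ∑ i ∈ s, P i η) Filter.atTop (nhds η) :=
      h.left.hasSum η
    have h2 : Filter.Tendsto (fun s : Finset ι => ∑ i ∈ s, Q i ξ) Filter.atTop (nhds ξ) :=
      h.right.hasSum ξ
    exact h1.inner (((T - Θ T).continuous.tendsto ξ).comp h2)
  refine le_of_tendsto' hlim.norm fun s => ?_
  have hentry : ∀ i j, ⟪P i η, (T - Θ T) (Q j ξ)⟫_ℂ =
      if i = j then 0 else ⟪P i η, T (Q j ξ)⟫_ℂ := fun i j => by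
    have h1 := congrArg (fun A : B H => ⟪η, A ξ⟫_ℂ) (h.mul_mul T i j)
    rw [sub_apply, inner_sub_right, (h.left.proj i).inner_left,
      (h.left.proj i).inner_left]
    simp only [mul_apply_eq_comp] at h1
    rw [h1]
    split_ifs <;> simp
  simp only [sum_inner, map_sum, inner_sum, hentry]
  have hconst : 4 * (c * ‖ξ‖ * ‖η‖) = 4 * c * ‖ξ‖ * ‖η‖ := by ring
  rw [← hconst, Finset.sum_comm]
  refine norm_sum_offDiag_le s (fun i j => ⟪P i η, T (Q j ξ)⟫_ℂ) fun F hF => ?_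
  have h1 : ∑ i ∈ F, ∑ j ∈ s \ F, ⟪P i η, T (Q j ξ)⟫_ℂ =
      ⟪(∑ i ∈ F, P i) η, T ((∑ j ∈ s \ F, Q j) ξ)⟫_ℂ := by
    simp only [sum_apply, sum_inner, map_sum, inner_sum]
    exact Finset.sum_comm
  rw [h1]
  have hPF := isStarProjection_sum h.left.proj h.left.orth F
  have hQF := isStarProjection_sum h.right.proj h.right.orth (s \ F)
  refine (hT _ _ fun S hSX => ?_).trans ?_
  · simp only [sum_apply, sum_inner, map_sum, inner_sum]
    refine Finset.sum_eq_zero fun j hj => Finset.sum_eq_zero fun i hi => ?_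
    have hne : i ≠ j := by grind
    have h2 := hS _ (hY i j _ (hXY S hSX))
    rw [mul_sub, sub_mul, h.off S i j hne, sub_zero] at h2
    rw [(h.left.proj i).inner_left]
    exact h2
  · have h2 := hPF.norm_apply_le η
    have h3 := hQF.norm_apply_le ξ
    gcongr

end BlockMap

section Lift

universe u v

variable {H : Type u} [NormedAddCommGroup H] [InnerProductSpace ℂ H] [CompleteSpace H]
  {W : Type v} [NormedAddCommGroup W] [InnerProductSpace ℂ W] [CompleteSpace W]
  {D : StarSubalgebra ℂ (B H)} {π : B H →⋆ₐ[ℂ] B W}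

lemma IsDecomp.map {ι : Type*} {P : ι → B H} (hP : IsDecomp P)
    (hπ : IsNormalMap (π : B H →ₗ[ℂ] B W)) : IsDecomp fun i => π (P i) := by
  refine .of_ker (fun i => ⟨?_, ?_⟩) (fun i j hij => ?_) fun x hx => ?_
  · rw [IsIdempotentElem, ← map_mul, (hP.proj i).isIdempotentElem]
  · rw [IsSelfAdjoint, ← map_star, (hP.proj i).isSelfAdjoint]
  · rw [← map_mul, hP.orth i j hij, map_zero]
  · let ω : B W →ₗ[ℂ] ℂ := (innerSL ℂ x : W →ₗ[ℂ] ℂ) ∘ₗ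
      (ContinuousLinearMap.apply ℂ W x : B W →ₗ[ℂ] W)
    have hω : IsNormalFunctional W ω := .of_inner x x _ fun T => rfl
    have h1 := (hπ ω hω).tendsto (l := Filter.atTop) (f := fun s : Finset ι => ∑ i ∈ s, P i)
      (T := 1) (C := 1) (fun s => (isStarProjection_sum hP.proj hP.orth s).norm_le)
      fun x y => by
        simp only [sum_apply, one_apply_eq_self]
        exact Filter.Tendsto.inner tendsto_const_nhds (hP.hasSum x)
    have h2 : ∀ s : Finset ι, (ω ∘ₗ (π : B H →ₗ[ℂ] B W)) (∑ i ∈ s, P i) = 0 := fun s => by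
      rw [map_sum]
      refine Finset.sum_eq_zero fun i _ => ?_
      change ⟪x, π (P i) x⟫_ℂ = 0
      rw [hx, inner_zero_right]
    have h3 : (ω ∘ₗ (π : B H →ₗ[ℂ] B W)) 1 = ⟪x, x⟫_ℂ := by
      change ⟪x, π 1 x⟫_ℂ = _
      rw [map_one, one_apply_eq_self]
    simp only [h2, h3] at h1
    exact inner_self_eq_zero.1 (tendsto_nhds_unique h1 tendsto_const_nhds)

/-- Pairs of maps on `B H` and on `B W`. -/
abbrev MapPair (H : Type u) [NormedAddCommGroup H] [InnerProductSpace ℂ H]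
    (W : Type v) [NormedAddCommGroup W] [InnerProductSpace ℂ W] : Type (max u v) :=
  (B H →L[ℂ] B H) × (B W →L[ℂ] B W)

/-- A block truncation with blocks in `D`, paired with its amplification along `π`. -/
def IsBlockPair (D : StarSubalgebra ℂ (B H)) (π : B H →⋆ₐ[ℂ] B W) (g : MapPair H W) : Prop :=
  ∃ (ι : Type u) (P Q : ι → B H), (∀ i, P i ∈ D) ∧ (∀ i, Q i ∈ D) ∧
    IsBlockMap P Q g.1 ∧ IsBlockMap (fun i => π (P i)) (fun i => π (Q i)) g.2

/-- The bimodule property for both components of a pair. -/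
def IsBimodPair (D : StarSubalgebra ℂ (B H)) (π : B H →⋆ₐ[ℂ] B W) (g : MapPair H W) : Prop :=
  ∀ p ∈ D, ∀ q ∈ D, (∀ T, g.1 (p * T * q) = p * g.1 T * q) ∧
    ∀ T, g.2 (π p * T * π q) = π p * g.2 T * π q

/-- The monoid generated by the block truncations and their complements. -/
def blockMonoid (D : StarSubalgebra ℂ (B H)) (π : B H →⋆ₐ[ℂ] B W) : Submonoid (MapPair H W) :=
  Submonoid.closure {g | IsBlockPair D π g ∨ IsBlockPair D π (1 - g)}

lemma IsBlockPair.bimod (hD : IsMasa D) {g : MapPair H W} (h : IsBlockPair D π g) :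
    IsBimodPair D π g := by
  obtain ⟨ι, P, Q, hP, hQ, h1, h2⟩ := h
  refine fun p hp q hq => ⟨fun T => h1.bimod (fun i => hD.comm (hP i) hp)
    (fun i => hD.comm (hQ i) hq) T, fun T => h2.bimod (fun i => ?_) (fun i => ?_) T⟩
  · rw [← map_mul, ← map_mul, hD.comm (hP i) hp]
  · rw [← map_mul, ← map_mul, hD.comm (hQ i) hq]

lemma IsBimodPair.one_sub {g : MapPair H W} (h : IsBimodPair D π g) :
    IsBimodPair D π (1 - g) := fun p hp q hq => by
  refine ⟨fun T => ?_, fun T => ?_⟩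
  · change p * T * q - g.1 (p * T * q) = p * (T - g.1 T) * q
    rw [(h p hp q hq).1, mul_sub, sub_mul]
  · change π p * T * π q - g.2 (π p * T * π q) = π p * (T - g.2 T) * π q
    rw [(h p hp q hq).2, mul_sub, sub_mul]

lemma blockMonoid_bimod (hD : IsMasa D) {g : MapPair H W} (h : g ∈ blockMonoid D π) :
    IsBimodPair D π g := by
  induction h using Submonoid.closure_induction with
  | mem g hg =>
    rcases hg with hg | hg
    · exact hg.bimod hD
    · simpa using (hg.bimod hD).one_sub
  | one => exact fun p hp q hq => ⟨fun T => rfl, fun T => rfl⟩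
  | mul g k _ _ hg hk =>
    refine fun p hp q hq => ⟨fun T => ?_, fun T => ?_⟩
    · change g.1 (k.1 _) = p * g.1 (k.1 T) * q
      rw [(hk p hp q hq).1, (hg p hp q hq).1]
    · change g.2 (k.2 _) = π p * g.2 (k.2 T) * π q
      rw [(hk p hp q hq).2, (hg p hp q hq).2]

lemma IsBlockPair.commute {g k : MapPair H W} (hg : IsBlockPair D π g) (hk : IsBimodPair D π k) :
    Commute g k := by
  obtain ⟨ι, P, Q, hP, hQ, h1, h2⟩ := hg
  exact Prod.ext (h1.commute fun i j T => (hk _ (hP i) _ (hQ j)).1 T)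
    (h2.commute fun i j T => (hk _ (hP i) _ (hQ j)).2 T)

lemma blockMonoid_commute (hD : IsMasa D) {g k : MapPair H W} (hg : g ∈ blockMonoid D π)
    (hk : k ∈ blockMonoid D π) : Commute g k := by
  have hk' := blockMonoid_bimod hD hk
  induction hg using Submonoid.closure_induction with
  | mem g hg =>
    rcases hg with hg | hg
    · exact hg.commute hk'
    · have := (Commute.one_left k).sub_left (hg.commute hk')
      rwa [sub_sub_cancel] at this
  | one => exact Commute.one_left _
  | mul a b _ _ ha hb => exact ha.mul_left hb

lemma IsBlockPair.mul_self {g : MapPair H W} (hg : IsBlockPair D π g) : g * g = g := by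
  obtain ⟨ι, P, Q, hP, hQ, h1, h2⟩ := hg
  exact Prod.ext h1.mul_self h2.mul_self

lemma blockMonoid_mul_self (hD : IsMasa D) {g : MapPair H W} (hg : g ∈ blockMonoid D π) :
    g * g = g := by
  induction hg using Submonoid.closure_induction with
  | mem g hg =>
    rcases hg with hg | hg
    · exact hg.mul_self
    · have := hg.mul_self
      have h2 : g = 1 - (1 - g) := by abel
      rw [h2]
      generalize 1 - g = k at this
      rw [mul_sub, mul_one, sub_mul, one_mul, this, sub_self, sub_zero]
  | one => exact one_mul _
  | mul a b ha hb iha ihb =>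
    have := (blockMonoid_commute hD ha hb).eq
    calc a * b * (a * b) = a * (b * a) * b := by simp only [mul_assoc]
      _ = (a * a) * (b * b) := by rw [← this]; simp only [mul_assoc]
      _ = a * b := by rw [iha, ihb]

/-- The second component of a pair extends the first one along `π`. -/
def IsAmplPair (π : B H →⋆ₐ[ℂ] B W) (g : MapPair H W) : Prop :=
  ∀ a r, (∀ b, π b * r = r * π b) → g.2 (π a * r) = π (g.1 a) * r

lemma IsBlockPair.ampl {g : MapPair H W} (hg : IsBlockPair D π g) : IsAmplPair π g := by
  obtain ⟨ι, P, Q, hP, hQ, h1, h2⟩ := hg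
  intro a r hr
  have key : ∀ i j b, π (P i) * (π b * r) * π (Q j) = π (P i * b * Q j) * r := fun i j b => by
    calc _ = π (P i) * π b * (r * π (Q j)) := by simp only [mul_assoc]
      _ = _ := by rw [← hr, map_mul, map_mul]; simp only [mul_assoc]
  refine h2.apply_eq (fun i => ?_) fun i j hij => ?_
  · rw [key, key, h1.diag]
  · rw [key, h1.off a i j hij, map_zero, zero_mul]

lemma blockMonoid_ampl {g : MapPair H W} (hg : g ∈ blockMonoid D π) : IsAmplPair π g := by
  induction hg using Submonoid.closure_induction with
  | mem g hg =>
    rcases hg with hg | hg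
    · exact hg.ampl
    · intro a r hr
      have h1 := hg.ampl a r hr
      change π a * r - g.2 (π a * r) = π (a - g.1 a) * r at h1
      rw [map_sub, sub_mul] at h1
      exact sub_right_injective h1
  | one => exact fun a r hr => rfl
  | mul a b _ _ iha ihb =>
    intro x r hr
    change a.2 (b.2 _) = π (a.1 (b.1 x)) * r
    rw [ihb x r hr, iha _ r hr]

lemma blockMonoid_normal {g : MapPair H W} (hg : g ∈ blockMonoid D π) :
    IsNormalMap (g.2 : B W →ₗ[ℂ] B W) := by
  induction hg using Submonoid.closure_induction with
  | mem g hg =>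
    rcases hg with ⟨ι, P, Q, hP, hQ, h1, h2⟩ | ⟨ι, P, Q, hP, hQ, h1, h2⟩
    · exact h2.isNormalMap
    · have h3 := IsNormalMap.id.sub h2.isNormalMap
      have h4 : (g.2 : B W →ₗ[ℂ] B W) = LinearMap.id - ((1 - g).2 : B W →ₗ[ℂ] B W) := by
        ext T x
        simp
      rwa [h4]
  | one => exact IsNormalMap.id
  | mul a b _ _ iha ihb => exact iha.comp ihb

/-- Linear control of the Arveson distance under the second component of a pair. -/
def IsArvesonBdd (D : StarSubalgebra ℂ (B H)) (π : B H →⋆ₐ[ℂ] B W) (g : MapPair H W) : Prop :=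
  ∃ C : ℝ, 0 ≤ C ∧ ∀ X Y : Submodule ℂ (B W), (∀ p ∈ D, ∀ q ∈ D, ∀ T ∈ Y, π p * T * π q ∈ Y) →
    (∀ T ∈ X, g.2 T ∈ Y) → ∀ T c, 0 ≤ c → AnnBound T X c → AnnBound (g.2 T) Y (C * c)

lemma blockMonoid_arvesonBdd (hD : IsMasa D) {g : MapPair H W} (hg : g ∈ blockMonoid D π) :
    IsArvesonBdd D π g := by
  induction hg using Submonoid.closure_induction with
  | mem g hg =>
    rcases hg with ⟨ι, P, Q, hP, hQ, h1, h2⟩ | ⟨ι, P, Q, hP, hQ, h1, h2⟩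
    · refine ⟨1, zero_le_one, fun X Y hY hXY T c hc hT => ?_⟩
      rw [one_mul]
      exact h2.annBound (fun i j => hY _ (hP i) _ (hQ j)) hXY hc hT
    · refine ⟨4, by norm_num, fun X Y hY hXY T c hc hT => ?_⟩
      have h3 : ∀ T, g.2 T = T - (1 - g).2 T := fun T => (sub_sub_cancel T (g.2 T)).symm
      simp only [h3] at hXY ⊢
      exact h2.annBound_sub (fun i j => hY _ (hP i) _ (hQ j)) hXY hc hT
  | one =>
    exact ⟨1, zero_le_one, fun X Y hY hXY T c hc hT => by
      rw [one_mul]; exact AnnBound.mono (Y := (Y : Set (B W))) hT fun T hT => hXY T hT⟩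
  | mul a b ha hb iha ihb =>
    obtain ⟨C, hC, iha⟩ := iha
    obtain ⟨C', hC', ihb⟩ := ihb
    refine ⟨C * C', mul_nonneg hC hC', fun X Y hY hXY T c hc hT => ?_⟩
    have h1 := ihb X (Y.comap (a.2 : B W →ₗ[ℂ] B W)) (fun p hp q hq T hT => ?_) hXY T c hc hT
    · rw [mul_assoc]
      exact iha (Y.comap (a.2 : B W →ₗ[ℂ] B W)) Y hY (fun T hT => hT) _ _ (mul_nonneg hC' hc) h1
    · change a.2 (π p * T * π q) ∈ Y
      rw [(blockMonoid_bimod hD ha p hp q hq).2]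
      exact hY p hp q hq _ hT

/-- `Φ` acts on `A` as `0` or as the identity. -/
def Decides (Φ A : B H →L[ℂ] B H) : Prop :=
  (Φ * A = A ∧ A * Φ = A) ∨ (Φ * A = 0 ∧ A * Φ = 0)

lemma Decides.mul_right {Φ A A' : B H →L[ℂ] B H} (h : Decides Φ A) (hc : A * A' = A' * A) :
    Decides Φ (A * A') := by
  refine h.imp (fun h => ⟨?_, ?_⟩) fun h => ⟨?_, ?_⟩
  · rw [← mul_assoc, h.1]
  · rw [hc, mul_assoc, h.2]
  · rw [← mul_assoc, h.1, zero_mul]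
  · rw [hc, mul_assoc, h.2, mul_zero]

lemma Decides.mul_left {Φ A A' : B H →L[ℂ] B H} (h : Decides Φ A') (hc : A * A' = A' * A) :
    Decides Φ (A * A') := by
  rw [hc]; exact h.mul_right hc.symm

lemma Decides.compl {Φ A : B H →L[ℂ] B H} (h : Decides Φ A) : Decides (1 - Φ) A := by
  refine h.symm.imp (fun h => ⟨?_, ?_⟩) fun h => ⟨?_, ?_⟩ <;>
    simp only [sub_mul, mul_sub, one_mul, mul_one, h.1, h.2, sub_zero, sub_self]

lemma Decides.mul {Φ Ψ A : B H →L[ℂ] B H} (h : Decides Φ A) (h' : Decides Ψ A) :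
    Decides (Φ * Ψ) A := by
  rcases h with h | h
  · refine h'.imp (fun h' => ⟨?_, ?_⟩) fun h' => ⟨?_, ?_⟩
    · rw [mul_assoc, h'.1, h.1]
    · rw [← mul_assoc, h.2, h'.2]
    · rw [mul_assoc, h'.1, mul_zero]
    · rw [← mul_assoc, h.2, h'.2]
  · refine Or.inr ⟨?_, by rw [← mul_assoc, h.2, zero_mul]⟩
    rcases h' with h' | h'
    · rw [mul_assoc, h'.1, h.1]
    · rw [mul_assoc, h'.1, mul_zero]

/-- A finite partition of unity in `blockMonoid`. -/
structure IsAtomic {κ : Type} [Fintype κ] (D : StarSubalgebra ℂ (B H)) (π : B H →⋆ₐ[ℂ] B W)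
    (g : κ → MapPair H W) : Prop where
  mem : ∀ k, g k ∈ blockMonoid D π
  sum : ∑ k, g k = 1

lemma IsAtomic.mul {κ κ' : Type} [Fintype κ] [Fintype κ'] {g : κ → MapPair H W}
    {g' : κ' → MapPair H W} (h : IsAtomic D π g) (h' : IsAtomic D π g') :
    IsAtomic D π fun k : κ × κ' => g k.1 * g' k.2 :=
  ⟨fun k => mul_mem (h.mem _) (h'.mem _), by
    rw [Fintype.sum_prod_type, ← Finset.sum_mul_sum, h.sum, h'.sum, one_mul]⟩

lemma InC.exists_atomic (hD : IsMasa D) (hπ : IsNormalMap (π : B H →ₗ[ℂ] B W))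
    {Φ : B H →L[ℂ] B H} (hΦ : InC D Φ) :
    ∃ (κ : Type) (_ : Fintype κ) (g : κ → MapPair H W), IsAtomic D π g ∧
      ∀ k, Decides Φ (g k).1 := by
  have key : ∀ {Φ Ψ : B H →L[ℂ] B H},
      (∃ (κ : Type) (_ : Fintype κ) (g : κ → MapPair H W), IsAtomic D π g ∧
        ∀ k, Decides Φ (g k).1) →
      (∃ (κ : Type) (_ : Fintype κ) (g : κ → MapPair H W), IsAtomic D π g ∧
        ∀ k, Decides Ψ (g k).1) →
      ∃ (κ : Type) (_ : Fintype κ) (g : κ → MapPair H W), IsAtomic D π g ∧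
        ∀ k, Decides Φ (g k).1 ∧ Decides Ψ (g k).1 := by
    rintro Φ Ψ ⟨κ, _, g, hg, h⟩ ⟨κ', _, g', hg', h'⟩
    refine ⟨κ × κ', inferInstance, _, hg.mul hg', fun k => ?_⟩
    have hc := congrArg Prod.fst (blockMonoid_commute hD (hg.mem k.1) (hg'.mem k.2)).eq
    exact ⟨(h _).mul_right hc, (h' _).mul_left hc⟩
  induction hΦ with
  | base Φ h hc =>
    obtain ⟨ι, P, Q, hP, hQ, hPD, hQD, h1, h2⟩ := exists_block_decomp hD h hc
    obtain ⟨Θ, hΘ⟩ := (hP.map hπ).exists_isBlockMap (hQ.map hπ)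
    have hb : IsBlockPair D π (Φ, Θ) :=
      ⟨ι, P, Q, fun i => (hPD i).1, fun i => (hQD i).1, ⟨hP, hQ, h1, h2⟩, hΘ⟩
    have hi : Φ * Φ = Φ := h.2
    refine ⟨Bool, inferInstance, fun b => bif b then (Φ, Θ) else 1 - (Φ, Θ), ⟨?_, ?_⟩, ?_⟩
    · rintro (_ | _)
      · exact Submonoid.subset_closure (Or.inr (by simpa using hb))
      · exact Submonoid.subset_closure (Or.inl hb)
    · rw [Fintype.sum_bool]
      exact add_sub_cancel _ _
    · rintro (_ | _)
      · refine Or.inr ⟨?_, ?_⟩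
        · change Φ * (1 - Φ) = _
          rw [mul_sub, mul_one, hi, sub_self]
        · change (1 - Φ) * Φ = _
          rw [sub_mul, one_mul, hi, sub_self]
      · exact Or.inl ⟨hi, hi⟩
  | compl Φ _ ih =>
    obtain ⟨κ, i, g, hg, h⟩ := ih
    exact ⟨κ, i, g, hg, fun k => (h k).compl⟩
  | meet Φ Ψ _ _ ih ih' =>
    obtain ⟨κ, i, g, hg, h⟩ := key ih ih'
    exact ⟨κ, i, g, hg, fun k => (h k).1.mul (h k).2⟩
  | join Φ Ψ _ _ ih ih' =>
    obtain ⟨κ, i, g, hg, h⟩ := key ih ih'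
    refine ⟨κ, i, g, hg, fun k => ?_⟩
    have h1 := ((h k).1.compl.mul (h k).2.compl).compl
    have h2 : 1 - (1 - Φ) * (1 - Ψ) = Φ + Ψ - Φ.comp Ψ := by
      change _ = Φ + Ψ - Φ * Ψ
      simp only [mul_sub, sub_mul, mul_one, one_mul]
      abel
    rwa [h2] at h1

lemma exists_atomic (hD : IsMasa D) (hπ : IsNormalMap (π : B H →ₗ[ℂ] B W)) {n : ℕ}
    (Φ : Fin n → (B H →L[ℂ] B H)) (hΦ : ∀ i, InC D (Φ i)) :
    ∃ (κ : Type) (_ : Fintype κ) (g : κ → MapPair H W), IsAtomic D π g ∧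
      ∀ k i, Decides (Φ i) (g k).1 := by
  induction n with
  | zero =>
    exact ⟨Unit, inferInstance, fun _ => 1, ⟨fun _ => one_mem _, by simp⟩, fun _ i => i.elim0⟩
  | succ n ih =>
    obtain ⟨κ, _, g, hg, h⟩ := ih (fun i => Φ i.succ) fun i => hΦ _
    obtain ⟨κ', _, g', hg', h'⟩ := (hΦ 0).exists_atomic hD hπ
    refine ⟨κ × κ', inferInstance, _, hg.mul hg', fun k i => ?_⟩
    have hc := congrArg Prod.fst (blockMonoid_commute hD (hg.mem k.1) (hg'.mem k.2)).eq
    refine Fin.cases ?_ (fun i => ?_) i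
    · exact (h' _).mul_left hc
    · exact (h _ i).mul_right hc

end Lift

section Final

lemma infDist_sum_le {E κ : Type*} [NormedAddCommGroup E] [NormedSpace ℂ E] (X : Submodule ℂ E)
    (s : Finset κ) (T : κ → E) :
    Metric.infDist (∑ k ∈ s, T k) (X : Set E) ≤ ∑ k ∈ s, Metric.infDist (T k) (X : Set E) := by
  classical
  have hadd : ∀ a b : E, Metric.infDist (a + b) (X : Set E) ≤
      Metric.infDist a (X : Set E) + Metric.infDist b (X : Set E) := fun a b => by
    refine le_of_forall_pos_le_add fun ε hε => ?_
    obtain ⟨x, hx, hax⟩ := (Metric.infDist_lt_iff ⟨0, X.zero_mem⟩).1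
      (lt_add_of_pos_right (Metric.infDist a (X : Set E)) (half_pos hε))
    obtain ⟨y, hy, hby⟩ := (Metric.infDist_lt_iff ⟨0, X.zero_mem⟩).1
      (lt_add_of_pos_right (Metric.infDist b (X : Set E)) (half_pos hε))
    have h1 := Metric.infDist_le_dist_of_mem (x := a + b) (X.add_mem hx hy)
    have h2 := dist_add_add_le a b x y
    linarith
  induction s using Finset.induction_on with
  | empty => simp [Metric.infDist_zero_of_mem (X.zero_mem : (0 : E) ∈ (X : Set E))]
  | insert k s hk ih =>
    rw [Finset.sum_insert hk, Finset.sum_insert hk]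
    exact (hadd _ _).trans (add_le_add le_rfl ih)

variable {W : Type*} [NormedAddCommGroup W] [InnerProductSpace ℂ W] [CompleteSpace W]

lemma hyperreflexive_wcl_bot : Hyperreflexive (wcl (⊥ : Submodule ℂ (B W)) : Set (B W)) := by
  refine hyperreflexive_iff.2 ⟨1, one_pos, fun T c hc hT => ?_⟩
  have h0 := hT.of_wcl
  have h1 : ‖T‖ ≤ c := T.opNorm_le_bound hc fun x => by
    have h2 := h0 x (T x) fun S hS => by
      rw [(Submodule.mem_bot ℂ).1 hS]; simp
    rw [inner_self_eq_norm_sq_to_K] at h2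
    by_contra! hlt
    have h3 : ‖T x‖ ^ 2 ≤ c * ‖x‖ * ‖T x‖ := by simpa using h2
    have h4 : 0 ≤ c * ‖x‖ := mul_nonneg hc (norm_nonneg _)
    nlinarith
  have h2 := Metric.infDist_le_dist_of_mem (x := T) ((wcl (⊥ : Submodule ℂ (B W))).zero_mem)
  rw [dist_zero_right] at h2
  rw [one_mul]
  exact h2.trans h1

universe u v

variable {H : Type u} [NormedAddCommGroup H] [InnerProductSpace ℂ H] [CompleteSpace H]
  {W : Type v} [NormedAddCommGroup W] [InnerProductSpace ℂ W] [CompleteSpace W]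
  {D : StarSubalgebra ℂ (B H)} {π : B H →⋆ₐ[ℂ] B W} {n : ℕ}

/-- The span of the products `π a * r`, where `a` lies in `X i` and `r` in `R i`. -/
def ampSpan (π : B H →⋆ₐ[ℂ] B W) (E : Finset (Fin n)) (X : Fin n → Set (B H))
    (R : Fin n → Set (B W)) : Submodule ℂ (B W) :=
  Submodule.span ℂ {z | ∃ i ∈ E, ∃ a ∈ X i, ∃ r ∈ R i, z = π a * r}

lemma mul_mem_wcl_ampSpan {R : Fin n → Set (B W)}
    (hR : ∀ i, ∀ r ∈ R i, ∀ b, π b * r = r * π b) (E : Finset (Fin n)) (p q : B H) {T : B W}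
    (hT : T ∈ wcl (ampSpan π E (fun _ => Set.univ) R)) :
    π p * T * π q ∈ wcl (ampSpan π E (fun _ => Set.univ) R) := by
  have h := (isNormalMap_mulLR (π p) (π q)).map_wcl (X := ampSpan π E (fun _ => Set.univ) R)
    (Y := ampSpan π E (fun _ => Set.univ) R) (fun T hT => ?_) hT
  · simpa using h
  · refine le_wcl _ ?_
    induction hT using Submodule.span_induction with
    | mem z hz =>
      obtain ⟨i, hi, a, -, r, hr, rfl⟩ := hz
      refine Submodule.subset_span ⟨i, hi, p * a * q, trivial, r, hr, ?_⟩
      rw [mulLR_apply, map_mul, map_mul, mul_assoc (π p * π a), hR i r hr q]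
      simp only [mul_assoc]
    | zero => rw [map_zero]; exact Submodule.zero_mem _
    | add x y _ _ hx hy => rw [map_add]; exact Submodule.add_mem _ hx hy
    | smul c x _ hx => rw [map_smul]; exact Submodule.smul_mem _ _ hx

lemma map_mem_wcl_ampSpan {R : Fin n → Set (B W)}
    (hR : ∀ i, ∀ r ∈ R i, ∀ b, π b * r = r * π b) {E E' : Finset (Fin n)}
    {X X' : Fin n → Set (B H)} {g : MapPair H W} (hg : g ∈ blockMonoid D π)
    (h : ∀ i ∈ E, ∀ a ∈ X i, g.1 a = 0 ∨ i ∈ E' ∧ g.1 a ∈ X' i) {T : B W}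
    (hT : T ∈ wcl (ampSpan π E X R)) : g.2 T ∈ wcl (ampSpan π E' X' R) := by
  refine (blockMonoid_normal hg).map_wcl (fun T hT => le_wcl _ ?_) hT
  induction hT using Submodule.span_induction with
  | mem z hz =>
    obtain ⟨i, hi, a, ha, r, hr, rfl⟩ := hz
    rw [ContinuousLinearMap.coe_coe, blockMonoid_ampl hg a r (hR i r hr)]
    rcases h i hi a ha with h0 | ⟨hi', ha'⟩
    · rw [h0, map_zero, zero_mul]; exact Submodule.zero_mem _
    · exact Submodule.subset_span ⟨i, hi', _, ha', r, hr, rfl⟩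
  | zero => rw [map_zero]; exact Submodule.zero_mem _
  | add x y _ _ hx hy => rw [map_add]; exact Submodule.add_mem _ hx hy
  | smul c x _ hx => rw [map_smul]; exact Submodule.smul_mem _ _ hx

/-- Hyperreflexivity of the amplified spaces glues along Schur idempotents in `𝔠(H)`. -/
theorem hyperreflexive_wcl_ampSpan (hD : IsMasa D) (hπ : IsNormalMap (π : B H →ₗ[ℂ] B W))
    (Φ : Fin n → (B H →L[ℂ] B H)) (hΦ : ∀ i, InC D (Φ i)) {R : Fin n → Set (B W)}
    (hR : ∀ i, ∀ r ∈ R i, ∀ b, π b * r = r * π b)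
    (hV : ∀ E : Finset (Fin n), E.Nonempty →
      Hyperreflexive (wcl (ampSpan π E (fun _ => Set.univ) R) : Set (B W))) :
    Hyperreflexive
      (wcl (ampSpan π Finset.univ (fun i => Set.range (Φ i)) R) : Set (B W)) := by
  classical
  have hV' : ∀ E : Finset (Fin n),
      Hyperreflexive (wcl (ampSpan π E (fun _ => Set.univ) R) : Set (B W)) := fun E => by
    rcases E.eq_empty_or_nonempty with rfl | hE
    · have : ampSpan π (∅ : Finset (Fin n)) (fun _ => Set.univ) R = ⊥ := by simp [ampSpan]
      rw [this]
      exact hyperreflexive_wcl_bot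
    · exact hV E hE
  obtain ⟨κ, _, g, hg, hdec⟩ := exists_atomic (π := π) hD hπ Φ hΦ
  set X := wcl (ampSpan π Finset.univ (fun i => Set.range (Φ i)) R) with hX
  have key : ∀ k, ∃ K : ℝ, 0 ≤ K ∧ ∀ T c, 0 ≤ c → AnnBound T X c →
      Metric.infDist ((g k).2 T) (X : Set (B W)) ≤ K * c := fun k => by
    set E : Finset (Fin n) := Finset.univ.filter fun i => Φ i * (g k).1 = (g k).1 with hE
    set V := wcl (ampSpan π E (fun _ => Set.univ) R) with hVdef
    obtain ⟨K, hK, hKT⟩ := hyperreflexive_iff.1 (hV' E)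
    obtain ⟨C, hC, hCT⟩ := blockMonoid_arvesonBdd hD (hg.mem k)
    have hVX : ∀ S ∈ V, (g k).2 S ∈ X := fun S hS =>
      map_mem_wcl_ampSpan hR (hg.mem k) (fun i hi a _ => Or.inr ⟨Finset.mem_univ i, by
        rw [hE, Finset.mem_filter] at hi
        exact ⟨(g k).1 a, congrArg (fun A : B H →L[ℂ] B H => A a) hi.2⟩⟩) hS
    have hXV : ∀ S ∈ X, (g k).2 S ∈ V := fun S hS => by
      refine map_mem_wcl_ampSpan hR (hg.mem k) (fun i _ a ha => ?_) hS
      obtain ⟨b, rfl⟩ := ha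
      rcases hdec k i with h | h
      · exact Or.inr ⟨by rw [hE, Finset.mem_filter]; exact ⟨Finset.mem_univ i, h.1⟩, trivial⟩
      · exact Or.inl (congrArg (fun A : B H →L[ℂ] B H => A b) h.2)
    refine ⟨‖(g k).2‖ * (K * C), by positivity, fun T c hc hT => ?_⟩
    have h1 := hKT _ _ (mul_nonneg hC hc) (hCT X V
      (fun p _ q _ T hT => mul_mem_wcl_ampSpan hR E p q hT) hXV T c hc hT)
    have hidem : (g k).2 ((g k).2 T) = (g k).2 T :=
      congrArg (fun h : MapPair H W => h.2 T) (blockMonoid_mul_self hD (hg.mem k))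
    have h2 : Metric.infDist ((g k).2 T) (X : Set (B W)) ≤
        ‖(g k).2‖ * Metric.infDist ((g k).2 T) (V : Set (B W)) := by
      refine le_of_forall_pos_le_add fun ε hε => ?_
      have hpos : 0 < ‖(g k).2‖ + 1 := by positivity
      obtain ⟨S, hS, hdist⟩ := (Metric.infDist_lt_iff ⟨0, V.zero_mem⟩).1
        (lt_add_of_pos_right (Metric.infDist ((g k).2 T) (V : Set (B W))) (div_pos hε hpos))
      have h3 := Metric.infDist_le_dist_of_mem (x := (g k).2 T) (hVX S hS)
      have h4 : dist ((g k).2 T) ((g k).2 S) ≤ ‖(g k).2‖ * dist ((g k).2 T) S := by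
        rw [dist_eq_norm, dist_eq_norm]
        nth_rewrite 1 [← hidem]
        rw [← map_sub]
        exact (g k).2.le_opNorm _
      have h5 : ‖(g k).2‖ * (ε / (‖(g k).2‖ + 1)) ≤ ε := by
        rw [← mul_div_assoc, div_le_iff₀ hpos]
        nlinarith [norm_nonneg (g k).2]
      calc _ ≤ ‖(g k).2‖ * dist ((g k).2 T) S := h3.trans h4
        _ ≤ ‖(g k).2‖ * (Metric.infDist ((g k).2 T) (V : Set (B W)) + ε / (‖(g k).2‖ + 1)) :=
          mul_le_mul_of_nonneg_left hdist.le (norm_nonneg _)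
        _ ≤ _ := by rw [mul_add]; linarith
    calc _ ≤ _ := h2
      _ ≤ ‖(g k).2‖ * (K * (C * c)) := mul_le_mul_of_nonneg_left h1 (norm_nonneg _)
      _ = _ := by ring
  choose K hK hKT using key
  refine hyperreflexive_iff.2 ⟨∑ k, K k + 1, by
    have := Finset.sum_nonneg fun k (_ : k ∈ Finset.univ) => hK k
    positivity, fun T c hc hT => ?_⟩
  have hsum : ∑ k, (g k).2 T = T := by
    have h1 := congrArg (fun h : MapPair H W => h.2 T) hg.sum
    simpa [Prod.snd_sum] using h1
  calc Metric.infDist T (X : Set (B W)) = Metric.infDist (∑ k, (g k).2 T) (X : Set (B W)) := by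
        rw [hsum]
    _ ≤ ∑ k, Metric.infDist ((g k).2 T) (X : Set (B W)) := infDist_sum_le X _ _
    _ ≤ ∑ k, K k * c := Finset.sum_le_sum fun k _ => hKT k T c hc hT
    _ ≤ (∑ k, K k + 1) * c := by rw [← Finset.sum_mul, add_mul, one_mul]; linarith

end Final

section Slices

variable {E : Type*} [NormedAddCommGroup E] [InnerProductSpace ℂ E]
  {F : Type*} [NormedAddCommGroup F] [InnerProductSpace ℂ F]
  {G : Type*} [NormedAddCommGroup G] [InnerProductSpace ℂ G] {ι κ : Type*}

/-- Isometries with mutually orthogonal ranges whose union is total. -/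
structure IsSlices (S : ι → E →L[ℂ] G) : Prop where
  inner_same : ∀ i x y, ⟪S i x, S i y⟫_ℂ = ⟪x, y⟫_ℂ
  inner_ne : ∀ i j, i ≠ j → ∀ x y, ⟪S i x, S j y⟫_ℂ = 0
  total : ∀ z, (∀ i x, ⟪S i x, z⟫_ℂ = 0) → z = 0

lemma IsSlices.reindex {S : ι → E →L[ℂ] G} (hS : IsSlices S) (e : κ ≃ ι) :
    IsSlices fun k => S (e k) :=
  ⟨fun _ => hS.inner_same _, fun _ _ hij => hS.inner_ne _ _ (e.injective.ne hij), fun z hz =>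
    hS.total z fun i x => by simpa using hz (e.symm i) x⟩

/-- Two operators agreeing on slices coincide. -/
lemma IsSlices.ext {L : Type*} [NormedAddCommGroup L] [InnerProductSpace ℂ L] [CompleteSpace G]
    {S : ι → E →L[ℂ] G} (hS : IsSlices S) {A C : G →L[ℂ] L}
    (h : ∀ i x, A (S i x) = C (S i x)) : A = C := by
  let M : Submodule ℂ G := Submodule.span ℂ {z | ∃ i x, z = S i x}
  have hM : M.topologicalClosure = ⊤ := by
    rw [Submodule.topologicalClosure_eq_top_iff, Submodule.eq_bot_iff]
    intro z hz
    exact hS.total z fun i x => hz _ (Submodule.subset_span ⟨i, x, rfl⟩)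
  have hd : Dense (M : Set G) := by
    rw [dense_iff_closure_eq, ← Submodule.topologicalClosure_coe, hM, Submodule.top_coe]
  refine DFunLike.coe_injective (Continuous.ext_on hd A.continuous C.continuous fun z hz => ?_)
  induction hz using Submodule.span_induction with
  | mem z hz => obtain ⟨i, x, rfl⟩ := hz; exact h i x
  | zero => rw [map_zero, map_zero]
  | add x y _ _ hx hy => rw [map_add, map_add, hx, hy]
  | smul c x _ hx => rw [map_smul, map_smul, hx]

variable [CompleteSpace E] [CompleteSpace G]

lemma IsSlices.adjoint_apply [DecidableEq ι] {S : ι → E →L[ℂ] G} (hS : IsSlices S) (i j : ι)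
    (x : E) : ContinuousLinearMap.adjoint (S i) (S j x) = if i = j then x else 0 := by
  refine ext_inner_left ℂ fun y => ?_
  rw [ContinuousLinearMap.adjoint_inner_right]
  split_ifs with h
  · rw [h, hS.inner_same]
  · rw [hS.inner_ne i j h, inner_zero_right]

lemma IsSlices.eq_zero {S : ι → E →L[ℂ] G} (hS : IsSlices S) {z : G}
    (h : ∀ i, ContinuousLinearMap.adjoint (S i) z = 0) : z = 0 :=
  hS.total z fun i x => by
    rw [← ContinuousLinearMap.adjoint_inner_right, h, inner_zero_right]

lemma IsSlices.norm_apply {S : ι → E →L[ℂ] G} (hS : IsSlices S) (i : ι) (x : E) :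
    ‖S i x‖ = ‖x‖ := by
  have h := hS.inner_same i x x
  rw [inner_self_eq_norm_sq_to_K, inner_self_eq_norm_sq_to_K] at h
  exact (pow_left_inj₀ (norm_nonneg _) (norm_nonneg _) two_ne_zero).1 (by exact_mod_cast h)

lemma IsSlices.isDecomp {S : ι → E →L[ℂ] G} (hS : IsSlices S) :
    IsDecomp fun i => S i ∘L ContinuousLinearMap.adjoint (S i) := by
  classical
  refine .of_ker (fun i => ⟨?_, ?_⟩) (fun i j hij => ?_) fun x hx => hS.eq_zero fun i => ?_
  · ext x
    simp [hS.adjoint_apply]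
  · rw [IsSelfAdjoint, ContinuousLinearMap.star_eq_adjoint, ContinuousLinearMap.adjoint_comp,
      ContinuousLinearMap.adjoint_adjoint]
  · ext x
    simp [hS.adjoint_apply, hij]
  · have h1 := congrArg norm (hx i)
    rw [ContinuousLinearMap.comp_apply, hS.norm_apply, norm_zero] at h1
    exact norm_eq_zero.1 h1

lemma IsSlices.isBddFam {S : ι → E →L[ℂ] G} (hS : IsSlices S) :
    IsBddFam (fun i => ContinuousLinearMap.adjoint (S i)) 1 := by
  have h := hS.isDecomp.isBddFam
  simpa only [IsBddFam, ContinuousLinearMap.comp_apply, hS.norm_apply] using h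

lemma IsSlices.comp [CompleteSpace F] {S : ι → E →L[ℂ] F} {S' : κ → F →L[ℂ] G} (hS : IsSlices S)
    (hS' : IsSlices S') : IsSlices fun p : ι × κ => S' p.2 ∘L S p.1 := by
  refine ⟨fun p x y => ?_, fun p q hpq x y => ?_, fun z hz => hS'.eq_zero fun k =>
    hS.total _ fun i x => ?_⟩
  · simp only [ContinuousLinearMap.comp_apply]
    rw [hS'.inner_same, hS.inner_same]
  · simp only [ContinuousLinearMap.comp_apply]
    by_cases h : p.2 = q.2
    · rw [h, hS'.inner_same]
      exact hS.inner_ne _ _ (fun h1 => hpq (Prod.ext h1 h)) _ _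
    · exact hS'.inner_ne _ _ h _ _
  · rw [ContinuousLinearMap.adjoint_inner_right]
    exact hz (i, k) x

end Slices

section Tensor

variable {E : Type*} [NormedAddCommGroup E] [InnerProductSpace ℂ E]
  {F : Type*} [NormedAddCommGroup F] [InnerProductSpace ℂ F]
  {G : Type*} [NormedAddCommGroup G] [InnerProductSpace ℂ G]
  {t : E →ₗ[ℂ] F →ₗ[ℂ] G} {τ : B E →ₗ[ℂ] B F →ₗ[ℂ] B G}

lemma IsElemTensor.norm_apply (ht : IsElemTensor t) (x : E) (y : F) : ‖t x y‖ = ‖x‖ * ‖y‖ := by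
  have h := ht.1 x x y y
  rw [inner_self_eq_norm_sq_to_K, inner_self_eq_norm_sq_to_K, inner_self_eq_norm_sq_to_K,
    ← mul_pow] at h
  refine (pow_left_inj₀ (norm_nonneg _) (by positivity) two_ne_zero).1 ?_
  exact_mod_cast h

lemma IsElemTensor.flip (ht : IsElemTensor t) : IsElemTensor t.flip := by
  refine ⟨fun x₁ x₂ y₁ y₂ => by simp [ht.1, mul_comm], ?_⟩
  have : {z : G | ∃ x y, z = t.flip x y} = {z | ∃ x y, z = t x y} := by
    ext z
    simp only [LinearMap.flip_apply, Set.mem_ofPred_eq]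
    exact exists_comm
  rw [this]
  exact ht.2

/-- The slice map `x ↦ x ⊗ y`. -/
def IsElemTensor.slice (ht : IsElemTensor t) (y : F) : E →L[ℂ] G :=
  (t.flip y).mkContinuous ‖y‖ fun x => by
    rw [LinearMap.flip_apply, ht.norm_apply, mul_comm]

@[simp] lemma IsElemTensor.slice_apply (ht : IsElemTensor t) (y : F) (x : E) :
    ht.slice y x = t x y := rfl

lemma IsElemTensor.ext (ht : IsElemTensor t) {A C : B G} (h : ∀ x y, A (t x y) = C (t x y)) :
    A = C := by
  refine DFunLike.coe_injective (Continuous.ext_on ht.2 A.continuous C.continuous fun z hz => ?_)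
  induction hz using Submodule.span_induction with
  | mem z hz => obtain ⟨x, y, rfl⟩ := hz; exact h x y
  | zero => rw [map_zero, map_zero]
  | add x y _ _ hx hy => rw [map_add, map_add, hx, hy]
  | smul c x _ hx => rw [map_smul, map_smul, hx]

lemma IsElemTensor.eq_zero (ht : IsElemTensor t) {z : G} (h : ∀ x y, ⟪t x y, z⟫_ℂ = 0) :
    z = 0 := by
  refine ht.2.eq_zero_of_inner_left ℂ fun v hv => ?_
  induction hv using Submodule.span_induction with
  | mem v hv => obtain ⟨x, y, rfl⟩ := hv; exact inner_eq_zero_symm.1 (h x y)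
  | zero => exact inner_zero_right _
  | add x y _ _ hx hy => rw [inner_add_right, hx, hy, add_zero]
  | smul c x _ hx => rw [inner_smul_right, hx, mul_zero]

lemma IsElemTensor.hasSum_inner {ι : Type*} (ht : IsElemTensor t) (b : HilbertBasis ι ℂ F)
    (x : E) (y : F) (z : G) :
    HasSum (fun j => b.repr y j * ⟪z, t x (b j)⟫_ℂ) ⟪z, t x y⟫_ℂ := by
  have h := ((b.hasSum_repr y).mapL (ht.flip.slice x)).mapL (innerSL ℂ z)
  refine h.congr_fun fun j => Eq.symm ?_
  exact (congrArg _ (map_smul (ht.flip.slice x) (b.repr y j) (b j))).trans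
    (inner_smul_right z _ (b.repr y j))

lemma IsElemTensor.isSlices {ι : Type*} (ht : IsElemTensor t) (b : HilbertBasis ι ℂ F) :
    IsSlices fun j => ht.slice (b j) := by
  refine ⟨fun j x y => ?_, fun i j hij x y => ?_, fun z hz => ht.eq_zero fun x y => ?_⟩
  · simp [ht.1, b.orthonormal.1 j]
  · simp [ht.1, b.orthonormal.2 hij]
  · have h3 : ∀ j, ⟪z, t x (b j)⟫_ℂ = 0 := fun j => inner_eq_zero_symm.1 (hz j x)
    have h2 := ht.hasSum_inner b x y z
    simp only [h3, mul_zero] at h2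
    exact inner_eq_zero_symm.1 (h2.unique hasSum_zero)

lemma IsOpTensor.map_mul (ht : IsElemTensor t) (hτ : IsOpTensor t τ) (A A' : B E) (C C' : B F) :
    τ (A * A') (C * C') = τ A C * τ A' C' :=
  ht.ext fun x y => by simp [hτ _ _ _ _]

lemma IsOpTensor.map_one (ht : IsElemTensor t) (hτ : IsOpTensor t τ) : τ 1 1 = 1 :=
  ht.ext fun x y => by simp [hτ _ _ _ _]

variable [CompleteSpace E] [CompleteSpace F] [CompleteSpace G]

lemma IsOpTensor.map_star (ht : IsElemTensor t) (hτ : IsOpTensor t τ) (A : B E) (C : B F) :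
    τ (star A) (star C) = star (τ A C) := by
  refine ht.ext fun x y => ?_
  rw [← sub_eq_zero]
  refine ht.eq_zero fun x' y' => ?_
  rw [inner_sub_right, hτ, ContinuousLinearMap.star_eq_adjoint,
    ContinuousLinearMap.star_eq_adjoint, ContinuousLinearMap.star_eq_adjoint, ht.1,
    ContinuousLinearMap.adjoint_inner_right, ContinuousLinearMap.adjoint_inner_right,
    ContinuousLinearMap.adjoint_inner_right, hτ, ht.1, sub_self]

/-- Ampliation of operators on the first tensor factor. -/
lemma IsElemTensor.exists_ampliation (ht : IsElemTensor t) :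
    ∃ Θ : B E →L[ℂ] B G, IsNormalMap (Θ : B E →ₗ[ℂ] B G) ∧
      ∀ A x y, Θ A (t x y) = t (A x) y := by
  obtain ⟨w, b, -⟩ := exists_hilbertBasis ℂ F
  have hS := ht.isSlices b
  obtain ⟨Θ, hΘ, hn⟩ := exists_kraus hS.isBddFam hS.isBddFam
  refine ⟨Θ, hn, fun A x y => ext_inner_left ℂ fun z => ?_⟩
  rw [hΘ, ← (ht.hasSum_inner b (A x) y z).tsum_eq]
  refine tsum_congr fun j => ?_
  have h2 : ContinuousLinearMap.adjoint (ht.slice (b j)) (t x y) = b.repr y j • x := by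
    refine ext_inner_left ℂ fun v => ?_
    rw [ContinuousLinearMap.adjoint_inner_right, ht.slice_apply, ht.1, inner_smul_right,
      b.repr_apply_apply, mul_comm]
  rw [h2, map_smul, inner_smul_right, ContinuousLinearMap.adjoint_inner_left, ht.slice_apply]

lemma IsElemTensor.exists_isOpTensor (ht : IsElemTensor t) :
    ∃ τ : B E →ₗ[ℂ] B F →ₗ[ℂ] B G, IsOpTensor t τ := by
  obtain ⟨Θ₁, -, h₁⟩ := ht.exists_ampliation
  obtain ⟨Θ₂, -, h₂⟩ := ht.flip.exists_ampliation
  refine ⟨(LinearMap.mul ℂ (B G)).compl₁₂ (Θ₁ : B E →ₗ[ℂ] B G) (Θ₂ : B F →ₗ[ℂ] B G),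
    fun A C x y => ?_⟩
  have h3 := h₂ C y x
  simp only [LinearMap.flip_apply] at h3
  simp [h₁, h3]

lemma IsOpTensor.isNormalMap_left (ht : IsElemTensor t) (hτ : IsOpTensor t τ) (C : B F) :
    IsNormalMap (τ.flip C) := by
  obtain ⟨Θ, hn, h⟩ := ht.exists_ampliation
  have h1 : τ.flip C = mulLR 1 (τ 1 C) ∘ₗ (Θ : B E →ₗ[ℂ] B G) := by
    refine LinearMap.ext fun A => ht.ext fun x y => ?_
    simp [hτ _ _ _ _, h]
  rw [h1]
  exact (isNormalMap_mulLR _ _).comp hn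

end Tensor

section Blocks

variable {H : Type*} [NormedAddCommGroup H] [InnerProductSpace ℂ H] [CompleteSpace H] {ι : Type*}

/-- An operator whose blocks lie in a weak* closed subspace lies in that subspace. -/
lemma IsDecomp.mem_wcl {P : ι → B H} (hP : IsDecomp P) {X : Submodule ℂ (B H)} {T : B H}
    (h : ∀ i j, P i * T * P j ∈ wcl X) : T ∈ wcl X := by
  refine wcl_le (le_refl _) ?_
  refine mem_wcl_of_tendsto (l := Filter.atTop)
    (f := fun F : Finset ι => (∑ i ∈ F, P i) * T * ∑ j ∈ F, P j) (fun F => ?_) fun ω hω => ?_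
  · rw [Finset.sum_mul, Finset.sum_mul]
    refine Submodule.sum_mem _ fun i _ => ?_
    rw [Finset.mul_sum]
    exact Submodule.sum_mem _ fun j _ => h i j
  · have hF := fun F => isStarProjection_sum hP.proj hP.orth F
    refine hω.tendsto (C := ‖T‖) (fun F => ?_) fun x y => ?_
    · calc _ ≤ ‖∑ i ∈ F, P i‖ * ‖T‖ * ‖∑ i ∈ F, P i‖ :=
            (norm_mul_le _ _).trans (by gcongr; exact norm_mul_le _ _)
        _ ≤ 1 * ‖T‖ * 1 := by gcongr <;> exact (hF F).norm_le
        _ = ‖T‖ := by ring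
    · have hs : ∀ z, Filter.Tendsto (fun F : Finset ι => (∑ i ∈ F, P i) z) Filter.atTop
          (nhds z) := fun z => by
        simp only [sum_apply]
        exact hP.hasSum z
      have h1 := ((T.continuous.tendsto x).comp (hs x))
      have h2 := (hs y).inner (𝕜 := ℂ) h1
      refine h2.congr fun F => ?_
      rw [mul_apply_eq_comp, mul_apply_eq_comp, ← (hF F).inner_left]
      rfl

end Blocks

section Separable

variable {H : Type*} [NormedAddCommGroup H] [InnerProductSpace ℂ H]

lemma countable_of_orthonormal [TopologicalSpace.SeparableSpace H] {ι : Type*} {v : ι → H}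
    (hv : Orthonormal ℂ v) : Countable ι := by
  refine Pairwise.countable_of_isOpen_disjoint (s := fun i => Metric.ball (v i) (1 / 2))
    (fun i j hij => Metric.ball_disjoint_ball ?_) (fun _ => Metric.isOpen_ball)
    fun i => ⟨v i, Metric.mem_ball_self (by norm_num)⟩
  have h1 : ‖v i - v j‖ ^ 2 = 2 := by
    rw [@norm_sub_sq ℂ, hv.1, hv.1, hv.2 hij]
    norm_num
  rw [dist_eq_norm]
  nlinarith [norm_nonneg (v i - v j)]

end Separable

section EllTensor

/-- The standard basis of `ℓ²`. -/
def ellBasis : HilbertBasis ℕ ℂ ell2 := .ofRepr (LinearIsometryEquiv.refl ℂ ell2)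

variable {E : Type*} [NormedAddCommGroup E] [InnerProductSpace ℂ E]
  {G : Type*} [NormedAddCommGroup G] [InnerProductSpace ℂ G]

lemma dense_span_of_total [CompleteSpace G] {s : Set G}
    (h : ∀ z, (∀ v ∈ s, ⟪v, z⟫_ℂ = 0) → z = 0) : Dense (Submodule.span ℂ s : Set G) := by
  rw [dense_iff_closure_eq, ← Submodule.topologicalClosure_coe,
    (Submodule.topologicalClosure_eq_top_iff (K := Submodule.span ℂ s)).2, Submodule.top_coe]
  rw [Submodule.eq_bot_iff]
  exact fun z hz => h z fun v hv => hz _ (Submodule.subset_span hv)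

lemma IsSlices.summable [CompleteSpace G] {S : ℕ → E →L[ℂ] G} (hS : IsSlices S) (x : E)
    (f : ell2) : Summable fun n => f n • S n x := by
  have hV : OrthogonalFamily ℂ (fun _ : ℕ => E) fun n =>
      ((S n : E →ₗ[ℂ] G).isometryOfInner (hS.inner_same n)) :=
    fun i j hij x y => hS.inner_ne i j hij x y
  have h1 := (hV.summable_iff_norm_sq_summable fun n => f n • x).2 (by
    simp only [norm_smul, mul_pow]
    refine Summable.mul_right _ ?_
    have := (lp.memℓp f).summable (by norm_num)
    simpa using this)
  refine h1.congr fun n => ?_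
  rw [map_smul]
  rfl

lemma IsSlices.exists_isElemTensor [CompleteSpace G] {S : ℕ → E →L[ℂ] G} (hS : IsSlices S) :
    ∃ t : E →ₗ[ℂ] ell2 →ₗ[ℂ] G, IsElemTensor t ∧ ∀ x n, t x (ellBasis n) = S n x := by
  let t : E →ₗ[ℂ] ell2 →ₗ[ℂ] G := LinearMap.mk₂ ℂ (fun x f => ∑' n, f n • S n x)
    (fun x y f => by
      rw [← (hS.summable x f).tsum_add (hS.summable y f)]
      simp only [map_add, smul_add])
    (fun c x f => by
      rw [← (hS.summable x f).tsum_const_smul]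
      simp only [map_smul, smul_comm c])
    (fun x f g => by
      rw [← (hS.summable x f).tsum_add (hS.summable x g)]
      simp only [lp.coeFn_add, Pi.add_apply, add_smul])
    (fun c x f => by
      rw [← (hS.summable x f).tsum_const_smul]
      simp only [lp.coeFn_smul, Pi.smul_apply, smul_assoc])
  have hsum : ∀ x f, HasSum (fun n => f n • S n x) (t x f) := fun x f => (hS.summable x f).hasSum
  have hb : ∀ n m, (ellBasis n : ell2) m = if m = n then 1 else 0 := fun n m => by
    rw [← ellBasis.repr_symm_single n]
    change (lp.single 2 n (1 : ℂ) : ell2) m = _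
    rw [lp.single_apply, Pi.single_apply]
  have ht : ∀ x n, t x (ellBasis n) = S n x := fun x n => by
    refine (hsum x (ellBasis n)).unique ?_
    convert hasSum_single n fun m hm => ?_
    · simp [hb]
    · simp [hb, hm]
  refine ⟨t, ⟨fun x y f g => ?_, dense_span_of_total fun z hz => hS.total z fun n x => ?_⟩, ht⟩
  · have h1 : ∀ n, ⟪S n x, t y g⟫_ℂ = ⟪x, y⟫_ℂ * g n := fun n => by
      refine ((hsum y g).mapL (innerSL ℂ (S n x))).unique ?_
      convert hasSum_single n fun m hm => ?_
      · simp [inner_smul_right, hS.inner_same, mul_comm]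
      · simp [inner_smul_right, hS.inner_ne n m hm.symm]
    have h2 := ((hsum x f).mapL (innerSL ℂ (t y g))).star
    refine (inner_conj_symm _ _).symm.trans (h2.unique ?_)
    refine ((lp.hasSum_inner f g).mul_left ⟪x, y⟫_ℂ).congr_fun fun n => ?_
    simp [inner_smul_right, h1, mul_comm, mul_left_comm]
    ring
  · exact hz _ ⟨x, ellBasis n, (ht x n).symm⟩

end EllTensor

section Unitary

variable {W : Type*} [NormedAddCommGroup W] [InnerProductSpace ℂ W] [CompleteSpace W]
  {M : Type*} [NormedAddCommGroup M] [InnerProductSpace ℂ M] [CompleteSpace M]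

/-- Conjugation by a unitary operator, as a linear map. -/
def conjₗ (Ω : W ≃ₗᵢ[ℂ] M) : B W →ₗ[ℂ] B M := Ω.conjStarAlgEquiv.toAlgEquiv.toLinearMap

@[simp] lemma conjₗ_apply (Ω : W ≃ₗᵢ[ℂ] M) (T : B W) (x : M) :
    conjₗ Ω T x = Ω (T (Ω.symm x)) := rfl

lemma isNormalMap_conjₗ (Ω : W ≃ₗᵢ[ℂ] M) : IsNormalMap (conjₗ Ω) :=
  isNormalMap_of_apply (Ω : W →L[ℂ] M) (Ω.symm : M →L[ℂ] W) _ fun _ _ => rfl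

lemma norm_conjₗ_le (Ω : W ≃ₗᵢ[ℂ] M) (T : B W) : ‖conjₗ Ω T‖ ≤ ‖T‖ :=
  ContinuousLinearMap.opNorm_le_bound _ (norm_nonneg _) fun x => by
    simpa using T.le_opNorm (Ω.symm x)

lemma Hyperreflexive.of_unitary (Ω : W ≃ₗᵢ[ℂ] M) {X : Submodule ℂ (B W)} {Y : Submodule ℂ (B M)}
    (hXY : ∀ T ∈ X, conjₗ Ω T ∈ Y) (hYX : ∀ T ∈ Y, conjₗ Ω.symm T ∈ X)
    (hY : Hyperreflexive (Y : Set (B M))) : Hyperreflexive (X : Set (B W)) := by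
  rw [hyperreflexive_iff] at hY ⊢
  obtain ⟨k, hk, h⟩ := hY
  refine ⟨k, hk, fun T c hc hT => le_trans ?_ (h (conjₗ Ω T) c hc fun ξ η hS => ?_)⟩
  · refine (Metric.le_infDist ⟨0, Y.zero_mem⟩).2 fun S hS => ?_
    refine (Metric.infDist_le_dist_of_mem (hYX S hS)).trans ?_
    have h1 : T - conjₗ Ω.symm S = conjₗ Ω.symm (conjₗ Ω T - S) := by
      ext x
      simp
    rw [dist_eq_norm, dist_eq_norm, h1]
    exact norm_conjₗ_le _ _
  · have h1 : ∀ S : B W, ⟪η, conjₗ Ω S ξ⟫_ℂ = ⟪Ω.symm η, S (Ω.symm ξ)⟫_ℂ := fun S => by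
      rw [conjₗ_apply, ← Ω.symm.inner_map_map, Ω.symm_apply_apply]
    have h2 := hT (Ω.symm ξ) (Ω.symm η) fun S hSX => by
      rw [← h1]
      exact hS _ (hXY S hSX)
    rwa [← h1, Ω.symm.norm_map, Ω.symm.norm_map] at h2

end Unitary

section Transfer

universe v w

/-- Complete hyperreflexivity can be tested in realisations living in any universe. -/
lemma CompletelyHyperreflexive.transfer {E : Type*} [NormedAddCommGroup E]
    [InnerProductSpace ℂ E] [CompleteSpace E] [TopologicalSpace.SeparableSpace E] {X : Set (B E)}
    (hX : CompletelyHyperreflexive.{_, w} X)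
    {W : Type v} [NormedAddCommGroup W] [InnerProductSpace ℂ W] [CompleteSpace W]
    {t : E →ₗ[ℂ] ell2 →ₗ[ℂ] W} {τ : B E →ₗ[ℂ] B ell2 →ₗ[ℂ] B W} (ht : IsElemTensor t)
    (hτ : IsOpTensor t τ) : Hyperreflexive (wStarClosure W (tensorSpan τ X Set.univ)) := by
  obtain ⟨s, b, -⟩ := exists_hilbertBasis ℂ E
  have : Countable s := countable_of_orthonormal b.orthonormal
  let e := (equivShrink.{w} (s × ℕ)).symm
  have hv : Orthonormal ℂ fun i => t (b (e i).1) (ellBasis (e i).2) := by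
    refine ⟨fun i => ?_, fun i j hij => ?_⟩
    · rw [ht.norm_apply, b.orthonormal.1, ellBasis.orthonormal.1, mul_one]
    · change ⟪_, _⟫_ℂ = 0
      rw [ht.1]
      by_cases h : (e i).1 = (e j).1
      · rw [ellBasis.orthonormal.2 fun h2 => hij (e.injective (Prod.ext h h2)), mul_zero]
      · rw [b.orthonormal.2 h, zero_mul]
  have hsp : (Submodule.span ℂ (Set.range fun i => t (b (e i).1) (ellBasis (e i).2)))ᗮ = ⊥ := by
    rw [Submodule.eq_bot_iff]
    refine fun z hz => (ht.isSlices ellBasis).total z fun n x => ?_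
    have h1 : ∀ i, ⟪z, t (b i) (ellBasis n)⟫_ℂ = 0 := fun i => by
      have := hz _ (Submodule.subset_span ⟨e.symm (i, n), rfl⟩)
      beta_reduce at this
      rw [e.apply_symm_apply] at this
      exact inner_eq_zero_symm.1 this
    have h2 := ht.flip.hasSum_inner b (ellBasis n) x z
    simp only [LinearMap.flip_apply, h1, mul_zero] at h2
    exact inner_eq_zero_symm.1 (h2.unique hasSum_zero)
  let Ω := (HilbertBasis.mkOfOrthogonalEqBot hv hsp).repr
  let t₁ := t.compr₂ Ω.toLinearEquiv.toLinearMap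
  let τ₁ := τ.compr₂ (conjₗ Ω)
  have ht₁ : IsElemTensor t₁ := by
    refine ⟨fun x₁ x₂ y₁ y₂ => ?_, dense_span_of_total fun z hz => ?_⟩
    · rw [← ht.1]
      exact Ω.inner_map_map _ _
    · have h1 : Ω.symm z = 0 := ht.eq_zero fun x y => by
        rw [← Ω.inner_map_map, Ω.apply_symm_apply]
        exact hz _ ⟨x, y, rfl⟩
      simpa using h1
  have hτ₁ : IsOpTensor t₁ τ₁ := fun A C x y => by
    change Ω (τ A C (Ω.symm (Ω (t x y)))) = Ω (t (A x) (C y))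
    rw [Ω.symm_apply_apply, hτ]
  have hY := hX _ t₁ τ₁ ht₁ hτ₁
  let Z := Submodule.span ℂ {z : B W | ∃ a ∈ X, ∃ c ∈ (Set.univ : Set (B ell2)), z = τ a c}
  let Z₁ := Submodule.span ℂ {z | ∃ a ∈ X, ∃ c ∈ (Set.univ : Set (B ell2)), z = τ₁ a c}
  refine Hyperreflexive.of_unitary Ω (X := wcl Z) (Y := wcl Z₁) (fun T hT => ?_)
    (fun T hT => ?_) hY
  · refine (isNormalMap_conjₗ Ω).map_wcl (X := Z) (fun T hT => le_wcl _ ?_) hT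
    induction hT using Submodule.span_induction with
    | mem z hz =>
      obtain ⟨a, ha, c, hc, rfl⟩ := hz
      exact Submodule.subset_span ⟨a, ha, c, hc, rfl⟩
    | zero => rw [map_zero]; exact Submodule.zero_mem _
    | add x y _ _ hx hy => rw [map_add]; exact Submodule.add_mem _ hx hy
    | smul c x _ hx => rw [map_smul]; exact Submodule.smul_mem _ c hx
  · refine (isNormalMap_conjₗ Ω.symm).map_wcl (X := Z₁) (fun T hT => le_wcl _ ?_) hT
    induction hT using Submodule.span_induction with
    | mem z hz =>
      obtain ⟨a, ha, c, hc, rfl⟩ := hz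
      refine Submodule.subset_span ⟨a, ha, c, hc, ?_⟩
      ext x
      change Ω.symm (Ω (τ a c (Ω.symm (Ω x)))) = τ a c x
      rw [Ω.symm_apply_apply, Ω.symm_apply_apply]
    | zero => rw [map_zero]; exact Submodule.zero_mem _
    | add x y _ _ hx hy => rw [map_add]; exact Submodule.add_mem _ hx hy
    | smul c x _ hx => rw [map_smul]; exact Submodule.smul_mem _ c hx

end Transfer

section TensorSpan

variable {E : Type*} [NormedAddCommGroup E] [InnerProductSpace ℂ E] [CompleteSpace E]
  {F : Type*} [NormedAddCommGroup F] [InnerProductSpace ℂ F] [CompleteSpace F]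
  {G : Type*} [NormedAddCommGroup G] [InnerProductSpace ℂ G] [CompleteSpace G]
  {t : E →ₗ[ℂ] F →ₗ[ℂ] G} {τ : B E →ₗ[ℂ] B F →ₗ[ℂ] B G}

/-- The span of the operators `a ⊗ c` with `a ∈ X`, as a submodule. -/
def ampTensorSpan (τ : B E →ₗ[ℂ] B F →ₗ[ℂ] B G) (X : Set (B E)) : Submodule ℂ (B G) :=
  Submodule.span ℂ {z | ∃ a ∈ X, ∃ c ∈ (Set.univ : Set (B F)), z = τ a c}

lemma mem_ampTensorSpan {X : Set (B E)} {a : B E} (ha : a ∈ X) (c : B F) :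
    τ a c ∈ ampTensorSpan τ X :=
  Submodule.subset_span ⟨a, ha, c, trivial, rfl⟩

lemma ampTensorSpan_le {X : Set (B E)} {Z : Submodule ℂ (B G)} (h : ∀ a ∈ X, ∀ c, τ a c ∈ Z) :
    ampTensorSpan τ X ≤ Z :=
  Submodule.span_le.2 fun _ ⟨a, ha, c, _, hz⟩ => hz ▸ h a ha c

lemma IsOpTensor.wcl_ampTensorSpan_wcl (ht : IsElemTensor t) (hτ : IsOpTensor t τ)
    (X : Submodule ℂ (B E)) :
    wcl (ampTensorSpan τ (wcl X : Set (B E))) = wcl (ampTensorSpan τ (X : Set (B E))) := by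
  refine le_antisymm (wcl_le (ampTensorSpan_le fun a ha c => ?_))
    (wcl_mono (ampTensorSpan_le fun a ha c => mem_ampTensorSpan (le_wcl X ha) c))
  exact (hτ.isNormalMap_left ht c).map_wcl
    (fun a ha => le_wcl _ (mem_ampTensorSpan (τ := τ) ha c)) ha

/-- The representation `a ↦ a ⊗ 1`. -/
def IsOpTensor.ampl (ht : IsElemTensor t) (hτ : IsOpTensor t τ) : B E →⋆ₐ[ℂ] B G where
  toFun a := τ a 1
  map_one' := hτ.map_one ht
  map_mul' a a' := by rw [← hτ.map_mul ht, one_mul]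
  map_zero' := by rw [map_zero, LinearMap.zero_apply]
  map_add' a a' := by rw [map_add, LinearMap.add_apply]
  commutes' c := by
    rw [Algebra.algebraMap_eq_smul_one, Algebra.algebraMap_eq_smul_one, map_smul,
      LinearMap.smul_apply, hτ.map_one ht]
  map_star' a := by rw [← hτ.map_star ht, star_one]

end TensorSpan

section Trivial

variable {W : Type*} [NormedAddCommGroup W] [InnerProductSpace ℂ W] [CompleteSpace W]

lemma hyperreflexive_of_subsingleton [Subsingleton W] (X : Submodule ℂ (B W)) :
    Hyperreflexive (X : Set (B W)) := by
  refine hyperreflexive_iff.2 ⟨1, one_pos, fun T c hc _ => ?_⟩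
  rw [Subsingleton.elim T 0, Metric.infDist_zero_of_mem X.zero_mem, one_mul]
  exact hc

lemma IsElemTensor.subsingleton {E F : Type*} [NormedAddCommGroup E] [InnerProductSpace ℂ E]
    [NormedAddCommGroup F] [InnerProductSpace ℂ F] [Subsingleton E] {t : E →ₗ[ℂ] F →ₗ[ℂ] W}
    (ht : IsElemTensor t) : Subsingleton W := by
  refine subsingleton_of_forall_eq 0 fun z => ht.eq_zero fun x y => ?_
  rw [Subsingleton.elim x 0, map_zero, LinearMap.zero_apply, inner_zero_left]

end Trivial

section Rearrange

variable {K : Type*} [NormedAddCommGroup K] [InnerProductSpace ℂ K] [CompleteSpace K]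
  {W : Type*} [NormedAddCommGroup W] [InnerProductSpace ℂ W] [CompleteSpace W]

/-- Operators compressing to scalar multiples of `c` between slices. -/
lemma block_eq_smul {S S' : K →L[ℂ] W} {T : B W} {c : B K} {r : ℂ}
    (h : ∀ x, ContinuousLinearMap.adjoint S (T (S' x)) = r • c x) :
    (S ∘L ContinuousLinearMap.adjoint S : B W) * T * (S' ∘L ContinuousLinearMap.adjoint S' : B W)
      = r • (S ∘L c ∘L ContinuousLinearMap.adjoint S' : B W) := by
  ext z
  simp only [mul_apply_eq_comp, ContinuousLinearMap.comp_apply, h, map_smul,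
    smul_apply]

variable {H : Type*} [NormedAddCommGroup H] [InnerProductSpace ℂ H] [CompleteSpace H]
  [TopologicalSpace.SeparableSpace H]
  {HK : Type*} [NormedAddCommGroup HK] [InnerProductSpace ℂ HK] [CompleteSpace HK]

/-- `(H ⊗ K) ⊗ ℓ²` is a realisation of `K ⊗ ℓ²`, in such a way that `B(H) ⊗ V ⊗ B(ℓ²)` and
`V ⊗ B(ℓ²)` have the same weak* closed span for every subspace `V` of `B(K)`. -/
theorem exists_rearrange [Nontrivial H] {t : H →ₗ[ℂ] K →ₗ[ℂ] HK}
    {τ : B H →ₗ[ℂ] B K →ₗ[ℂ] B HK} (ht : IsElemTensor t) (hτ : IsOpTensor t τ)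
    {t' : HK →ₗ[ℂ] ell2 →ₗ[ℂ] W} {τ' : B HK →ₗ[ℂ] B ell2 →ₗ[ℂ] B W} (ht' : IsElemTensor t')
    (hτ' : IsOpTensor t' τ') :
    ∃ (t₁ : K →ₗ[ℂ] ell2 →ₗ[ℂ] W) (τ₁ : B K →ₗ[ℂ] B ell2 →ₗ[ℂ] B W),
      IsElemTensor t₁ ∧ IsOpTensor t₁ τ₁ ∧ ∀ V : Set (B K),
        wcl (Submodule.span ℂ {z | ∃ a, ∃ c ∈ V, ∃ l, z = τ' (τ a c) l}) =
          wcl (ampTensorSpan τ₁ V) := by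
  classical
  obtain ⟨s, b, -⟩ := exists_hilbertBasis ℂ H
  have : Countable s := countable_of_orthonormal b.orthonormal
  have : Nonempty s := by
    by_contra hs
    rw [not_nonempty_iff] at hs
    obtain ⟨x, hx⟩ := exists_ne (0 : H)
    refine hx (b.repr.injective ?_)
    ext i
    exact hs.elim i
  obtain ⟨_⟩ := nonempty_denumerable (s × ℕ)
  let e := (Denumerable.eqv (s × ℕ)).symm
  let S : ℕ → K →L[ℂ] W := fun k =>
    ht'.slice (ellBasis (e k).2) ∘L ht.flip.slice (b (e k).1)
  have hS : IsSlices S := ((ht.flip.isSlices b).comp (ht'.isSlices ellBasis)).reindex e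
  have hSa : ∀ k x, S k x = t' (t (b (e k).1) x) (ellBasis (e k).2) := fun _ _ => rfl
  clear_value S
  obtain ⟨t₁, ht₁, htS⟩ := hS.exists_isElemTensor
  obtain ⟨τ₁, hτ₁⟩ := ht₁.exists_isOpTensor
  refine ⟨t₁, τ₁, ht₁, hτ₁, fun V => le_antisymm (wcl_le ?_) (wcl_le ?_)⟩
  · rw [Submodule.span_le]
    rintro _ ⟨a, c, hc, l, rfl⟩
    refine hS.isDecomp.mem_wcl fun m n => ?_
    rw [block_eq_smul (c := c)
      (r := ⟪b (e m).1, a (b (e n).1)⟫_ℂ * ⟪ellBasis (e m).2, l (ellBasis (e n).2)⟫_ℂ) fun x => ?_]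
    · have h : (S m ∘L c ∘L ContinuousLinearMap.adjoint (S n) : B W) =
          τ₁ c (rk (ellBasis m) (ellBasis n)) := hS.ext fun r x => by
        rw [ContinuousLinearMap.comp_apply, ContinuousLinearMap.comp_apply, hS.adjoint_apply,
          ← htS x r, hτ₁, rk_apply, map_smul, htS, orthonormal_iff_ite.1 ellBasis.orthonormal]
        split_ifs <;> simp
      rw [h]
      exact le_wcl _ (Submodule.smul_mem _ _ (mem_ampTensorSpan hc _))
    · refine ext_inner_left ℂ fun y => ?_
      rw [ContinuousLinearMap.adjoint_inner_right, hSa, hSa, hτ', hτ, ht'.1, ht.1,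
        inner_smul_right]
      ring
  · refine ampTensorSpan_le fun c hc l => hS.isDecomp.mem_wcl fun m n => ?_
    rw [block_eq_smul (c := c) (r := ⟪ellBasis m, l (ellBasis n)⟫_ℂ) fun x => ?_]
    · have h : (S m ∘L c ∘L ContinuousLinearMap.adjoint (S n) : B W) =
          τ' (τ (rk (b (e m).1) (b (e n).1)) c) (rk (ellBasis (e m).2) (ellBasis (e n).2)) :=
        hS.ext fun r x => by
          rw [ContinuousLinearMap.comp_apply, ContinuousLinearMap.comp_apply, hS.adjoint_apply,
            hSa r x, hτ', hτ, rk_apply, rk_apply]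
          split_ifs with hnr
          · subst hnr
            rw [inner_self_eq_norm_sq_to_K, inner_self_eq_norm_sq_to_K, b.orthonormal.1,
              ellBasis.orthonormal.1, hSa]
            simp
          · rw [map_zero, map_zero]
            by_cases h1 : (e n).1 = (e r).1
            · rw [ellBasis.orthonormal.2 fun h2 => hnr (e.injective (Prod.ext h1 h2)), zero_smul,
                map_zero]
            · rw [b.orthonormal.2 h1, zero_smul, map_zero, LinearMap.zero_apply, map_zero,
                LinearMap.zero_apply]
      rw [h]
      exact le_wcl _ (Submodule.smul_mem _ _ (Submodule.subset_span ⟨_, c, hc, _, rfl⟩))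
    · refine ext_inner_left ℂ fun y => ?_
      rw [ContinuousLinearMap.adjoint_inner_right, ← htS, ← htS, hτ₁, ht₁.1, inner_smul_right,
        mul_comm]

end Rearrange

end SchurHyper

/-- if `Φ₁, …, Φₙ ∈ 𝔠(H)` with `Xᵢ = ran Φᵢ` and `U₁, …, Uₙ` are
weak* closed subspaces of `B(K)` such that the weak* closure of every sum
`U_{i₁} + ⋯ + U_{iₘ}` over a nonempty index set is completely hyperreflexive,
then the weak* closed span `W` of `X₁⊗U₁ + ⋯ + Xₙ⊗Uₙ` in `B(H⊗K)` is
completely hyperreflexive. -/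
theorem stmt17 {H K HK : Type*}
    [NormedAddCommGroup H] [InnerProductSpace ℂ H] [CompleteSpace H]
    [TopologicalSpace.SeparableSpace H]
    [NormedAddCommGroup K] [InnerProductSpace ℂ K] [CompleteSpace K]
    [TopologicalSpace.SeparableSpace K]
    [NormedAddCommGroup HK] [InnerProductSpace ℂ HK] [CompleteSpace HK]
    (DH : StarSubalgebra ℂ (B H)) (hDH : IsMasa DH)
    (DK : StarSubalgebra ℂ (B K)) (hDK : IsMasa DK)
    (t : H →ₗ[ℂ] K →ₗ[ℂ] HK) (τ : B H →ₗ[ℂ] B K →ₗ[ℂ] B HK)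
    (ht : IsElemTensor t) (hτ : IsOpTensor t τ)
    (n : ℕ) (Φ : Fin n → (B H →L[ℂ] B H)) (hΦ : ∀ i, InC DH (Φ i))
    (U : Fin n → Submodule ℂ (B K)) (hU : ∀ i, WStarClosed K (U i : Set (B K)))
    (hUE : ∀ E : Finset (Fin n), E.Nonempty →
      CompletelyHyperreflexive
        (wStarClosure K ((⨆ i ∈ E, U i : Submodule ℂ (B K)) : Set (B K)))) :
    CompletelyHyperreflexive (wStarClosure HK
      ((Submodule.span ℂ
        {z : B HK | ∃ i, ∃ a ∈ Set.range ⇑(Φ i), ∃ c ∈ U i, z = τ a c} :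
          Submodule ℂ (B HK)) : Set (B HK))) := by
  intro W _ _ _ t' τ' ht' hτ'
  rcases subsingleton_or_nontrivial H with hH | hH
  · have : Subsingleton HK := ht.subsingleton
    have : Subsingleton W := ht'.subsingleton
    exact hyperreflexive_of_subsingleton (wcl (ampTensorSpan τ' _))
  let π := (hτ'.ampl ht').comp (hτ.ampl ht)
  let R : Fin n → Set (B W) := fun i => {r | ∃ c ∈ U i, ∃ l, r = τ' (τ 1 c) l}
  have hπ_apply : ∀ a, π a = τ' (τ a 1) 1 := fun _ => rfl
  have hmul : ∀ a c l, π a * τ' (τ 1 c) l = τ' (τ a c) l := fun a c l => by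
    rw [hπ_apply, ← hτ'.map_mul ht', ← hτ.map_mul ht, mul_one, one_mul, one_mul]
  have hπ : IsNormalMap (π : B H →ₗ[ℂ] B W) :=
    (hτ'.isNormalMap_left ht' 1).comp (hτ.isNormalMap_left ht 1)
  have hR : ∀ i, ∀ r ∈ R i, ∀ b, π b * r = r * π b := by
    rintro i _ ⟨c, -, l, rfl⟩ b
    rw [hmul, hπ_apply, ← hτ'.map_mul ht', ← hτ.map_mul ht, mul_one, mul_one, one_mul]
  obtain ⟨t₁, τ₁, ht₁, hτ₁, hspan⟩ := exists_rearrange ht hτ ht' hτ'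
  have hV : ∀ E : Finset (Fin n), E.Nonempty →
      Hyperreflexive (wcl (ampSpan π E (fun _ => Set.univ) R) : Set (B W)) := fun E hE => by
    have h := (hUE E hE).transfer ht₁ hτ₁
    rw [← coe_wcl] at h
    change Hyperreflexive (wcl (ampTensorSpan τ₁ _) : Set (B W)) at h
    rw [hτ₁.wcl_ampTensorSpan_wcl ht₁, ← hspan] at h
    convert h using 3
    refine le_antisymm (Submodule.span_le.2 ?_) (Submodule.span_le.2 ?_)
    · rintro _ ⟨i, hi, a, -, _, ⟨c, hc, l, rfl⟩, rfl⟩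
      exact Submodule.subset_span
        ⟨a, c, Submodule.mem_iSup_of_mem i (Submodule.mem_iSup_of_mem hi hc), l, hmul a c l⟩
    · rintro _ ⟨a, c, hc, l, rfl⟩
      have hle : (⨆ i ∈ E, U i) ≤
          (ampSpan π E (fun _ => Set.univ) R).comap (τ'.flip l ∘ₗ τ a) :=
        iSup₂_le fun i hi c hc => Submodule.subset_span
          ⟨i, hi, a, trivial, _, ⟨c, hc, l, rfl⟩, (hmul a c l).symm⟩
      exact hle hc
  have hmain := hyperreflexive_wcl_ampSpan hDH hπ Φ hΦ hR hV
  rw [← coe_wcl]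
  change Hyperreflexive (wcl (ampTensorSpan τ' _) : Set (B W))
  rw [hτ'.wcl_ampTensorSpan_wcl ht']
  convert hmain using 3
  refine le_antisymm (ampTensorSpan_le fun z hz l => ?_) (Submodule.span_le.2 ?_)
  · have hle : Submodule.span ℂ {z : B HK | ∃ i, ∃ a ∈ Set.range ⇑(Φ i), ∃ c ∈ U i, z = τ a c} ≤
        (ampSpan π Finset.univ (fun i => Set.range (Φ i)) R).comap (τ'.flip l) :=
      Submodule.span_le.2 fun _ ⟨i, a, ha, c, hc, hz⟩ => Submodule.subset_span
        ⟨i, Finset.mem_univ i, a, ha, _, ⟨c, hc, l, rfl⟩, by rw [hz, hmul]; rfl⟩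
    exact hle hz
  · rintro _ ⟨i, -, a, ha, _, ⟨c, hc, l, rfl⟩, rfl⟩
    rw [hmul]
    refine mem_ampTensorSpan ?_ l
    exact Submodule.subset_span ⟨i, a, ha, c, hc, rfl⟩
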